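/- Let n ≥ 1 and let Γ be a subgroup of ℋ(n,1) whose affine action on ℂ^{n+1} is properly discontinuous and cocompact. Then either Γ is virtually nilpotent, or Γ contains a subgroup of finite index that is abelian by cyclic. -/

import Mathlib

open Matrix

noncomputable section

/-- The ambient affine space ℂ^{n+1}. -/
abbrev HV (n : ℕ) : Type := Fin (n + 1) → ℂ

/-- The matrix of the Hermitian form of signature (n,1):
blocks of sizes 1, n-1, 1, with the antidiagonal 1's in the corners and the
identity in the middle block. -/
def HMat (n : ℕ) : Matrix (Fin (n + 1)) (Fin (n + 1)) ℂ := fun i j =>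
  if i = 0 ∧ j = Fin.last n then 1
  else if i = Fin.last n ∧ j = 0 then 1
  else if i = j ∧ i ≠ 0 ∧ i ≠ Fin.last n then 1
  else 0

/-- The group U(n,1) of matrices preserving the Hermitian form. -/
def USet (n : ℕ) : Set (Matrix (Fin (n + 1)) (Fin (n + 1)) ℂ) :=
  {A | Aᴴ * HMat n * A = HMat n}

/-- ℋ(n,1): affine transformations x ↦ A x + v with A ∈ U(n,1), viewed
as bijections of ℂ^{n+1}. -/
def HermAff (n : ℕ) : Set (Equiv.Perm (HV n)) :=
  {f | ∃ A ∈ USet n, ∃ v : HV n, ∀ x, f x = A.mulVec x + v}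

/-- A subgroup of bijections of ℂ^{n+1} acts properly discontinuously if for
every compact K only finitely many elements move K into a set meeting K. -/
def ProperlyDiscontinuous {n : ℕ} (Γ : Subgroup (Equiv.Perm (HV n))) : Prop :=
  ∀ K : Set (HV n), IsCompact K →
    {γ : Equiv.Perm (HV n) | γ ∈ Γ ∧ ((⇑γ '' K) ∩ K).Nonempty}.Finite

/-- The action is cocompact if the quotient topological space is compact. -/
def Cocompact {n : ℕ} (Γ : Subgroup (Equiv.Perm (HV n))) : Prop :=
  CompactSpace (Quotient (MulAction.orbitRel Γ (HV n)))

/-- A group is virtually nilpotent if it has a nilpotent subgroup of finite index. -/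
def VirtuallyNilpotent (G : Type*) [Group G] : Prop :=
  ∃ H : Subgroup G, H.FiniteIndex ∧ Group.IsNilpotent H

/-- A group is abelian by cyclic if it has a normal abelian subgroup whose
quotient is cyclic (the quotient being cyclic is expressed via cosets). -/
def AbelianByCyclic (G : Type*) [Group G] : Prop :=
  ∃ A : Subgroup G, A.Normal ∧ (∀ x y : A, x * y = y * x) ∧
    ∃ g : G, ∀ x : G, ∃ k : ℤ, x * (g ^ k)⁻¹ ∈ A

noncomputable section
namespace HLC
open scoped commutatorElement

/-- The conclusion of the theorem for an abstract group. -/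
def Concl (G : Type*) [Group G] : Prop :=
  VirtuallyNilpotent G ∨ ∃ Γ₀ : Subgroup G, Γ₀.FiniteIndex ∧ AbelianByCyclic Γ₀

theorem abc_of_mulEquiv {G G' : Type*} [Group G] [Group G'] (e : G ≃* G')
    (h : AbelianByCyclic G) : AbelianByCyclic G' := by
  obtain ⟨A, hA, hab, g, hg⟩ := h
  refine ⟨A.map e.toMonoidHom, hA.map _ e.surjective, ?_, e g, ?_⟩
  · rintro ⟨x, x', hx, rfl⟩ ⟨y, y', hy, rfl⟩
    have := congrArg Subtype.val (hab ⟨x', hx⟩ ⟨y', hy⟩)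
    ext
    simp only [Subgroup.coe_mul] at this ⊢
    change e x' * e y' = e y' * e x'
    rw [← map_mul, ← map_mul]; exact congrArg e this
  · intro x
    obtain ⟨k, hk⟩ := hg (e.symm x)
    refine ⟨k, _, hk, ?_⟩
    simp

theorem vn_of_subgroup {G : Type*} [Group G] (H : Subgroup G) [H.FiniteIndex]
    (h : VirtuallyNilpotent H) : VirtuallyNilpotent G := by
  obtain ⟨K, hK, hn⟩ := h
  refine ⟨K.map H.subtype, ?_, ?_⟩
  · constructor
    rw [Subgroup.index_map_subtype]
    exact mul_ne_zero hK.index_ne_zero Subgroup.FiniteIndex.index_ne_zero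
  · exact Group.nilpotent_of_mulEquiv (K.equivMapOfInjective H.subtype H.subtype_injective)

theorem concl_of_subgroup {G : Type*} [Group G] (H : Subgroup G) [H.FiniteIndex]
    (h : Concl H) : Concl G := by
  rcases h with h | ⟨K, hK, hn⟩
  · exact Or.inl (vn_of_subgroup H h)
  · refine Or.inr ⟨K.map H.subtype, ?_, ?_⟩
    · constructor
      rw [Subgroup.index_map_subtype]
      exact mul_ne_zero hK.index_ne_zero Subgroup.FiniteIndex.index_ne_zero
    · exact abc_of_mulEquiv (K.equivMapOfInjective H.subtype H.subtype_injective) hn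

theorem concl_of_nilpotent_fi {G : Type*} [Group G] (H : Subgroup G) [hH : H.FiniteIndex]
    (h : Group.IsNilpotent H) : Concl G := Or.inl ⟨H, hH, h⟩

/-- (FI0) -/
theorem fi_of_finite_range {G X : Type*} [Group G] (C : Subgroup G) (f : G → X)
    (hf : (Set.range f).Finite) (h : ∀ b b', f b = f b' → b⁻¹ * b' ∈ C) : C.FiniteIndex := by
  have : Finite (Set.range f) := hf
  have hfin : Finite (G ⧸ C) := by
    have hinj : Function.Injective (fun q : G ⧸ C => (⟨f q.out, q.out, rfl⟩ : Set.range f)) := by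
      intro q q' hq
      have := h _ _ (congrArg Subtype.val hq)
      rw [← QuotientGroup.eq] at this
      simpa using this
    exact Finite.of_injective _ hinj
  exact Subgroup.finiteIndex_of_finite_quotient

section Zass
variable {R : Type*} [NormedRing R] {G : Type*} [Group G]

theorem norm_mul_inv_le (ρ : G →* R) (X : R) (c : G) (hc : ‖ρ c - 1‖ ≤ 1/8) :
    ‖X * ρ c⁻¹‖ ≤ 8/7 * ‖X‖ := by
  have h1 : ρ c⁻¹ * ρ c = 1 := by rw [← map_mul]; simp
  have h2 : X * ρ c⁻¹ = X - (X * ρ c⁻¹) * (ρ c - 1) := by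
    rw [mul_sub, mul_assoc, h1]; simp
  have h3 : ‖X * ρ c⁻¹‖ ≤ ‖X‖ + ‖X * ρ c⁻¹‖ * (1/8) := by
    calc ‖X * ρ c⁻¹‖ = ‖X - (X * ρ c⁻¹) * (ρ c - 1)‖ := by rw [← h2]
      _ ≤ ‖X‖ + ‖(X * ρ c⁻¹) * (ρ c - 1)‖ := norm_sub_le _ _
      _ ≤ ‖X‖ + ‖X * ρ c⁻¹‖ * (1/8) := by
        gcongr
        exact (norm_mul_le _ _).trans (by gcongr)
  linarith

theorem norm_comm_le (ρ : G →* R) (c s : G) (hc : ‖ρ c - 1‖ ≤ 1/8) (hs : ‖ρ s - 1‖ ≤ 1/8) :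
    ‖ρ ⁅c, s⁆ - 1‖ ≤ ‖ρ c - 1‖ / 2 := by
  set X := (ρ c - 1) * (ρ s - 1) - (ρ s - 1) * (ρ c - 1) with hX
  have hXn : ‖X‖ ≤ ‖ρ c - 1‖ / 4 := by
    calc ‖X‖ ≤ ‖(ρ c - 1) * (ρ s - 1)‖ + ‖(ρ s - 1) * (ρ c - 1)‖ := norm_sub_le _ _
      _ ≤ ‖ρ c - 1‖ * ‖ρ s - 1‖ + ‖ρ s - 1‖ * ‖ρ c - 1‖ := by
        gcongr <;> exact norm_mul_le _ _
      _ ≤ ‖ρ c - 1‖ * (1/8) + (1/8) * ‖ρ c - 1‖ := by gcongr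
      _ = _ := by ring
  have e : ρ ⁅c, s⁆ - 1 = X * ρ c⁻¹ * ρ s⁻¹ := by
    have h1 : ρ s * ρ c * (ρ c⁻¹ * ρ s⁻¹) = 1 := by
      simp only [← map_mul]; simp [mul_assoc]
    have : X = ρ c * ρ s - ρ s * ρ c := by rw [hX]; noncomm_ring
    rw [this, mul_assoc, sub_mul, h1, commutatorElement_def]
    simp only [map_mul, mul_assoc]
  rw [e]
  have := norm_mul_inv_le ρ (X * ρ c⁻¹) s hs
  have := norm_mul_inv_le ρ X c hc
  have := norm_nonneg (ρ c - 1)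
  linarith

theorem zassenhaus (ρ : G →* R) (S : Set G) (hS : Subgroup.closure S = ⊤)
    (hs : ∀ s ∈ S, ‖ρ s - 1‖ ≤ 1/8) (δ : ℝ) (hδ : 0 < δ)
    (hd : ∀ g, ‖ρ g - 1‖ < δ → g = 1) : Group.IsNilpotent G := by
  have key : ∀ i : ℕ, ∀ c : G, ‖ρ c - 1‖ ≤ 1/8 → ‖ρ c - 1‖ < δ * 2 ^ i →
      c ∈ Subgroup.upperCentralSeries G i := by
    intro i
    induction i with
    | zero => intro c _ h; simp at h; simpa using hd c h
    | succ i ih =>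
      intro c hc h
      rw [Subgroup.mem_upperCentralSeries_succ_iff]
      intro y
      have hy : y ∈ Subgroup.closure S := by rw [hS]; trivial
      have hN : (Subgroup.upperCentralSeries G i).Normal := inferInstance
      induction hy using Subgroup.closure_induction with
      | mem s hsS =>
        have := norm_comm_le ρ c s hc (hs s hsS)
        have h0 := norm_nonneg (ρ c - 1)
        refine ih _ (by linarith) ?_
        rw [pow_succ] at h; linarith
      | one => simp [commutatorElement_def, (Subgroup.upperCentralSeries G i).one_mem]
      | mul a b _ _ ha hb =>
        have : ⁅c, a * b⁆ = ⁅c, a⁆ * (a * ⁅c, b⁆ * a⁻¹) := by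
          simp only [commutatorElement_def]; group
        rw [this]
        exact mul_mem ha (hN.conj_mem _ hb a)
      | inv a _ ha =>
        have : ⁅c, a⁻¹⁆ = a⁻¹ * ⁅c, a⁆⁻¹ * a⁻¹⁻¹ := by
          simp only [commutatorElement_def]; group
        rw [this]
        exact hN.conj_mem _ (inv_mem ha) a⁻¹
  obtain ⟨N, hN⟩ := pow_unbounded_of_one_lt (1 / (8 * δ)) (by norm_num : (1:ℝ) < 2)
  refine ⟨N, ?_⟩
  rw [eq_top_iff, ← hS, Subgroup.closure_le]
  intro s hsS
  refine key N s (hs s hsS) ((hs s hsS).trans_lt ?_)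
  rw [div_lt_iff₀ (by positivity)] at hN
  linarith

end Zass

section Flag
variable {k M : Type*} [Field k] [AddCommGroup M] [Module k M]

/-- The flag attached to a set of endomorphisms, starting at `B`. -/
def Fl (S : Set (M →ₗ[k] M)) (B : Submodule k M) : ℕ → Submodule k M
  | 0 => B
  | i + 1 => ⨅ s ∈ S, (Fl S B i).comap (s - 1)

theorem mem_Fl_succ {S : Set (M →ₗ[k] M)} {B : Submodule k M} {i : ℕ} {v : M} :
    v ∈ Fl S B (i+1) ↔ ∀ s ∈ S, s v - v ∈ Fl S B i := by
  simp [Fl, Submodule.mem_iInf]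

theorem Fl_mono_base (S : Set (M →ₗ[k] M)) {B B' : Submodule k M} (h : B ≤ B') (i : ℕ) :
    Fl S B i ≤ Fl S B' i := by
  induction i with
  | zero => exact h
  | succ i ih => intro v hv; rw [mem_Fl_succ] at *; exact fun s hs => ih (hv s hs)

theorem Fl_anti {S S' : Set (M →ₗ[k] M)} (h : S ⊆ S') (B : Submodule k M) (i : ℕ) :
    Fl S' B i ≤ Fl S B i := by
  induction i with
  | zero => exact le_rfl
  | succ i ih => intro v hv; rw [mem_Fl_succ] at *; exact fun s hs => ih (hv s (h hs))

theorem Fl_add (S : Set (M →ₗ[k] M)) (B : Submodule k M) (i j : ℕ) :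
    Fl S B (i + j) = Fl S (Fl S B i) j := by
  induction j with
  | zero => rfl
  | succ j ih => rw [← add_assoc]; ext v; rw [mem_Fl_succ, mem_Fl_succ, ih]

theorem Fl_le_succ {S : Set (M →ₗ[k] M)} {B : Submodule k M}
    (hB : ∀ s ∈ S, ∀ v ∈ B, s v ∈ B) (i : ℕ) : Fl S B i ≤ Fl S B (i+1) := by
  induction i with
  | zero => intro v hv; rw [mem_Fl_succ]; exact fun s hs => sub_mem (hB s hs v hv) hv
  | succ i ih => intro v hv; rw [mem_Fl_succ] at *; exact fun s hs => ih (hv s hs)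

theorem Fl_mono {S : Set (M →ₗ[k] M)} {B : Submodule k M}
    (hB : ∀ s ∈ S, ∀ v ∈ B, s v ∈ B) : Monotone (Fl S B) :=
  monotone_nat_of_le_succ (Fl_le_succ hB)

theorem Fl_inv {S : Set (M →ₗ[k] M)} {B : Submodule k M}
    (hB : ∀ s ∈ S, ∀ v ∈ B, s v ∈ B) (i : ℕ) {s} (hs : s ∈ S) {v : M} (hv : v ∈ Fl S B i) :
    s v ∈ Fl S B i := by
  have := Fl_le_succ hB i hv
  rw [mem_Fl_succ] at this
  simpa using add_mem (this s hs) hv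

theorem Fl_le_finrank [FiniteDimensional k M] (S : Set (M →ₗ[k] M)) (i : ℕ) :
    Fl S ⊥ i ≤ Fl S ⊥ (Module.finrank k M) := by
  have hB : ∀ s ∈ S, ∀ v ∈ (⊥ : Submodule k M), s v ∈ (⊥ : Submodule k M) := by
    intro s _ v hv; simp at hv; simp [hv]
  have hm := Fl_mono hB
  have stab : ∀ j, Fl S ⊥ j = Fl S ⊥ (j+1) → ∀ m, Fl S ⊥ (j + m) = Fl S ⊥ j := by
    intro j h m
    induction m with
    | zero => rfl
    | succ m ih =>
      rw [← add_assoc]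
      rw [h]
      ext v; rw [mem_Fl_succ, mem_Fl_succ, ih]
  have : ∀ j, (∃ l < j, Fl S ⊥ l = Fl S ⊥ (l+1)) ∨ j ≤ Module.finrank k (Fl S ⊥ j) := by
    intro j
    induction j with
    | zero => right; exact Nat.zero_le _
    | succ j ih =>
      rcases ih with ⟨l, hl, h⟩ | ih
      · exact Or.inl ⟨l, by omega, h⟩
      by_cases h : Fl S ⊥ j = Fl S ⊥ (j+1)
      · exact Or.inl ⟨j, by omega, h⟩
      · right
        have := Submodule.finrank_lt_finrank_of_lt (lt_of_le_of_ne (hm (show j ≤ j + 1 by omega)) h)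
        omega
  set d := Module.finrank k M
  rcases this (d+1) with ⟨l, hl, h⟩ | h
  · rcases le_total i d with hi | hi
    · exact hm hi
    · have h1 := stab l h (i - l)
      have h2 := stab l h (d - l)
      rw [show l + (i - l) = i by omega] at h1
      rw [show l + (d - l) = d by omega] at h2
      rw [h1, h2]
  · have := Submodule.finrank_le (Fl S ⊥ (d+1))
    omega

/-- finite character of the flag -/
theorem Fl_finite {S : Set (M →ₗ[k] M)} {B : Submodule k M} {i : ℕ} {v : M}
    (h : v ∉ Fl S B i) : ∃ F : Set (M →ₗ[k] M), F.Finite ∧ F ⊆ S ∧ v ∉ Fl F B i := by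
  induction i generalizing v with
  | zero => exact ⟨∅, Set.finite_empty, Set.empty_subset _, h⟩
  | succ i ih =>
    rw [mem_Fl_succ] at h
    push Not at h
    obtain ⟨s, hs, hv⟩ := h
    obtain ⟨F, hF, hFS, hFv⟩ := ih hv
    refine ⟨insert s F, hF.insert s, Set.insert_subset hs hFS, ?_⟩
    rw [mem_Fl_succ]
    push Not
    exact ⟨s, Set.mem_insert _ _, fun h => hFv (Fl_anti (Set.subset_insert _ _) _ _ h)⟩

/-- a linear map intertwining two families carries flags into flags -/
theorem Fl_map {M' ι : Type*} [AddCommGroup M'] [Module k M'] (a : ι → M →ₗ[k] M)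
    (a' : ι → M' →ₗ[k] M') (f : M →ₗ[k] M') (hf : ∀ i v, f (a i v) = a' i (f v))
    {B : Submodule k M} {B' : Submodule k M'} (hB : ∀ v ∈ B, f v ∈ B') (j : ℕ) :
    ∀ v ∈ Fl (Set.range a) B j, f v ∈ Fl (Set.range a') B' j := by
  induction j with
  | zero => exact hB
  | succ j ih =>
    intro v hv
    rw [mem_Fl_succ] at *
    rintro _ ⟨i, rfl⟩
    have := ih _ (hv (a i) ⟨i, rfl⟩)
    rwa [map_sub, hf] at this

theorem Fl_comap {M' ι : Type*} [AddCommGroup M'] [Module k M'] (a : ι → M →ₗ[k] M)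
    (a' : ι → M' →ₗ[k] M') (f : M →ₗ[k] M') (hf : ∀ i v, f (a i v) = a' i (f v))
    {B : Submodule k M} {B' : Submodule k M'} (hB : ∀ v, f v ∈ B' → v ∈ B) (j : ℕ) :
    ∀ v, f v ∈ Fl (Set.range a') B' j → v ∈ Fl (Set.range a) B j := by
  induction j with
  | zero => exact hB
  | succ j ih =>
    intro v hv
    rw [mem_Fl_succ] at *
    rintro _ ⟨i, rfl⟩
    have := hv (a' i) ⟨i, rfl⟩
    rw [← hf, ← map_sub] at this
    exact ih _ this

theorem FlagNil {G : Type*} [Group G] (ρ : G →* (M →ₗ[k] M)) (hinj : ∀ g, ρ g = 1 → g = 1)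
    (N : ℕ) (hN : Fl (Set.range ρ) ⊥ N = ⊤) : Group.IsNilpotent G := by
  have hB : ∀ s ∈ Set.range ρ, ∀ v ∈ (⊥ : Submodule k M), s v ∈ (⊥ : Submodule k M) := by
    intro s _ v hv; simp at hv; simp [hv]
  set W := Fl (Set.range ρ) ⊥ with hW
  have hm : Monotone W := Fl_mono hB
  have hstep : ∀ g i v, v ∈ W (i+1) → ρ g v - v ∈ W i := fun g i v hv =>
    (mem_Fl_succ.1 hv) _ ⟨g, rfl⟩
  have hWinv : ∀ g i v, v ∈ W i → ρ g v ∈ W i := fun g i v hv => Fl_inv hB i ⟨g, rfl⟩ hv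
  let D : ℕ → Subgroup G := fun j =>
    { carrier := {g | ∀ i v, v ∈ W (i + j) → ρ g v - v ∈ W i}
      one_mem' := by intro i v _; simp
      mul_mem' := by
        intro a b ha hb i v hv
        have e : ρ (a * b) v - v = ρ a (ρ b v - v) + (ρ a v - v) := by simp
        rw [e]
        exact add_mem (hWinv _ _ _ (hb i v hv)) (ha i v hv)
      inv_mem' := by
        intro a ha i v hv
        have e : ρ a⁻¹ v - v = - (ρ a⁻¹ (ρ a v - v)) := by
          have : ρ a⁻¹ (ρ a v) = v := by
            rw [← Module.End.mul_apply, ← map_mul]; simp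
          rw [map_sub, this]; abel
        rw [e]
        exact neg_mem (hWinv _ _ _ (ha i v hv)) }
  refine (Subgroup.nilpotent_iff_finite_descending_central_series (G := G)).2
    ⟨N, fun j => D (j+1), ⟨?_, ?_⟩, ?_⟩
  · rw [eq_top_iff]; intro g _ i v hv; exact hstep g i v hv
  · intro x n hx g i v hv
    rw [commutatorElement_def]
    have e : ρ (x * g * x⁻¹ * g⁻¹) v - v
        = ρ (x * g) ((fun w => w) (ρ (x⁻¹ * g⁻¹) v)) - ρ (g * x) (ρ (x⁻¹ * g⁻¹) v) := by
      have h1 : ρ (g * x) (ρ (x⁻¹ * g⁻¹) v) = v := by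
        rw [← Module.End.mul_apply, ← map_mul]; simp [mul_assoc]
      rw [h1]
      simp [mul_assoc]
    rw [e]
    set w := ρ (x⁻¹ * g⁻¹) v with hw
    have hwm : w ∈ W (i + (n + 1 + 1)) := hWinv _ _ _ hv
    have e2 : ρ (x * g) w - ρ (g * x) w
        = (ρ x (ρ g w - w) - (ρ g w - w)) - (ρ g (ρ x w - w) - (ρ x w - w)) := by
      simp [map_sub]; abel
    show ρ (x * g) w - ρ (g * x) w ∈ W i
    rw [e2]
    refine sub_mem ?_ ?_
    · exact hx i _ (hstep g (i + (n+1)) w hwm)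
    · refine hstep g i _ (hx (i+1) w ?_)
      convert hwm using 2; ring
  · rw [eq_bot_iff]
    intro g hg
    rw [Subgroup.mem_bot]
    apply hinj
    ext v
    have : v ∈ W (0 + (N+1)) := by
      have h1 : v ∈ W N := by rw [hN]; trivial
      exact hm (by omega) h1
    have h2 := hg 0 v this
    have h3 : ρ g v - v ∈ (⊥ : Submodule k M) := h2
    rw [Submodule.mem_bot] at h3
    simpa using sub_eq_zero.1 h3

/-- (BU): unipotent with bounded powers is trivial -/
theorem bounded_unipotent {R : Type*} [NormedRing R] [NormedAlgebra ℝ R] (A : R) (N : ℕ)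
    (hN : (A - 1) ^ N = 0) (C : ℝ) (hC : ∀ j : ℕ, ‖A ^ j‖ ≤ C) : A = 1 := by
  by_contra hne
  set X := A - 1 with hX
  have hX0 : X ≠ 0 := sub_ne_zero.2 hne
  classical
  have hex : ∃ m, X ^ m = 0 := ⟨N, hN⟩
  set m := Nat.find hex with hm
  have hm0 : X ^ m = 0 := Nat.find_spec hex
  have hm2 : 2 ≤ m := by
    by_contra h
    have : m = 0 ∨ m = 1 := by omega
    rcases this with h | h
    · rw [h, pow_zero] at hm0
      exact hX0 (by rw [← mul_one X, hm0, mul_zero])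
    · rw [h, pow_one] at hm0; exact hX0 hm0
  have hm1 : X ^ (m - 1) ≠ 0 := Nat.find_min hex (by omega)
  have hA : A = 1 + X := by rw [hX]; abel
  have hp : ∀ j : ℕ, A ^ j * X ^ (m - 2) = X ^ (m-2) + (j : ℝ) • X ^ (m - 1) := by
    intro j
    induction j with
    | zero => simp
    | succ j ih =>
      have e1 : X * X ^ (m - 2) = X ^ (m-1) := by rw [← pow_succ']; congr 1; omega
      have e2 : X * X ^ (m - 1) = 0 := by rw [← pow_succ', ← hm0]; congr 1; omega
      rw [pow_succ', mul_assoc, ih, hA, add_mul, one_mul, mul_add, mul_smul_comm, e1, e2]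
      push_cast
      rw [add_smul]; simp [add_assoc]
  have hb : ∀ j : ℕ, (j : ℝ) * ‖X ^ (m-1)‖ ≤ C * ‖X ^ (m-2)‖ + ‖X ^ (m-2)‖ := by
    intro j
    have : (j : ℝ) • X ^ (m - 1) = A ^ j * X ^ (m - 2) - X ^ (m-2) := by rw [hp]; abel
    calc (j : ℝ) * ‖X ^ (m-1)‖ = ‖(j : ℝ) • X ^ (m - 1)‖ := by rw [norm_smul]; simp
      _ ≤ ‖A ^ j * X ^ (m - 2)‖ + ‖X ^ (m-2)‖ := by rw [this]; exact norm_sub_le _ _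
      _ ≤ _ := by
        gcongr
        exact (norm_mul_le _ _).trans (by gcongr; exact hC j)
  have hpos : 0 < ‖X ^ (m-1)‖ := norm_pos_iff.2 hm1
  obtain ⟨j, hj⟩ := exists_nat_gt ((C * ‖X ^ (m-2)‖ + ‖X ^ (m-2)‖) / ‖X ^ (m-1)‖)
  rw [div_lt_iff₀ hpos] at hj
  exact absurd (hb j) (not_le.2 hj)

end Flag

section Nilp
variable {k : Type*} [Field k]

/-- restriction of a representation to an invariant submodule -/
def resRep {G M : Type*} [Group G] [AddCommGroup M] [Module k M] (ρ : G →* (M →ₗ[k] M))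
    (N : Submodule k M) (hN : ∀ g, ∀ v ∈ N, ρ g v ∈ N) : G →* (N →ₗ[k] N) where
  toFun g := (ρ g).restrict (hN g)
  map_one' := by ext v; simp
  map_mul' a b := by ext v; simp

/-- quotient representation -/
def quoRep {G M : Type*} [Group G] [AddCommGroup M] [Module k M] (ρ : G →* (M →ₗ[k] M))
    (N : Submodule k M) (hN : ∀ g, ∀ v ∈ N, ρ g v ∈ N) : G →* ((M ⧸ N) →ₗ[k] (M ⧸ N)) where
  toFun g := N.mapQ N (ρ g) (hN g)
  map_one' := by ext v; simp
  map_mul' a b := by ext v; simp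

def USt (k : Type*) [Field k] (G : Type*) [Group G] (M : Type*) [AddCommGroup M] [Module k M] :
    Prop :=
  ∀ (ρ : G →* (M →ₗ[k] M)) (l : M →ₗ[k] k), (∀ g v, l (ρ g v) = l v) → l ≠ 0 →
    ∃ i, ∃ v ∈ Fl (Set.range ρ) ⊥ i, l v ≠ 0

theorem USt_step {G M : Type*} [Group G] [AddCommGroup M] [Module k M] [FiniteDimensional k M]
    (hq : USt k (G ⧸ Subgroup.center G) M)
    (hsub : ∀ N : Submodule k M, N ≠ ⊤ → USt k G N)
    (hquo : ∀ N : Submodule k M, N ≠ ⊥ → USt k G (M ⧸ N)) : USt k G M := by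
  intro ρ l hl hl0
  -- restriction principle
  have restr : ∀ N : Submodule k M, N ≠ ⊤ → (∀ g, ∀ v ∈ N, ρ g v ∈ N) → (∃ v ∈ N, l v ≠ 0) →
      ∃ i, ∃ v ∈ Fl (Set.range ρ) ⊥ i, l v ≠ 0 := by
    rintro N hN hinv ⟨v, hv, hlv⟩
    obtain ⟨i, w, hw, hlw⟩ := hsub N hN (resRep ρ N hinv) (l.comp N.subtype)
      (fun g v => by simpa [resRep] using hl g v)
      (fun h => hlv (by simpa using LinearMap.congr_fun h ⟨v, hv⟩))
    refine ⟨i, w, ?_, hlw⟩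
    exact Fl_map (resRep ρ N hinv) ρ N.subtype (fun g v => rfl) (by simp) i w hw
  by_cases hc : ∀ z ∈ Subgroup.center G, ρ z = 1
  · obtain ⟨i, v, hv, hlv⟩ := hq (QuotientGroup.lift (Subgroup.center G) ρ hc) l
      (fun g v => by
        obtain ⟨g, rfl⟩ := QuotientGroup.mk_surjective g
        exact hl g v) hl0
    refine ⟨i, v, Fl_anti ?_ _ _ hv, hlv⟩
    rintro _ ⟨g, rfl⟩
    exact ⟨(g : G ⧸ Subgroup.center G), rfl⟩
  push Not at hc
  obtain ⟨z, hz, hz1⟩ := hc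
  set T := ρ z - 1 with hT
  have hT0 : T ≠ 0 := sub_ne_zero.2 hz1
  have hcomm : ∀ g, Commute (ρ g) T := by
    intro g
    have : ρ g * ρ z = ρ z * ρ g := by
      rw [← map_mul, ← map_mul, Subgroup.mem_center_iff.1 hz g]
    show ρ g * T = T * ρ g
    rw [hT, mul_sub, sub_mul, this]; simp
  have hlT : ∀ v, l (T v) = 0 := by intro v; simp [hT, hl]
  obtain ⟨v0, hv0⟩ : ∃ v, l v ≠ 0 := by
    by_contra h; push Not at h; exact hl0 (LinearMap.ext h)
  set d := Module.finrank k M with hd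
  have hdpos : 0 < d := by
    have : Nontrivial M := ⟨v0, 0, by rintro rfl; simp at hv0⟩
    exact Module.finrank_pos
  by_cases hnil : T ^ d = 0
  swap
  · refine restr (LinearMap.ker (T ^ d)) ?_ ?_ ?_
    · intro h; exact hnil (LinearMap.ker_eq_top.1 h)
    · intro g v hv
      rw [LinearMap.mem_ker] at *
      have := ((hcomm g).pow_right d).eq
      rw [← Module.End.mul_apply, ← this, Module.End.mul_apply, hv, map_zero]
    · by_contra hcon
      push Not at hcon
      have hco := LinearMap.isCompl_iSup_ker_pow_iInf_range_pow T
      have h1 : (⨆ n, LinearMap.ker (T ^ n)) ≤ LinearMap.ker l := by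
        rw [iSup_le_iff]
        intro n x hx
        rw [LinearMap.mem_ker]
        apply hcon
        exact Module.End.ker_pow_le_ker_pow_finrank T n hx
      have h2 : (⨅ n, LinearMap.range (T ^ n)) ≤ LinearMap.ker l := by
        refine (iInf_le _ 1).trans ?_
        rintro _ ⟨x, rfl⟩
        simp [hlT]
      have h3 : (⊤ : Submodule k M) ≤ LinearMap.ker l := by
        rw [← hco.sup_eq_top]; exact sup_le h1 h2
      exact hv0 (h3 (Submodule.mem_top (x := v0)))
  · set B := LinearMap.range T with hBdef
    have hBinv : ∀ g, ∀ v ∈ B, ρ g v ∈ B := by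
      rintro g _ ⟨w, rfl⟩
      exact ⟨ρ g w, by rw [← Module.End.mul_apply, ← (hcomm g).eq]; rfl⟩
    have hB0 : B ≠ ⊥ := fun h => hT0 (LinearMap.range_eq_bot.1 h)
    have hBl : B ≤ LinearMap.ker l := by rintro _ ⟨w, rfl⟩; exact hlT w
    have hle : ∀ s ∈ Set.range ρ, ∀ v ∈ B, s v ∈ B := by rintro _ ⟨g, rfl⟩; exact hBinv g
    obtain ⟨i, w, hw, hlw⟩ := hquo B hB0 (quoRep ρ B hBinv) (B.liftQ l hBl)
      (fun g v => by
        obtain ⟨v, rfl⟩ := Submodule.mkQ_surjective B v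
        simpa [quoRep] using hl g v)
      (fun h => hv0 (by simpa using LinearMap.congr_fun h (B.mkQ v0)))
    obtain ⟨w, rfl⟩ := Submodule.mkQ_surjective B w
    have hwF : w ∈ Fl (Set.range ρ) B i :=
      Fl_comap ρ (quoRep ρ B hBinv) B.mkQ (fun g v => rfl) (by simp) i w hw
    by_cases hY : Fl (Set.range ρ) B i = ⊤
    · -- everything is unipotent
      have hk : ∀ m, LinearMap.range (T ^ (d - m)) ≤ Fl (Set.range ρ) ⊥ (m * i) := by
        intro m
        induction m with
        | zero => simp [hnil, Fl]
        | succ m ih =>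
          by_cases hmd : d ≤ m
          · have : d - (m+1) = d - m := by omega
            rw [this]
            refine ih.trans (Fl_mono ?_ ?_)
            · intro s _ v hv; simp at hv; simp [hv]
            · rw [add_mul]; omega
          rintro _ ⟨x, rfl⟩
          rw [add_mul, one_mul, Fl_add]
          refine Fl_mono_base _ ih i ?_
          refine Fl_map ρ ρ (T ^ (d - (m+1))) (fun g v => ?_) (B := B) ?_ i x (by rw [hY]; trivial)
          · rw [← Module.End.mul_apply, ← ((hcomm g).pow_right _).eq]; rfl
          · rintro _ ⟨y, rfl⟩
            refine ⟨y, ?_⟩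
            rw [← Module.End.mul_apply, ← pow_succ]
            congr 2; omega
      refine ⟨d * i, v0, hk d ?_, hv0⟩
      simp
    · refine restr _ hY (fun g v hv => Fl_inv hle i ⟨g, rfl⟩ hv) ⟨w, hwF, by simpa using hlw⟩

universe uu vv in
theorem nilpotent_flag_aux (k : Type*) [Field k] (G : Type uu) [Group G] (hG : Group.IsNilpotent G) :
    ∀ (n : ℕ) (M : Type vv) [AddCommGroup M] [Module k M] [FiniteDimensional k M],
      Module.finrank k M = n → USt k G M := by
  refine Group.nilpotent_center_quotient_ind
    (P := fun (G : Type uu) _ _ => ∀ (n : ℕ) (M : Type vv) [AddCommGroup M] [Module k M]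
      [FiniteDimensional k M], Module.finrank k M = n → USt k G M) G ?_ ?_
  · intro G _ _ n M _ _ _ _ ρ l hl hl0
    obtain ⟨v0, hv0⟩ : ∃ v, l v ≠ 0 := by
      by_contra h; push Not at h; exact hl0 (LinearMap.ext h)
    refine ⟨1, v0, ?_, hv0⟩
    rw [mem_Fl_succ]
    rintro _ ⟨g, rfl⟩
    rw [Subsingleton.elim g 1]; simp
  · intro G _ _ ih n
    induction n using Nat.strong_induction_on with
    | _ n ihn =>
      intro M _ _ _ hM
      refine USt_step (ih n M hM) ?_ ?_
      · intro N hN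
        exact ihn _ (hM ▸ Submodule.finrank_lt hN) N rfl
      · intro N hN
        refine ihn _ ?_ (M ⧸ N) rfl
        have := N.finrank_quotient_add_finrank
        have h2 : 0 < Module.finrank k N := by
          rw [Module.finrank_pos_iff, Submodule.nontrivial_iff_ne_bot]; exact hN
        omega

/-- (U) -/
theorem nilpotent_flag {G M : Type*} [Group G] [hG : Group.IsNilpotent G] [AddCommGroup M]
    [Module k M] [FiniteDimensional k M] : USt k G M :=
  nilpotent_flag_aux k G hG _ M rfl

end Nilp
end HLC
end

noncomputable section
namespace HLC
open Filter Topology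
set_option linter.unusedSectionVars false

theorem exists_min_nat {α : Type*} (p : α → Prop) (f : α → ℕ) (h : ∃ a, p a) :
    ∃ a, p a ∧ ∀ b, p b → f a ≤ f b := by
  classical
  have hex : ∃ m, ∃ a, p a ∧ f a = m := by obtain ⟨a, ha⟩ := h; exact ⟨_, a, ha, rfl⟩
  obtain ⟨a, ha, hm⟩ := Nat.find_spec hex
  exact ⟨a, ha, fun b hb => hm ▸ Nat.find_min' hex ⟨b, hb, rfl⟩⟩

theorem exists_max_nat {α : Type*} (p : α → Prop) (f : α → ℕ) (D : ℕ) (hD : ∀ a, f a ≤ D)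
    (h : ∃ a, p a) : ∃ a, p a ∧ ∀ b, p b → f b ≤ f a := by
  obtain ⟨a, ha, hm⟩ := exists_min_nat p (fun a => D - f a) h
  refine ⟨a, ha, fun b hb => ?_⟩
  have := hm b hb
  have := hD a
  have := hD b
  omega

theorem zass_flag_inj {M K : Type*} [NormedAddCommGroup M] [NormedSpace ℝ M]
    [FiniteDimensional ℝ M] [Group K]
    (r : K →* (M →L[ℝ] M)) (S : Set K) (hS : Subgroup.closure S = ⊤) (D D' : M →L[ℝ] M)
    (hDD : D * D' = 1) (hDD' : D' * D = 1)
    (hk : ∀ g ∈ S, ‖D * r g * D' - 1‖ ≤ 1/8) (δ : ℝ) (hδ : 0 < δ)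
    (hd : ∀ g, ‖r g - 1‖ < δ → g = 1) (l : M →ₗ[ℝ] ℝ) (hl : ∀ g v, l (r g v) = l v) (hl0 : l ≠ 0) :
    ∃ i, ∃ v ∈ Fl ((fun g => (r g : M →ₗ[ℝ] M)) '' S) ⊥ i, l v ≠ 0 := by
  let r'' : K →* (M →L[ℝ] M) :=
    { toFun := fun g => D * r g * D'
      map_one' := by simp [hDD]
      map_mul' := by
        intro a b
        rw [map_mul]
        calc _ = D * r a * 1 * r b * D' := by simp [mul_assoc]
          _ = _ := by rw [← hDD']; simp only [mul_assoc] }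
  have hnil : Group.IsNilpotent K := by
    refine zassenhaus r'' S hS hk (δ / (‖D'‖ * ‖D‖ + 1)) (by positivity) ?_
    intro g hg
    have hg : ‖D * r g * D' - 1‖ < (δ / (‖D'‖ * ‖D‖ + 1)) := hg
    refine hd g ?_
    have e : r g - 1 = D' * (D * r g * D' - 1) * D := by
      rw [mul_sub, sub_mul]
      have : D' * (D * r g * D') * D = (D' * D) * r g * (D' * D) := by
        simp only [mul_assoc]
      rw [this, hDD']; simp [hDD']
    rw [lt_div_iff₀ (by positivity)] at hg
    rw [e]
    calc _ ≤ ‖D'‖ * ‖D * r g * D' - 1‖ * ‖D‖ :=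
          (norm_mul_le _ _).trans (by gcongr; exact norm_mul_le _ _)
      _ = ‖D * r g * D' - 1‖ * (‖D'‖ * ‖D‖) := by ring
      _ ≤ ‖D * r g * D' - 1‖ * (‖D'‖ * ‖D‖ + 1) := by gcongr; linarith
      _ < δ := hg
  let rl : K →* (M →ₗ[ℝ] M) :=
    { toFun := fun g => (r g : M →ₗ[ℝ] M)
      map_one' := by rw [map_one]; rfl
      map_mul' := by intro a b; rw [map_mul]; rfl }
  obtain ⟨i, v, hv, hlv⟩ := nilpotent_flag (hG := hnil) rl l hl hl0
  refine ⟨i, v, Fl_anti ?_ _ _ hv, hlv⟩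
  rintro _ ⟨g, hg, rfl⟩
  exact ⟨g, rfl⟩

theorem zass_flag {M G : Type*} [NormedAddCommGroup M] [NormedSpace ℝ M]
    [FiniteDimensional ℝ M] [Group G]
    (r : G →* (M →L[ℝ] M)) (F : Set G) (D D' : M →L[ℝ] M)
    (hDD : D * D' = 1) (hDD' : D' * D = 1)
    (hk : ∀ g ∈ F, ‖D * r g * D' - 1‖ ≤ 1/8) (δ : ℝ) (hδ : 0 < δ)
    (hd : ∀ g, ‖r g - 1‖ < δ → r g = 1) (l : M →ₗ[ℝ] ℝ) (hl : ∀ g v, l (r g v) = l v)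
    (hl0 : l ≠ 0) :
    ∃ i, ∃ v ∈ Fl ((fun g => (r g : M →ₗ[ℝ] M)) '' F) ⊥ i, l v ≠ 0 := by
  obtain ⟨s, hs⟩ : ∃ s : G →* (M →L[ℝ] M)ˣ, ∀ g, (s g : M →L[ℝ] M) = r g :=
    ⟨r.toHomUnits, fun g => rfl⟩
  have hmap : (Subgroup.closure F).map s = Subgroup.closure (s '' F) := MonoidHom.map_closure s F
  have hmem : ∀ g : Subgroup.closure (s '' F), ∃ g', s g' = g := by
    intro g
    obtain ⟨g', _, h⟩ := hmap.ge g.2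
    exact ⟨g', h⟩
  have := zass_flag_inj ((Units.coeHom (M →L[ℝ] M)).comp (Subgroup.closure (s '' F)).subtype)
    (Subtype.val ⁻¹' (s '' F)) (Subgroup.closure_closure_coe_preimage) D D' hDD hDD' ?_ δ hδ ?_ l
    ?_ hl0
  · obtain ⟨i, v, hv, hlv⟩ := this
    refine ⟨i, v, Fl_anti ?_ _ _ hv, hlv⟩
    rintro _ ⟨g, hg, rfl⟩
    refine ⟨⟨s g, Subgroup.subset_closure ⟨g, hg, rfl⟩⟩, ⟨g, hg, rfl⟩, ?_⟩
    simp [hs]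
  · rintro ⟨_, hx⟩ ⟨g, hg, rfl⟩
    have := hk g hg
    simpa [hs] using this
  · intro g hg
    obtain ⟨g', h⟩ := hmem g
    have h1 : ((Units.coeHom (M →L[ℝ] M)).comp (Subgroup.closure (s '' F)).subtype) g = r g' := by
      simp [← h, hs]
    rw [h1] at hg
    have := hd _ hg
    apply Subtype.ext
    apply Units.ext
    rw [← h, hs, this]; rfl
  · intro g v
    obtain ⟨g', h⟩ := hmem g
    have h1 : ((Units.coeHom (M →L[ℝ] M)).comp (Subgroup.closure (s '' F)).subtype) g = r g' := by
      simp [← h, hs]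
    rw [h1]; exact hl _ _

/-- An affine action of a group on a normed space. -/
structure AffAct (G E : Type*) [Group G] [NormedAddCommGroup E] [NormedSpace ℝ E] where
  L : G →* (E →L[ℝ] E)
  u : G → E
  u_mul : ∀ g h, u (g * h) = u g + L g (u h)

namespace AffAct
variable {G E : Type*} [Group G] [NormedAddCommGroup E] [NormedSpace ℝ E] (A : AffAct G E)

def act (g : G) (x : E) : E := A.L g x + A.u g

theorem act_def (g : G) (x : E) : A.act g x = A.L g x + A.u g := rfl

theorem L_mul (g h : G) (x : E) : A.L (g * h) x = A.L g (A.L h x) := by simp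

theorem L_inv_L (g : G) (x : E) : A.L g⁻¹ (A.L g x) = x := by rw [← L_mul]; simp
theorem L_L_inv (g : G) (x : E) : A.L g (A.L g⁻¹ x) = x := by rw [← L_mul]; simp

theorem u_one : A.u 1 = 0 := by
  have := A.u_mul 1 1
  simpa using this

theorem act_mul (g h : G) (x : E) : A.act (g * h) x = A.act g (A.act h x) := by
  simp [act, u_mul]; abel

theorem act_one (x : E) : A.act 1 x = x := by simp [act, u_one]

theorem act_inv_act (g : G) (x : E) : A.act g⁻¹ (A.act g x) = x := by
  rw [← act_mul]; simp [act_one]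
theorem act_act_inv (g : G) (x : E) : A.act g (A.act g⁻¹ x) = x := by
  rw [← act_mul]; simp [act_one]

theorem act_zero (g : G) : A.act g 0 = A.u g := by simp [act]

theorem u_inv (g : G) : A.u g⁻¹ = - A.L g⁻¹ (A.u g) := by
  have := A.u_mul g⁻¹ g
  rw [inv_mul_cancel, u_one] at this
  exact eq_neg_of_add_eq_zero_left this.symm

theorem act_sub (g : G) (x y : E) : A.act g x - A.act g y = A.L g (x - y) := by
  simp [act]

theorem continuous_act (g : G) : Continuous (A.act g) := by
  unfold act; fun_prop

/-- linearised action on `E × ℝ` -/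
def hat : G →* ((E × ℝ) →L[ℝ] (E × ℝ)) where
  toFun g := ((A.L g).comp (ContinuousLinearMap.fst ℝ E ℝ) +
      (ContinuousLinearMap.snd ℝ E ℝ).smulRight (A.u g)).prod (ContinuousLinearMap.snd ℝ E ℝ)
  map_one' := by ext <;> simp [u_one]
  map_mul' g h := by
    ext <;> simp [u_mul, add_comm]

@[simp] theorem hat_apply (g : G) (x : E × ℝ) :
    A.hat g x = (A.L g x.1 + x.2 • A.u g, x.2) := by simp [hat]

theorem hat_one (g : G) (x : E) : A.hat g (x, 1) = (A.act g x, 1) := by simp [act]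

def Proper : Prop := ∀ R : ℝ, {g : G | ∃ x, ‖x‖ ≤ R ∧ ‖A.act g x‖ ≤ R}.Finite
def Cocpt : Prop := ∃ R : ℝ, ∀ x, ∃ g, ‖A.act g x‖ ≤ R
def Unimod : Prop := ∀ g, |(A.L g).det| = 1
def Faithful : Prop := ∀ g, (∀ x, A.act g x = x) → g = 1
def NoInv : Prop := ∀ Y : Submodule ℝ (E × ℝ), (∀ g, ∀ y ∈ Y, A.hat g y ∈ Y) →
  (∃ y ∈ Y, y.2 ≠ 0) → Y = ⊤
def Disc : Prop := ∃ δ > 0, ∀ g, ‖A.hat g - 1‖ < δ → A.hat g = 1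

structure Crys : Prop where
  proper : A.Proper
  cocpt : A.Cocpt
  unimod : A.Unimod
  faithful : A.Faithful

def res (H : Subgroup G) : AffAct H E where
  L := A.L.comp H.subtype
  u g := A.u g
  u_mul g h := A.u_mul g h

@[simp] theorem res_act (H : Subgroup G) (g : H) (x : E) : (A.res H).act g x = A.act g x := rfl
@[simp] theorem res_L (H : Subgroup G) (g : H) : (A.res H).L g = A.L g := rfl
@[simp] theorem res_u (H : Subgroup G) (g : H) : (A.res H).u g = A.u g := rfl

theorem Cocpt.res {A : AffAct G E} (h : A.Cocpt) (H : Subgroup G) [H.FiniteIndex] :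
    (A.res H).Cocpt := by
  obtain ⟨R, hR⟩ := h
  have : Finite (G ⧸ H) := Subgroup.finite_quotient_of_finiteIndex
  obtain ⟨C, hC⟩ : ∃ C : ℝ, ∀ q : G ⧸ H, ‖A.L q.out⁻¹‖ * R + ‖A.u q.out⁻¹‖ ≤ C := by
    obtain ⟨C, hC⟩ := (Set.finite_range
      (fun q : G ⧸ H => ‖A.L q.out⁻¹‖ * R + ‖A.u q.out⁻¹‖)).bddAbove
    exact ⟨C, fun q => hC ⟨q, rfl⟩⟩
  refine ⟨C, fun x => ?_⟩
  obtain ⟨g, hg⟩ := hR x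
  have hm : ((g : G ⧸ H).out)⁻¹ * g ∈ H := by
    rw [← QuotientGroup.eq]; simp
  refine ⟨⟨_, hm⟩, ?_⟩
  rw [res_act, act_mul, act_def]
  refine (norm_add_le _ _).trans (le_trans ?_ (hC (g : G ⧸ H)))
  gcongr
  exact ((A.L _).le_opNorm _).trans (by gcongr)

theorem Crys.res {A : AffAct G E} (h : A.Crys) (H : Subgroup G) [H.FiniteIndex] :
    (A.res H).Crys where
  proper R := by
    refine Set.Finite.of_finite_image (f := Subtype.val) ?_ Subtype.val_injective.injOn
    refine (h.proper R).subset ?_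
    rintro _ ⟨g, hg, rfl⟩
    exact hg
  cocpt := h.cocpt.res H
  unimod g := h.unimod g
  faithful g hg := Subtype.ext (h.faithful g hg)

theorem hat_eq_one_iff (g : G) : A.hat g = 1 ↔ ∀ x, A.act g x = x := by
  constructor
  · intro h x
    have := A.hat_one g x
    rw [h] at this
    simpa using (congrArg Prod.fst this).symm
  · intro h
    have hu : A.u g = 0 := by have := h 0; rwa [act_zero] at this
    ext x <;> simp [hu]
    have := h x
    rw [act_def, hu] at this; simpa using this

theorem Crys.disc {A : AffAct G E} (h : A.Crys) : A.Disc := by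
  have hfin := h.proper 1
  have hfin2 : ({g : G | ‖A.hat g - 1‖ < 1 ∧ A.hat g ≠ 1}).Finite := by
    refine hfin.subset ?_
    rintro g ⟨hg, -⟩
    refine ⟨0, by simp, ?_⟩
    have h1 : (A.hat g - 1) (0, 1) = (A.u g, 0) := by simp
    have h2 := (A.hat g - 1).le_opNorm (0, 1)
    rw [h1] at h2
    have h3 : ‖((0 : E), (1 : ℝ))‖ = 1 := by simp [Prod.norm_def]
    have h4 : ‖A.u g‖ ≤ ‖(A.u g, (0:ℝ))‖ := by simp [Prod.norm_def]
    rw [h3] at h2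
    rw [act_zero]; linarith
  obtain ⟨δ, hδ, hmin⟩ : ∃ δ > 0, ∀ g ∈ {g : G | ‖A.hat g - 1‖ < 1 ∧ A.hat g ≠ 1},
      δ ≤ ‖A.hat g - 1‖ := by
    rcases Set.eq_empty_or_nonempty {g : G | ‖A.hat g - 1‖ < 1 ∧ A.hat g ≠ 1} with he | hne
    · exact ⟨1, one_pos, by rw [he]; simp⟩
    · obtain ⟨g, hg, hm⟩ := Set.exists_min_image _ (fun g => ‖A.hat g - 1‖) hfin2 hne
      exact ⟨‖A.hat g - 1‖, norm_pos_iff.2 (sub_ne_zero.2 hg.2), hm⟩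
  refine ⟨min δ 1, lt_min hδ one_pos, fun g hg => ?_⟩
  by_contra hne
  have := hmin g ⟨hg.trans_le (min_le_right _ _), hne⟩
  exact absurd (hg.trans_le (min_le_left _ _)) (not_lt.2 this)

section Rprime
variable [FiniteDimensional ℝ E]

/-- linear-map version of hat -/
def hatl : G →* ((E × ℝ) →ₗ[ℝ] (E × ℝ)) where
  toFun g := (A.hat g : (E × ℝ) →ₗ[ℝ] (E × ℝ))
  map_one' := by rw [map_one]; rfl
  map_mul' g h := by rw [map_mul]; rfl

@[simp] theorem hatl_apply (g : G) (x : E × ℝ) : A.hatl g x = A.hat g x := rfl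

def dhat (d : E →L[ℝ] E) : (E × ℝ) →L[ℝ] (E × ℝ) :=
  d.prodMap (ContinuousLinearMap.id ℝ ℝ)

theorem norm_dhat_sub (d : E →L[ℝ] E) : ‖dhat d - 1‖ ≤ ‖d - 1‖ := by
  refine ContinuousLinearMap.opNorm_le_bound _ (norm_nonneg _) ?_
  intro x
  have : (dhat d - 1) x = ((d - 1) x.1, 0) := by
    ext <;> simp [dhat]
  rw [this, Prod.norm_def]
  simp only [norm_zero]
  rw [max_eq_left (norm_nonneg _)]
  exact ((d - 1).le_opNorm _).trans (by gcongr; exact norm_fst_le x)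

/-- the set of linearised elements whose `d` is close to one -/
def Sc (d : G →* (E →L[ℝ] E)) (c : ℝ) : Set ((E × ℝ) →ₗ[ℝ] (E × ℝ)) :=
  A.hatl '' {g | ‖d g - 1‖ < c}

theorem Rprime_notle (hdisc : A.Disc) (d : G →* (E →L[ℝ] E))
    (D D' : ℕ → ((E × ℝ) →L[ℝ] (E × ℝ))) (hDD : ∀ k, D k * D' k = 1) (hDD' : ∀ k, D' k * D k = 1)
    (hlim : ∀ g, Tendsto (fun k => D k * A.hat g * D' k) atTop (𝓝 (dhat (d g))))
    (c : ℝ) (hc1 : c ≤ 1/16) :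
    ∃ y ∈ Fl (A.Sc d c) ⊥ (Module.finrank ℝ (E × ℝ)), y.2 ≠ 0 := by
  set N := Module.finrank ℝ (E × ℝ) with hN
  by_contra hcon
  push Not at hcon
  obtain ⟨F, ⟨hFfin, hFS⟩, hFmin⟩ := exists_min_nat
    (fun F : Set ((E × ℝ) →ₗ[ℝ] (E × ℝ)) => F.Finite ∧ F ⊆ A.Sc d c)
    (fun F => Module.finrank ℝ (Fl F ⊥ N)) ⟨∅, Set.finite_empty, Set.empty_subset _⟩
  have hle : Fl F ⊥ N ≤ Fl (A.Sc d c) ⊥ N := by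
    intro v hv
    by_contra hv'
    obtain ⟨F', hF', hF'S, hvF'⟩ := Fl_finite hv'
    have h1 := hFmin (F ∪ F') ⟨hFfin.union hF', Set.union_subset hFS hF'S⟩
    have h2 : Fl (F ∪ F') ⊥ N < Fl F ⊥ N := by
      refine lt_of_le_of_ne (Fl_anti Set.subset_union_left _ _) ?_
      intro h
      rw [← h] at hv
      exact hvF' (Fl_anti Set.subset_union_right _ _ hv)
    have := Submodule.finrank_lt_finrank_of_lt h2
    omega
  -- choose group elements
  obtain ⟨F0, hF0, hF0fin, hF0img⟩ : ∃ F0 : Set G, F0 ⊆ {g | ‖d g - 1‖ < c} ∧ F0.Finite ∧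
      A.hatl '' F0 = F := by
    have hch : ∀ s ∈ F, ∃ g, ‖d g - 1‖ < c ∧ A.hatl g = s := fun s hs => hFS hs
    choose! f hf1 hf2 using hch
    refine ⟨f '' F, ?_, hFfin.image f, ?_⟩
    · rintro _ ⟨s, hs, rfl⟩; exact hf1 s hs
    · rw [Set.image_image]
      ext s; constructor
      · rintro ⟨s, hs, rfl⟩; show A.hatl (f s) ∈ F; rw [hf2 s hs]; exact hs
      · intro hs; exact ⟨s, hs, hf2 s hs⟩
  have hev : ∀ᶠ k in atTop, ∀ g ∈ F0, ‖D k * A.hat g * D' k - 1‖ ≤ 1/8 := by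
    rw [hF0fin.eventually_all]
    intro g hg
    have h1 : ∀ᶠ k in atTop, ‖D k * A.hat g * D' k - dhat (d g)‖ < 1/16 := by
      have := (hlim g).sub_const (dhat (d g))
      rw [sub_self] at this
      have := this.norm
      rw [norm_zero] at this
      exact this.eventually_lt_const (by norm_num)
    filter_upwards [h1] with k hk
    have h2 := norm_dhat_sub (d g)
    have h3 : ‖d g - 1‖ < c := hF0 hg
    calc _ = ‖(D k * A.hat g * D' k - dhat (d g)) + (dhat (d g) - 1)‖ := by congr 1; abel
      _ ≤ _ := norm_add_le _ _
      _ ≤ 1/8 := by linarith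
  obtain ⟨k, hk⟩ := hev.exists
  obtain ⟨δ, hδ, hd⟩ := hdisc
  obtain ⟨i, v, hv, hlv⟩ := zass_flag A.hat F0 (D k) (D' k) (hDD k) (hDD' k) hk δ hδ hd
    (LinearMap.snd ℝ E ℝ) (by intro g v; simp)
    (by intro h; have := LinearMap.congr_fun h (0, 1); simp at this)
  refine hlv (hcon v (hle ?_))
  refine Fl_le_finrank _ i ?_
  rw [← hF0img]
  exact hv

theorem Rprime (hno : A.NoInv) (hdisc : A.Disc) (d : G →* (E →L[ℝ] E))
    (D D' : ℕ → ((E × ℝ) →L[ℝ] (E × ℝ))) (hDD : ∀ k, D k * D' k = 1) (hDD' : ∀ k, D' k * D k = 1)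
    (hlim : ∀ g, Tendsto (fun k => D k * A.hat g * D' k) atTop (𝓝 (dhat (d g)))) :
    ∃ c > 0, Fl (A.Sc d c) ⊥ (Module.finrank ℝ (E × ℝ)) = ⊤ := by
  set N := Module.finrank ℝ (E × ℝ) with hN
  obtain ⟨c, ⟨hc0, hc1⟩, hcmax⟩ := exists_max_nat (fun c : ℝ => 0 < c ∧ c ≤ 1/16)
    (fun c => Module.finrank ℝ (Fl (A.Sc d c) ⊥ N)) N (fun c => Submodule.finrank_le _)
    ⟨1/16, by norm_num, le_rfl⟩
  refine ⟨c, hc0, hno _ ?_ (A.Rprime_notle hdisc d D D' hDD hDD' hlim c hc1)⟩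
  intro g y hy
  set m := ‖d g⁻¹‖ * ‖d g‖ + 1 with hm
  have hmpos : 1 ≤ m := by rw [hm]; have := mul_nonneg (norm_nonneg (d g⁻¹)) (norm_nonneg (d g)); linarith
  have hc' : 0 < c / m ∧ c / m ≤ 1/16 :=
    ⟨by positivity, (div_le_self hc0.le hmpos).trans hc1⟩
  have hsub : A.Sc d (c / m) ⊆ A.Sc d c := by
    apply Set.image_mono
    intro s hs
    exact lt_of_lt_of_le hs (div_le_self hc0.le hmpos)
  have heq : Fl (A.Sc d c) ⊥ N = Fl (A.Sc d (c/m)) ⊥ N :=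
    Submodule.eq_of_le_of_finrank_le (Fl_anti hsub _ _) (hcmax _ hc')
  rw [heq]
  have key : ∀ i, ∀ v ∈ Fl (A.Sc d c) ⊥ i, A.hat g v ∈ Fl (A.Sc d (c/m)) ⊥ i := by
    intro i
    induction i with
    | zero => intro v hv; simp only [Fl, Submodule.mem_bot] at hv ⊢; rw [hv, map_zero]
    | succ i ih =>
      intro v hv
      rw [mem_Fl_succ] at hv ⊢
      rintro _ ⟨s, hs, rfl⟩
      have hmem : g⁻¹ * s * g ∈ {g | ‖d g - 1‖ < c} := by
        have e : d (g⁻¹ * s * g) - 1 = d g⁻¹ * (d s - 1) * d g := by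
          rw [mul_sub, sub_mul, mul_one, ← map_mul d g⁻¹ g]; simp [mul_assoc]
        have hs' : ‖d s - 1‖ < c / m := hs
        show ‖d (g⁻¹ * s * g) - 1‖ < c
        rw [e]
        rw [lt_div_iff₀ (by positivity)] at hs'
        calc _ ≤ ‖d g⁻¹‖ * ‖d s - 1‖ * ‖d g‖ :=
              (norm_mul_le _ _).trans (by gcongr; exact norm_mul_le _ _)
          _ = ‖d s - 1‖ * (‖d g⁻¹‖ * ‖d g‖) := by ring
          _ ≤ ‖d s - 1‖ * m := by gcongr; linarith
          _ < c := hs'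
      have h2 := ih _ (hv _ ⟨_, hmem, rfl⟩)
      have e : A.hat g (A.hatl (g⁻¹ * s * g) v - v) = A.hatl s (A.hat g v) - A.hat g v := by
        rw [map_sub, hatl_apply, hatl_apply, ← mul_apply_eq_comp,
          ← mul_apply_eq_comp, ← map_mul, ← map_mul]
        simp only [mul_assoc, mul_inv_cancel_left]
      rwa [e] at h2
  exact key N y hy

theorem Fl_top_pow {M : Type*} [AddCommGroup M] [Module ℝ M] {S : Set (M →ₗ[ℝ] M)} {N : ℕ}
    (h : Fl S ⊥ N = ⊤) {s} (hs : s ∈ S) : (s - 1) ^ N = 0 := by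
  have key : ∀ i, ∀ v ∈ Fl S ⊥ i, ((s - 1) ^ i) v = 0 := by
    intro i
    induction i with
    | zero => intro v hv; simpa [Fl] using hv
    | succ i ih =>
      intro v hv
      rw [mem_Fl_succ] at hv
      rw [pow_succ]
      exact ih _ (hv s hs)
  ext v
  exact key N v (by rw [h]; trivial)

theorem Rprime_pow (d : G →* (E →L[ℝ] E))
    (D D' : ℕ → ((E × ℝ) →L[ℝ] (E × ℝ))) (hDD : ∀ k, D k * D' k = 1) (hDD' : ∀ k, D' k * D k = 1)
    (hlim : ∀ g, Tendsto (fun k => D k * A.hat g * D' k) atTop (𝓝 (dhat (d g))))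
    (c : ℝ) (N : ℕ) (hF : Fl (A.Sc d c) ⊥ N = ⊤) (g : G) (hg : ‖d g - 1‖ < c) :
    (d g - 1) ^ N = 0 := by
  have h1 : (A.hat g - 1) ^ N = 0 := by
    have := Fl_top_pow hF ⟨g, hg, rfl⟩
    refine ContinuousLinearMap.ext fun v => ?_
    have h2 : ∀ m : ℕ, ∀ v, ((A.hatl g - 1) ^ m) v = ((A.hat g - 1) ^ m) v := by
      intro m
      induction m with
      | zero => intro v; rfl
      | succ m ih => intro v; rw [pow_succ, pow_succ, Module.End.mul_apply, ih]; rfl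
    rw [← h2, this]; rfl
  have h2 : ∀ k, (D k * A.hat g * D' k - 1) ^ N = 0 := by
    intro k
    have e : ∀ m, (D k * A.hat g * D' k - 1) ^ m = D k * (A.hat g - 1) ^ m * D' k := by
      intro m
      induction m with
      | zero => simp [hDD]
      | succ m ih =>
        have e1 : D k * A.hat g * D' k - 1 = D k * (A.hat g - 1) * D' k := by
          rw [mul_sub, sub_mul, mul_one, hDD]
        rw [pow_succ, ih, e1, pow_succ]
        calc _ = D k * (A.hat g - 1) ^ m * (D' k * D k) * (A.hat g - 1) * D' k := by
              simp only [mul_assoc]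
          _ = _ := by rw [hDD']; simp only [mul_assoc, mul_one]
    rw [e, h1]; simp
  have h3 : (dhat (d g) - 1) ^ N = 0 := by
    have := ((hlim g).sub_const 1).pow N
    simp only [h2] at this
    exact (tendsto_nhds_unique this tendsto_const_nhds)
  ext v
  have h4 : ∀ m : ℕ, ∀ v, ((dhat (d g) - 1) ^ m) (v, 0) = (((d g - 1) ^ m) v, 0) := by
    intro m
    induction m with
    | zero => intro v; rfl
    | succ m ih =>
      intro v
      rw [pow_succ, pow_succ, mul_apply_eq_comp, mul_apply_eq_comp, ← ih]
      congr 1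
      simp [dhat]
  have := h4 N v
  rw [h3] at this
  simpa using (congrArg Prod.fst this).symm

end Rprime
end AffAct
end HLC
end

noncomputable section
namespace HLC
open Filter Topology
set_option linter.unusedSectionVars false

namespace AffAct
variable {G E : Type*} [Group G] [NormedAddCommGroup E] [NormedSpace ℝ E] (A : AffAct G E)

theorem contDiff_act (g : G) {n : WithTop ℕ∞} : ContDiff ℝ n (A.act g) := by
  unfold act
  exact (A.L g).contDiff.add contDiff_const

theorem lf_of_proper {A : AffAct G E} (hp : A.Proper) {w : E → ℝ} {R : ℝ}
    (hw : ∀ x, w x ≠ 0 → ‖x‖ ≤ R) (r : ℝ) :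
    ∃ s : Finset G, ∀ x, ‖x‖ ≤ r → ∀ g ∉ s, w (A.act g x) = 0 := by
  refine ⟨(hp (max r R)).toFinset, fun x hx g hg => ?_⟩
  by_contra h
  apply hg
  rw [Set.Finite.mem_toFinset]
  exact ⟨x, hx.trans (le_max_left _ _), (hw _ h).trans (le_max_right _ _)⟩

theorem hasFiniteSupport {A : AffAct G E} (hp : A.Proper) {w : E → ℝ} {R : ℝ}
    (hw : ∀ x, w x ≠ 0 → ‖x‖ ≤ R) (x : E) : (Function.support fun g => w (A.act g x)).Finite := by
  obtain ⟨s, hs⟩ := lf_of_proper hp hw ‖x‖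
  refine s.finite_toSet.subset ?_
  intro g hg
  by_contra h
  exact hg (hs x le_rfl g h)

theorem finsum_contDiff {A : AffAct G E} (hp : A.Proper) {w : E → ℝ} {R : ℝ}
    (hw : ∀ x, w x ≠ 0 → ‖x‖ ≤ R) (hwc : ContDiff ℝ 1 w) {E' : Type*} [NormedAddCommGroup E']
    [NormedSpace ℝ E'] (a : G → E → E') (ha : ∀ g, ContDiff ℝ 1 (a g)) :
    ContDiff ℝ 1 (fun x => ∑ᶠ g, w (A.act g x) • a g x) := by
  rw [contDiff_iff_contDiffAt]
  intro x
  obtain ⟨s, hs⟩ := lf_of_proper hp hw (‖x‖ + 1)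
  have h1 : ContDiff ℝ 1 (fun x => ∑ g ∈ s, w (A.act g x) • a g x) :=
    ContDiff.sum fun g _ => (hwc.comp (A.contDiff_act g)).smul (ha g)
  refine h1.contDiffAt.congr_of_eventuallyEq ?_
  have : Metric.ball (0 : E) (‖x‖ + 1) ∈ 𝓝 x := by
    apply Metric.isOpen_ball.mem_nhds; simp
  filter_upwards [this] with y hy
  apply finsum_eq_sum_of_support_subset
  intro g hg
  by_contra h
  apply hg
  simp only
  rw [hs y (by simp at hy; exact hy.le) g h, zero_smul]

/-- a smooth partition of unity subordinate to the action -/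
structure PU where
  χ : E → ℝ
  R : ℝ
  smooth : ContDiff ℝ 1 χ
  nonneg : ∀ x, 0 ≤ χ x
  supp : ∀ x, χ x ≠ 0 → ‖x‖ ≤ R
  sum : ∀ x, ∑ᶠ g, χ (A.act g x) = 1

theorem finsum_shift (w : E → ℝ) {E' : Type*} [AddCommGroup E']
    [Module ℝ E'] (a : G → E') (γ : G) (x : E) :
    ∑ᶠ g, w (A.act g (A.act γ x)) • a g = ∑ᶠ g, w (A.act g x) • a (g * γ⁻¹) := by
  rw [← finsum_comp_equiv (Equiv.mulRight γ⁻¹)]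
  apply finsum_congr
  intro g
  simp only [Equiv.coe_mulRight]
  rw [← act_mul, inv_mul_cancel_right]

theorem exists_PU [FiniteDimensional ℝ E] {A : AffAct G E} (hp : A.Proper) (hc : A.Cocpt) :
    Nonempty A.PU := by
  obtain ⟨R0, hR0⟩ := hc
  set R := max R0 1 with hR
  have hRpos : 0 < R := lt_of_lt_of_le one_pos (le_max_right _ _)
  let φ : ContDiffBump (0 : E) := ⟨R, R + 1, hRpos, by linarith⟩
  have hsupp : ∀ x, φ x ≠ 0 → ‖x‖ ≤ R + 1 := by
    intro x hx
    have : x ∈ Function.support φ := hx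
    rw [φ.support_eq] at this
    simpa using (Metric.mem_ball.1 this).le
  have hone : ∀ x, ‖x‖ ≤ R → φ x = 1 := fun x hx =>
    φ.one_of_mem_closedBall (by simpa using hx)
  set Φ : E → ℝ := fun x => ∑ᶠ g, φ (A.act g x) with hΦ
  have hΦc : ContDiff ℝ 1 Φ := by
    have := finsum_contDiff hp hsupp φ.contDiff (fun (_ : G) (_ : E) => (1:ℝ))
      (fun _ => contDiff_const)
    simpa using this
  have hΦpos : ∀ x, 0 < Φ x := by
    intro x
    obtain ⟨g, hg⟩ := hR0 x
    exact finsum_pos (fun g => φ.nonneg) ⟨g, by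
      rw [hone _ (hg.trans (le_max_left _ _))]; exact one_pos⟩ (hasFiniteSupport hp hsupp x)
  have hΦinv : ∀ γ x, Φ (A.act γ x) = Φ x := by
    intro γ x
    have := A.finsum_shift φ (fun _ => (1:ℝ)) γ x
    simpa using this
  refine ⟨⟨fun x => φ x / Φ x, R + 1, φ.contDiff.div hΦc fun x => (hΦpos x).ne', fun x =>
    div_nonneg φ.nonneg (hΦpos x).le, fun x hx => hsupp x fun h => hx (by simp [h]), ?_⟩⟩
  intro x
  simp only [hΦinv]
  simp only [div_eq_mul_inv]
  rw [← finsum_mul]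
  exact mul_inv_cancel₀ (hΦpos x).ne'

namespace PU
variable {A} (P : A.PU)

theorem fin (hp : A.Proper) (x : E) : (Function.support fun g => P.χ (A.act g x)).Finite :=
  hasFiniteSupport hp P.supp x

theorem fin_smul (hp : A.Proper) (x : E) {E' : Type*} [AddCommGroup E'] [Module ℝ E']
    (a : G → E') : (Function.support fun g => P.χ (A.act g x) • a g).Finite := by
  refine (P.fin hp x).subset ?_
  intro g hg h
  exact hg (by simp [h])

/-- averaging -/
def Av (F : E → E) (x : E) : E := ∑ᶠ g, P.χ (A.act g x) • A.act g⁻¹ (F (A.act g x))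

theorem map_sum (hp : A.Proper) (x : E) {E' E'' : Type*} [AddCommGroup E'] [Module ℝ E']
    [AddCommGroup E''] [Module ℝ E''] (l : E' →ₗ[ℝ] E'') (a : G → E') :
    l (∑ᶠ g, P.χ (A.act g x) • a g) = ∑ᶠ g, P.χ (A.act g x) • l (a g) := by
  rw [map_finsum l (P.fin_smul hp x a)]
  simp

theorem sum_const (hp : A.Proper) (x : E) {E' : Type*} [AddCommGroup E'] [Module ℝ E']
    (c : E') : ∑ᶠ g, P.χ (A.act g x) • c = c := by
  have := P.map_sum hp x (LinearMap.toSpanSingleton ℝ E' c) (fun _ => (1:ℝ))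
  simp only [smul_eq_mul, mul_one, LinearMap.toSpanSingleton_apply, P.sum] at this
  rw [one_smul] at this
  exact this.symm

theorem sum_add (hp : A.Proper) (x : E) {E' : Type*} [AddCommGroup E'] [Module ℝ E']
    (a b : G → E') : ∑ᶠ g, P.χ (A.act g x) • (a g + b g) =
      ∑ᶠ g, P.χ (A.act g x) • a g + ∑ᶠ g, P.χ (A.act g x) • b g := by
  rw [← finsum_add_distrib (P.fin_smul hp x a) (P.fin_smul hp x b)]
  simp only [smul_add]

theorem mem_sum (x : E) {E' : Type*} [AddCommGroup E'] [Module ℝ E']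
    (Y : Submodule ℝ E') (a : G → E') (h : ∀ g, a g ∈ Y) :
    ∑ᶠ g, P.χ (A.act g x) • a g ∈ Y := by
  apply finsum_induction (fun y => y ∈ Y) Y.zero_mem (fun _ _ => Y.add_mem)
  intro g; exact Y.smul_mem _ (h g)

theorem Av_contDiff (hp : A.Proper) (F : E → E) (hF : ContDiff ℝ 1 F) :
    ContDiff ℝ 1 (P.Av F) := by
  refine finsum_contDiff hp P.supp P.smooth _ fun g => ?_
  exact (A.contDiff_act _).comp (hF.comp (A.contDiff_act g))

theorem Av_equiv (hp : A.Proper) (F : E → E) (γ : G) (x : E) :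
    P.Av F (A.act γ x) = A.act γ (P.Av F x) := by
  unfold Av
  rw [← finsum_comp_equiv (Equiv.mulRight γ⁻¹)]
  have e : ∀ g : G, P.χ (A.act ((Equiv.mulRight γ⁻¹) g) (A.act γ x)) •
      A.act ((Equiv.mulRight γ⁻¹) g)⁻¹ (F (A.act ((Equiv.mulRight γ⁻¹) g) (A.act γ x)))
      = P.χ (A.act g x) • (A.L γ (A.act g⁻¹ (F (A.act g x))) + A.u γ) := by
    intro g
    simp only [Equiv.coe_mulRight]
    rw [← act_mul]
    simp only [inv_mul_cancel_right, _root_.mul_inv_rev, inv_inv]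
    rw [act_mul, act_def A γ]
  simp_rw [e]
  rw [P.sum_add hp, P.sum_const hp, act_def]
  congr 1
  exact (P.map_sum hp x (A.L γ : E →ₗ[ℝ] E) _).symm

end PU

/-- determinant is polynomial along lines -/
theorem det_poly [FiniteDimensional ℝ E] (T : E →L[ℝ] E) :
    ∃ p : Polynomial ℝ, p.natDegree ≤ Module.finrank ℝ E ∧
      ∀ t : ℝ, p.eval t = (1 + t • T).det := by
  classical
  let b := Module.finBasis ℝ E
  let M := LinearMap.toMatrix b b (T : E →ₗ[ℝ] E)
  refine ⟨((Polynomial.X : Polynomial ℝ) • M.map Polynomial.C +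
    (1 : Matrix (Fin (Module.finrank ℝ E)) (Fin (Module.finrank ℝ E)) ℝ).map Polynomial.C).det, ?_, ?_⟩
  · refine (Polynomial.natDegree_det_X_add_C_le M 1).trans ?_
    simp
  · intro t
    rw [← Polynomial.coe_evalRingHom, RingHom.map_det]
    rw [ContinuousLinearMap.det, ← LinearMap.det_toMatrix b]
    congr 1
    ext i j
    simp [M, LinearMap.toMatrix_apply, Matrix.one_apply, Finsupp.single_apply, eq_comm, add_comm]
    split_ifs <;> simp [mul_comm]

open MeasureTheory in
theorem change_var [FiniteDimensional ℝ E] [MeasurableSpace E] [BorelSpace E]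
    (μ : Measure E) [μ.IsAddHaarMeasure] (H : E → E) (hH : ContDiff ℝ 1 H)
    (hb : Function.Bijective H) (f : E → ℝ) :
    ∫ x, |(fderiv ℝ H x).det| * f (H x) ∂μ = ∫ x, f x ∂μ := by
  have := integral_image_eq_integral_abs_det_fderiv_smul μ (s := Set.univ) (f := H)
    (f' := fderiv ℝ H) MeasurableSet.univ (fun x _ =>
      ((hH.differentiable (by norm_num)) x).hasFDerivAt.hasFDerivWithinAt) hb.1.injOn f
  rw [Set.image_univ, hb.2.range_eq] at this
  simpa using this.symm

theorem act_bij (g : G) : Function.Bijective (A.act g) :=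
  ⟨fun x y h => by rw [← A.act_inv_act g x, h, A.act_inv_act], fun y => ⟨_, A.act_act_inv g y⟩⟩

theorem fderiv_act (g : G) (x : E) : fderiv ℝ (A.act g) x = A.L g := by
  unfold act
  rw [fderiv_add_const]; exact (A.L g).fderiv

open MeasureTheory in
theorem integral_act [FiniteDimensional ℝ E] [MeasurableSpace E] [BorelSpace E]
    (μ : Measure E) [μ.IsAddHaarMeasure] {A : AffAct G E} (hu : A.Unimod) (g : G) (f : E → ℝ) :
    ∫ x, f (A.act g x) ∂μ = ∫ x, f x ∂μ := by
  rw [← change_var μ (A.act g) (A.contDiff_act g) (A.act_bij g) f]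
  simp [fderiv_act, hu g]

end AffAct
end HLC
end

noncomputable section
namespace HLC
open Filter Topology
set_option linter.unusedSectionVars false

namespace AffAct
variable {G E : Type*} [Group G] [NormedAddCommGroup E] [NormedSpace ℝ E] {A : AffAct G E}

theorem det_conj (g : G) (T : E →L[ℝ] E) : (A.L g * T * A.L g⁻¹).det = T.det := by
  have h1 : ∀ S T : E →L[ℝ] E, (S * T).det = S.det * T.det := by
    intro S T
    simp only [ContinuousLinearMap.det]
    exact LinearMap.det_comp _ _
  have h2 : (A.L g).det * (A.L g⁻¹).det = 1 := by
    rw [← h1, ← map_mul]; simp [ContinuousLinearMap.det]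
  rw [h1, h1, mul_right_comm, h2, one_mul]

section
variable {v : E → E} (hv : ContDiff ℝ 1 v) (hvg : ∀ g x, v (A.act g x) = A.L g (v x))
include hv hvg

theorem fderiv_conj (g : G) (x : E) :
    fderiv ℝ v (A.act g x) = A.L g * fderiv ℝ v x * A.L g⁻¹ := by
  have hd := hv.differentiable (by norm_num)
  have h1 : fderiv ℝ (v ∘ A.act g) x = (fderiv ℝ v (A.act g x)).comp (A.L g) := by
    rw [fderiv_comp _ (hd _) ((A.contDiff_act g (n := 1)).differentiable (by norm_num) _), fderiv_act]
  have h2 : v ∘ A.act g = A.L g ∘ v := funext fun x => hvg g x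
  rw [h2, fderiv_comp _ (A.L g).differentiableAt (hd _), ContinuousLinearMap.fderiv] at h1
  ext y
  have := congrArg (fun T => T (A.L g⁻¹ y)) h1
  simp only [ContinuousLinearMap.comp_apply, L_L_inv] at this
  simpa using this.symm

theorem det_inv (g : G) (x : E) (t : ℝ) :
    (1 + t • fderiv ℝ v (A.act g x)).det = (1 + t • fderiv ℝ v x).det := by
  rw [← A.det_conj g (1 + t • fderiv ℝ v x), fderiv_conj hv hvg]
  congr 1
  have : A.L g * A.L g⁻¹ = 1 := by rw [← map_mul]; simp
  rw [mul_add, add_mul, mul_one, this]; simp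

variable [FiniteDimensional ℝ E]

theorem bound_deriv (r : ℝ) : ∃ B > 0, ∀ x, ‖x‖ ≤ r → ‖v x‖ ≤ B ∧ ‖fderiv ℝ v x‖ ≤ B := by
  have hK := isCompact_closedBall (0 : E) r
  obtain ⟨B1, h1⟩ := hK.exists_bound_of_continuousOn hv.continuous.continuousOn
  obtain ⟨B2, h2⟩ := hK.exists_bound_of_continuousOn (hv.continuous_fderiv (by norm_num)).continuousOn
  refine ⟨max (max B1 B2) 1, by positivity, fun x hx => ⟨?_, ?_⟩⟩
  · exact (h1 x (by simpa using hx)).trans (by simp)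
  · exact (h2 x (by simpa using hx)).trans (by simp)

theorem stepA (hc : A.Cocpt) : ∃ t0 > (0:ℝ), ∀ t : ℝ, 0 ≤ t → t ≤ t0 → ∀ x, 0 < (1 + t • fderiv ℝ v x).det := by
  obtain ⟨R, hR⟩ := hc
  obtain ⟨B, hB, hb⟩ := bound_deriv hv hvg R
  have hcont : ∀ᶠ T in 𝓝 (1 : E →L[ℝ] E), 0 < T.det := by
    apply ContinuousLinearMap.continuous_det.continuousAt.eventually_const_lt
    simp only [ContinuousLinearMap.det]
    rw [show ((1 : E →L[ℝ] E) : E →ₗ[ℝ] E) = LinearMap.id from rfl, LinearMap.det_id]; exact one_pos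
  obtain ⟨ε, hε, hball⟩ := Metric.eventually_nhds_iff.1 hcont
  refine ⟨ε / (2 * B), by positivity, fun t ht ht' x => ?_⟩
  obtain ⟨g, hg⟩ := hR x
  rw [← det_inv hv hvg g x t]
  apply hball
  rw [dist_eq_norm, add_sub_cancel_left, norm_smul, Real.norm_of_nonneg ht]
  calc t * _ ≤ ε / (2 * B) * B := by gcongr; exact (hb _ hg).2
    _ = ε / 2 := by field_simp
    _ < ε := by linarith

omit hv [FiniteDimensional ℝ E] in
theorem Ht_equiv (t : ℝ) (g : G) (x : E) :
    A.act g x + t • v (A.act g x) = A.act g (x + t • v x) := by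
  rw [hvg, act_def, act_def]; simp; abel

theorem lip (r B : ℝ) (hb : ∀ x, ‖x‖ ≤ r → ‖fderiv ℝ v x‖ ≤ B) (x y : E) (hx : ‖x‖ ≤ r)
    (hy : ‖y‖ ≤ r) : ‖v x - v y‖ ≤ B * ‖x - y‖ := by
  refine (convex_closedBall (0:E) r).norm_image_sub_le_of_norm_fderiv_le (𝕜 := ℝ)
    (fun z _ => (hv.differentiable (by norm_num)) z) (fun z hz => hb z (by simpa using hz))
    (by simpa using hy) (by simpa using hx)

theorem stepB (hp : A.Proper) (hc : A.Cocpt) :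
    ∃ t0 > (0:ℝ), ∀ t : ℝ, 0 ≤ t → t ≤ t0 → Function.Injective (fun x => x + t • v x) := by
  obtain ⟨R, hR⟩ := hc
  obtain ⟨B, hB, hb⟩ := bound_deriv hv hvg R
  have hfin := hp (R + B)
  obtain ⟨R2, hR2⟩ : ∃ R2, R ≤ R2 ∧ ∀ g ∈ {g : G | ∃ x, ‖x‖ ≤ R + B ∧ ‖A.act g x‖ ≤ R + B},
      ‖A.L g‖ * R + ‖A.u g‖ ≤ R2 := by
    obtain ⟨C, hC⟩ := (hfin.image (fun g => ‖A.L g‖ * R + ‖A.u g‖)).bddAbove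
    exact ⟨max C R, le_max_right _ _, fun g hg => (hC ⟨g, hg, rfl⟩).trans (le_max_left _ _)⟩
  obtain ⟨B2, hB2, hb2⟩ := bound_deriv hv hvg R2
  refine ⟨min 1 (1 / (2 * B2)), by positivity, fun t ht ht' => ?_⟩
  have ht1 : t ≤ 1 := ht'.trans (min_le_left _ _)
  have ht2 : t * B2 ≤ 1 / 2 := by
    have := ht'.trans (min_le_right _ _)
    calc t * B2 ≤ 1 / (2 * B2) * B2 := by gcongr
      _ = 1 / 2 := by field_simp
  have key : ∀ x y, ‖x‖ ≤ R → x + t • v x = y + t • v y → x = y := by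
    intro x y hx hxy
    have hn : ∀ z, ‖z‖ ≤ R → ‖z + t • v z‖ ≤ R + B := by
      intro z hz
      refine (norm_add_le _ _).trans (add_le_add hz ?_)
      rw [norm_smul, Real.norm_of_nonneg ht]
      calc t * ‖v z‖ ≤ 1 * B := by gcongr; exact (hb z hz).1
        _ = B := one_mul B
    have hy : ‖y‖ ≤ R2 := by
      obtain ⟨g, hg⟩ := hR y
      have h1 := hn _ hg
      have h2 := hn _ hx
      rw [Ht_equiv hvg, ← hxy] at h1
      have hg' : g⁻¹ ∈ {g : G | ∃ x, ‖x‖ ≤ R + B ∧ ‖A.act g x‖ ≤ R + B} :=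
        ⟨_, h1, by rw [act_inv_act]; exact h2⟩
      have h3 := hR2.2 _ hg'
      refine le_trans ?_ h3
      rw [← A.act_inv_act g y, act_def A g⁻¹]
      refine (norm_add_le _ _).trans ?_
      gcongr
      exact ((A.L _).le_opNorm _).trans (by gcongr)
    have h4 := lip hv hvg R2 B2 (fun z hz => (hb2 z hz).2) y x hy (hx.trans hR2.1)
    have h5 : x - y = t • (v y - v x) := by
      rw [smul_sub, sub_eq_sub_iff_add_eq_add, add_comm (t • v y) y]; exact hxy
    have h6 : ‖x - y‖ ≤ 1 / 2 * ‖x - y‖ := by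
      calc ‖x - y‖ = t * ‖v y - v x‖ := by rw [h5, norm_smul, Real.norm_of_nonneg ht]
        _ ≤ t * (B2 * ‖y - x‖) := by gcongr
        _ = t * B2 * ‖x - y‖ := by rw [norm_sub_rev]; ring
        _ ≤ _ := by gcongr
    have : ‖x - y‖ = 0 := by linarith [norm_nonneg (x - y)]
    exact sub_eq_zero.1 (norm_eq_zero.1 this)
  intro x y hxy
  obtain ⟨g, hg⟩ := hR x
  apply (A.act_bij g).1
  apply key _ _ hg
  rw [Ht_equiv hvg, Ht_equiv hvg]
  exact congrArg _ hxy

theorem stepC (hc : A.Cocpt) :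
    ∃ t0 > (0:ℝ), ∀ t : ℝ, 0 ≤ t → t ≤ t0 → Function.Surjective (fun x => x + t • v x) := by
  obtain ⟨R, hR⟩ := hc
  obtain ⟨B, hB, hb⟩ := bound_deriv hv hvg (R + 1)
  refine ⟨1 / (2 * B), by positivity, fun t ht ht' => ?_⟩
  have htB : t * B ≤ 1 / 2 := by
    calc t * B ≤ 1 / (2 * B) * B := by gcongr
      _ = 1 / 2 := by field_simp
  have key : ∀ z, ‖z‖ ≤ R → ∃ x, x + t • v x = z := by
    intro z hz
    let φ : E → E := fun x => z - t • v x
    have hmap : Set.MapsTo φ (Metric.closedBall 0 (R + 1)) (Metric.closedBall 0 (R + 1)) := by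
      intro x hx
      simp only [Metric.mem_closedBall, dist_zero_right] at hx ⊢
      refine (norm_sub_le _ _).trans (add_le_add hz ?_)
      rw [norm_smul, Real.norm_of_nonneg ht]
      have := mul_le_mul_of_nonneg_left (hb x hx).1 ht
      linarith
    have hcontr : ContractingWith (1/2) (hmap.restrict φ _ _) := by
      refine ⟨by rw [div_lt_one] <;> norm_num, ?_⟩
      apply LipschitzWith.of_dist_le_mul
      rintro ⟨x, hx⟩ ⟨y, hy⟩
      simp only [Metric.mem_closedBall, dist_zero_right] at hx hy
      rw [Subtype.dist_eq, Subtype.dist_eq, Set.MapsTo.val_restrict_apply, Set.MapsTo.val_restrict_apply, dist_eq_norm, dist_eq_norm]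
      have h4 := lip hv hvg (R+1) B (fun z hz => (hb z hz).2) y x hy hx
      have : φ x - φ y = t • (v y - v x) := by simp [φ, smul_sub]
      rw [this, norm_smul, Real.norm_of_nonneg ht]
      calc t * _ ≤ t * (B * ‖y - x‖) := by gcongr
        _ = t * B * ‖x - y‖ := by rw [norm_sub_rev]; ring
        _ ≤ 1/2 * ‖x - y‖ := by gcongr
        _ = _ := by simp
    have hz0 : z ∈ Metric.closedBall (0:E) (R+1) := by simp; linarith
    obtain ⟨y, -, hy, -⟩ := hcontr.exists_fixedPoint' (Metric.isClosed_closedBall.isComplete) hmap hz0 (edist_ne_top _ _)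
    refine ⟨y, ?_⟩
    have : φ y = y := hy
    simp only [φ] at this
    rw [sub_eq_iff_eq_add] at this
    exact this.symm
  intro z
  obtain ⟨g, hg⟩ := hR z
  obtain ⟨x, hx⟩ := key _ hg
  refine ⟨A.act g⁻¹ x, ?_⟩
  simp only
  rw [Ht_equiv hvg, hx, act_inv_act]

open MeasureTheory in
theorem stepD (hA : A.Crys) (P : A.PU) [MeasurableSpace E] [BorelSpace E]
    (μ : Measure E) [μ.IsAddHaarMeasure] (t : ℝ)
    (hpos : ∀ x, 0 < (1 + t • fderiv ℝ v x).det)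
    (hbij : Function.Bijective (fun x => x + t • v x)) :
    ∫ x, P.χ x * (1 + t • fderiv ℝ v x).det ∂μ = ∫ x, P.χ x ∂μ := by
  set H : E → E := fun x => x + t • v x with hH
  set J : E → ℝ := fun x => (1 + t • fderiv ℝ v x).det with hJ
  have hHc : ContDiff ℝ 1 H := contDiff_id.add (contDiff_const.smul hv)
  have hJc : Continuous J := by
    apply ContinuousLinearMap.continuous_det.comp
    exact continuous_const.add ((hv.continuous_fderiv (by norm_num)).const_smul t)
  have hHd : ∀ x, fderiv ℝ H x = 1 + t • fderiv ℝ v x := by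
    intro x
    have hd := hv.differentiable (by norm_num) x
    have h1 : HasFDerivAt H (ContinuousLinearMap.id ℝ E + t • fderiv ℝ v x) x :=
      (hasFDerivAt_id x).add (hd.hasFDerivAt.const_smul t)
    exact h1.fderiv
  have hHe : ∀ g x, H (A.act g x) = A.act g (H x) := fun g x => Ht_equiv hvg t g x
  obtain ⟨B, hB, hb⟩ := bound_deriv hv hvg P.R
  have hsfin : {g : G | ∃ x, P.χ x ≠ 0 ∧ P.χ (A.act g (H x)) ≠ 0}.Finite := by
    refine (hA.proper (P.R + |t| * B)).subset ?_
    rintro g ⟨x, hx, hgx⟩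
    refine ⟨H x, ?_, ?_⟩
    · refine (norm_add_le _ _).trans (add_le_add (P.supp _ hx) ?_)
      rw [norm_smul]
      exact mul_le_mul_of_nonneg_left (hb _ (P.supp _ hx)).1 (norm_nonneg _)
    · have := P.supp _ hgx
      have h2 : 0 ≤ |t| * B := by positivity
      linarith
  set s := hsfin.toFinset with hs
  have hχc := P.smooth.continuous
  have e1 : ∀ x, P.χ x * J x = ∑ g ∈ s, P.χ (A.act g (H x)) * P.χ x * J x := by
    intro x
    rw [← Finset.sum_mul, ← Finset.sum_mul]
    by_cases hx : P.χ x = 0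
    · simp [hx]
    · have := P.sum (H x)
      rw [finsum_eq_sum_of_support_subset (s := s)] at this
      · rw [this, one_mul]
      · intro g hg
        simp only [hs, Set.Finite.coe_toFinset]
        exact ⟨x, hx, hg⟩
  have e2 : ∀ y, P.χ (H y) * J y = ∑ g ∈ s, P.χ (H y) * P.χ (A.act g⁻¹ y) * J y := by
    intro y
    rw [← Finset.sum_mul, ← Finset.mul_sum]
    by_cases hy : P.χ (H y) = 0
    · simp [hy]
    · have := P.sum y
      rw [← finsum_comp_equiv (Equiv.inv G)] at this
      simp only [Equiv.inv_apply] at this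
      rw [finsum_eq_sum_of_support_subset (s := s)] at this
      · rw [this, mul_one]
      · intro g hg
        simp only [hs, Set.Finite.coe_toFinset]
        refine ⟨A.act g⁻¹ y, hg, ?_⟩
        rw [hHe, act_act_inv]; exact hy
  have hHcont := hHc.continuous
  have hac := A.continuous_act
  have i1 : ∀ g ∈ s, Integrable (fun x => P.χ (A.act g (H x)) * P.χ x * J x) μ := by
    intro g _
    apply Continuous.integrable_of_hasCompactSupport
    · exact ((hχc.comp ((hac g).comp hHcont)).mul hχc).mul hJc
    · apply HasCompactSupport.intro (isCompact_closedBall (0:E) P.R)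
      intro x hx
      have : P.χ x = 0 := by
        by_contra h; exact hx (by simpa using P.supp _ h)
      simp [this]
  have i2 : ∀ g ∈ s, Integrable (fun x => P.χ (H x) * P.χ (A.act g⁻¹ x) * J x) μ := by
    intro g _
    apply Continuous.integrable_of_hasCompactSupport
    · exact ((hχc.comp hHcont).mul (hχc.comp (hac _))).mul hJc
    · apply HasCompactSupport.intro ((isCompact_closedBall (0:E) P.R).image (hac g))
      intro x hx
      have : P.χ (A.act g⁻¹ x) = 0 := by
        by_contra h
        exact hx ⟨_, by simpa using P.supp _ h, A.act_act_inv g x⟩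
      simp [this]
  calc ∫ x, P.χ x * J x ∂μ = ∫ x, ∑ g ∈ s, P.χ (A.act g (H x)) * P.χ x * J x ∂μ := by
        congr 1; ext x; exact e1 x
    _ = ∑ g ∈ s, ∫ x, P.χ (A.act g (H x)) * P.χ x * J x ∂μ := integral_finset_sum _ i1
    _ = ∑ g ∈ s, ∫ x, P.χ (H x) * P.χ (A.act g⁻¹ x) * J x ∂μ := by
        apply Finset.sum_congr rfl
        intro g _
        rw [← integral_act μ hA.unimod g⁻¹]
        congr 1; ext x
        rw [hHe, act_act_inv]
        congr 1
        exact det_inv hv hvg g⁻¹ x t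
    _ = ∫ x, ∑ g ∈ s, P.χ (H x) * P.χ (A.act g⁻¹ x) * J x ∂μ := (integral_finset_sum _ i2).symm
    _ = ∫ x, |(fderiv ℝ H x).det| * P.χ (H x) ∂μ := by
        congr 1; ext x
        rw [← e2, hHd, abs_of_pos (hpos x), mul_comm]
    _ = ∫ x, P.χ x ∂μ := change_var μ H hHc hbij _
end

open MeasureTheory in
/-- theorem P -/
theorem exists_det_ne_zero [FiniteDimensional ℝ E] (hA : A.Crys) (h : E → E) (hh : ContDiff ℝ 1 h)
    (heq : ∀ g x, h (A.act g x) = A.act g (h x)) : ∃ x, (fderiv ℝ h x).det ≠ 0 := by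
  by_contra! hcon
  letI : MeasurableSpace E := borel E
  haveI : BorelSpace E := ⟨rfl⟩
  let μ : Measure E := Measure.addHaar
  obtain ⟨P⟩ := exists_PU hA.proper hA.cocpt
  set v : E → E := fun x => h x - x with hvdef
  have hv : ContDiff ℝ 1 v := hh.sub contDiff_id
  have hvg : ∀ g x, v (A.act g x) = A.L g (v x) := by
    intro g x
    simp only [hvdef, heq, act_sub]
  have hvd : ∀ x, 1 + (1:ℝ) • fderiv ℝ v x = fderiv ℝ h x := by
    intro x
    have hd := hh.differentiable (by norm_num) x
    rw [hvdef, fderiv_fun_sub hd differentiableAt_fun_id]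
    rw [one_smul, fderiv_fun_id]
    exact add_sub_cancel _ _
  obtain ⟨ta, hta, hA1⟩ := stepA hv hvg hA.cocpt
  obtain ⟨tb, htb, hB1⟩ := stepB hv hvg hA.proper hA.cocpt
  obtain ⟨tc, htc, hC1⟩ := stepC hv hvg hA.cocpt
  set t0 := min ta (min tb tc) with ht0
  have ht0pos : 0 < t0 := by positivity
  have hD : ∀ t, 0 ≤ t → t ≤ t0 → ∫ x, P.χ x * (1 + t • fderiv ℝ v x).det ∂μ = ∫ x, P.χ x ∂μ := by
    intro t h0 h1
    exact stepD hv hvg hA P μ t (hA1 t h0 (h1.trans (min_le_left _ _)))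
      ⟨hB1 t h0 (h1.trans ((min_le_right _ _).trans (min_le_left _ _))),
       hC1 t h0 (h1.trans ((min_le_right _ _).trans (min_le_right _ _)))⟩
  set d := Module.finrank ℝ E
  let nd : ℕ → ℝ := fun i => t0 * (i / (d + 1))
  let s := Finset.range (d + 1)
  have hinj : Set.InjOn nd s := by
    intro i _ j _ hij
    simp only [nd] at hij
    have := mul_left_cancel₀ ht0pos.ne' hij
    field_simp at this
    exact_mod_cast this
  let c : ℕ → ℝ := fun i => (Lagrange.basis s nd i).eval 1
  have hc1 : ∑ i ∈ s, c i = 1 := by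
    have := congrArg (Polynomial.eval 1) (Lagrange.sum_basis hinj ⟨0, by simp [s]⟩)
    simpa [Polynomial.eval_finset_sum] using this
  have hdet : ∀ x, (1 + (1:ℝ) • fderiv ℝ v x).det = ∑ i ∈ s, c i * (1 + nd i • fderiv ℝ v x).det := by
    intro x
    obtain ⟨p, hp, hpe⟩ := det_poly (fderiv ℝ v x)
    have hlt : p.degree < (s.card : ℕ) := by
      refine lt_of_le_of_lt Polynomial.degree_le_natDegree ?_
      simp only [s, Finset.card_range]
      exact_mod_cast Nat.lt_succ_of_le hp
    have := Lagrange.eq_interpolate hinj hlt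
    have := congrArg (Polynomial.eval 1) this
    rw [Lagrange.interpolate_apply, Polynomial.eval_finset_sum] at this
    rw [← hpe, this]
    apply Finset.sum_congr rfl
    intro i _
    rw [Polynomial.eval_mul, Polynomial.eval_C, hpe, mul_comm]
  have hintg : ∀ t : ℝ, Integrable (fun x => P.χ x * (1 + t • fderiv ℝ v x).det) μ := by
    intro t
    apply Continuous.integrable_of_hasCompactSupport
    · refine P.smooth.continuous.mul (ContinuousLinearMap.continuous_det.comp ?_)
      exact continuous_const.add ((hv.continuous_fderiv (by norm_num)).const_smul t)
    · apply HasCompactSupport.intro (isCompact_closedBall (0:E) P.R)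
      intro x hx
      have : P.χ x = 0 := by
        by_contra h; exact hx (by simpa using P.supp _ h)
      simp [this]
  have hfinal : ∫ x, P.χ x * (1 + (1:ℝ) • fderiv ℝ v x).det ∂μ = ∫ x, P.χ x ∂μ := by
    calc _ = ∫ x, ∑ i ∈ s, c i * (P.χ x * (1 + nd i • fderiv ℝ v x).det) ∂μ := by
          congr 1; ext x; rw [hdet, Finset.mul_sum]
          apply Finset.sum_congr rfl; intro i _; ring
      _ = ∑ i ∈ s, ∫ x, c i * (P.χ x * (1 + nd i • fderiv ℝ v x).det) ∂μ :=
          integral_finset_sum _ fun i _ => (hintg _).const_mul _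
      _ = ∑ i ∈ s, c i * ∫ x, P.χ x ∂μ := by
          apply Finset.sum_congr rfl; intro i hi
          rw [integral_const_mul, hD]
          · simp only [nd]; positivity
          · simp only [nd]
            have hi' : (i : ℝ) / (d + 1) ≤ 1 := by
              rw [div_le_one (by positivity)]
              have : i < d + 1 := by simpa [s] using hi
              exact_mod_cast this.le
            calc t0 * _ ≤ t0 * 1 := by gcongr
              _ = t0 := mul_one _
      _ = _ := by rw [← Finset.sum_mul, hc1, one_mul]
  simp_rw [hvd, hcon] at hfinal
  simp only [mul_zero, integral_zero] at hfinal
  obtain ⟨x0, hx0⟩ : ∃ x0, P.χ x0 ≠ 0 := by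
    by_contra! h0
    have := P.sum 0
    simp [h0] at this
  have hcs : HasCompactSupport P.χ := by
    apply HasCompactSupport.intro (isCompact_closedBall (0:E) P.R)
    intro x hx
    by_contra h; exact hx (by simpa using P.supp _ h)
  have := P.smooth.continuous.integral_pos_of_hasCompactSupport_nonneg_nonzero (μ := μ) hcs P.nonneg hx0
  linarith

end AffAct
end HLC
end

noncomputable section
namespace HLC
open Filter Topology
set_option linter.unusedSectionVars false

namespace AffAct
variable {G E Q : Type*} [Group G] [NormedAddCommGroup E] [NormedSpace ℝ E]
  [NormedAddCommGroup Q] [NormedSpace ℝ Q] {A : AffAct G E}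

theorem exists_surj [FiniteDimensional ℝ E] (hA : A.Crys) (h : E → E) (hh : ContDiff ℝ 1 h)
    (heq : ∀ g x, h (A.act g x) = A.act g (h x)) :
    ∃ x, Function.Surjective (fderiv ℝ h x) := by
  obtain ⟨x, hx⟩ := exists_det_ne_zero hA h hh heq
  refine ⟨x, ?_⟩
  have := (LinearMap.equivOfDetNeZero _ hx).surjective
  exact this

theorem Crys.noInv [FiniteDimensional ℝ E] (hA : A.Crys) : A.NoInv := by
  rintro Y hY ⟨y, hyY, hy⟩
  obtain ⟨p, hp⟩ : ∃ p : E, (p, (1:ℝ)) ∈ Y := by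
    refine ⟨y.2⁻¹ • y.1, ?_⟩
    have := Y.smul_mem y.2⁻¹ hyY
    convert this using 1
    ext <;> simp [hy]
  let Y0 : Submodule ℝ E := Y.comap (LinearMap.inl ℝ E ℝ)
  have hpg : ∀ g, A.act g p - p ∈ Y0 := by
    intro g
    have := Y.sub_mem (hY g _ hp) hp
    simp only [Y0, Submodule.mem_comap, LinearMap.inl_apply]
    rw [hat_one] at this
    simpa using this
  have htop : Y0 = ⊤ := by
    by_contra hne
    obtain ⟨φ, hφ0, hφ⟩ := Submodule.exists_le_ker_of_lt_top Y0 (lt_top_iff_ne_top.2 hne)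
    obtain ⟨P⟩ := exists_PU hA.proper hA.cocpt
    let h := P.Av (fun _ => p)
    have hc : ContDiff ℝ 1 h := P.Av_contDiff hA.proper _ contDiff_const
    obtain ⟨x, hx⟩ := exists_surj hA h hc (fun g x => P.Av_equiv hA.proper _ g x)
    have hmem : ∀ x, h x - p ∈ Y0 := by
      intro x
      have h1 : h x = ∑ᶠ g, P.χ (A.act g x) • ((A.act g⁻¹ p - p) + p) := by
        simp [h, PU.Av]
      rw [h1, P.sum_add hA.proper, P.sum_const hA.proper, add_sub_cancel_right]
      exact P.mem_sum x Y0 _ fun g => hpg _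
    let φc : E →L[ℝ] ℝ := LinearMap.toContinuousLinearMap φ
    have h2 : φc ∘ h = fun _ => φ p := by
      funext x
      have := hφ (hmem x)
      rw [LinearMap.mem_ker, map_sub, sub_eq_zero] at this
      exact this
    have h3 : fderiv ℝ (φc ∘ h) x = φc.comp (fderiv ℝ h x) := by
      rw [fderiv_comp _ φc.differentiableAt (hc.differentiable (by norm_num) x), ContinuousLinearMap.fderiv]
    rw [h2, fderiv_fun_const] at h3
    apply hφ0
    ext z
    obtain ⟨w, rfl⟩ := hx z
    have := congrArg (fun T => T w) h3
    simpa [φc] using this.symm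
  rw [eq_top_iff]
  rintro ⟨a, t⟩ -
  have h1 : a - t • p ∈ Y0 := by rw [htop]; trivial
  have h2 : (a - t • p, (0:ℝ)) ∈ Y := h1
  have := Y.add_mem h2 (Y.smul_mem t hp)
  simpa using this

/-- a semiconjugacy of affine actions -/
structure Semi (A : AffAct G E) (B : AffAct G Q) where
  π : E →L[ℝ] Q
  surj : Function.Surjective π
  L : ∀ g x, B.L g (π x) = π (A.L g x)
  u : ∀ g, B.u g = π (A.u g)

theorem Semi.act {B : AffAct G Q} (S : Semi A B) (g : G) (x : E) :
    B.act g (S.π x) = S.π (A.act g x) := by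
  simp [act_def, S.L, S.u]

theorem Semi.noInv {B : AffAct G Q} (S : Semi A B) (h : A.NoInv) : B.NoInv := by
  rintro Y hY ⟨y, hy, hy2⟩
  let l : (E × ℝ) →ₗ[ℝ] (Q × ℝ) := (S.π : E →ₗ[ℝ] Q).prodMap LinearMap.id
  have := h (Y.comap l) (by
    intro g z hz
    rw [Submodule.mem_comap] at hz ⊢
    have := hY g _ hz
    convert this using 1
    simp [l, S.L, S.u]) (by
    obtain ⟨x, hx⟩ := S.surj y.1
    exact ⟨(x, y.2), by simpa [l, hx] using hy, hy2⟩)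
  rw [eq_top_iff]
  rintro ⟨a, t⟩ -
  obtain ⟨x, rfl⟩ := S.surj a
  have h1 : (x, t) ∈ Y.comap l := by rw [this]; trivial
  exact h1

theorem Semi.cocpt {B : AffAct G Q} (S : Semi A B) (h : A.Cocpt) : B.Cocpt := by
  obtain ⟨R, hR⟩ := h
  refine ⟨‖S.π‖ * R, fun x => ?_⟩
  obtain ⟨y, rfl⟩ := S.surj x
  obtain ⟨g, hg⟩ := hR y
  refine ⟨g, ?_⟩
  rw [S.act]
  exact (S.π.le_opNorm _).trans (by gcongr)

def Semi.res {B : AffAct G Q} (S : Semi A B) (H : Subgroup G) : Semi (A.res H) (B.res H) where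
  π := S.π
  surj := S.surj
  L g x := S.L g x
  u g := S.u g

end AffAct
end HLC
end

noncomputable section
namespace HLC
open Filter Topology
set_option linter.unusedSectionVars false
open scoped ComplexConjugate

theorem finite_of_sep {X : Type*} [PseudoMetricSpace X] [ProperSpace X] (S : Set X)
    (hb : Bornology.IsBounded S) (ε : ℝ) (hε : 0 < ε) (hs : ∀ x ∈ S, ∀ y ∈ S, dist x y < ε → x = y) :
    S.Finite := by
  have ht : TotallyBounded S := (Bornology.IsBounded.isCompact_closure hb).totallyBounded.subset subset_closure
  obtain ⟨t, ht, hc⟩ := Metric.totallyBounded_iff.1 ht (ε / 2) (by positivity)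
  have hex : ∀ x : S, ∃ y ∈ t, dist (x : X) y < ε / 2 := by
    intro x
    have := hc x.2
    simpa using this
  choose f hf hf2 using hex
  have hfin : Finite t := ht
  have : Finite S := by
    refine Finite.of_injective (β := t) (fun x => ⟨f x, hf x⟩) ?_
    intro x y hxy
    have hxy' : f x = f y := congrArg Subtype.val hxy
    apply Subtype.ext
    apply hs _ x.2 _ y.2
    have h1 := hf2 x
    have h2 := hf2 y
    rw [hxy'] at h1
    have := dist_triangle_right (x : X) y (f y)
    linarith
  exact this

theorem finite_image {G E : Type*} [Group G] [NormedAddCommGroup E] [NormedSpace ℝ E]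
    [FiniteDimensional ℝ E] (d : G →* (E →L[ℝ] E)) (c : ℝ) (hc : 0 < c)
    (hd : ∀ g, ‖d g - 1‖ < c → d g = 1) (C : ℝ) (S : Set G)
    (hS : ∀ g ∈ S, ‖d g‖ ≤ C ∧ ‖d g⁻¹‖ ≤ C) : (d '' S).Finite := by
  have : ProperSpace (E →L[ℝ] E) := FiniteDimensional.proper_real _
  apply finite_of_sep _ _ (c / (max C 1)) (by positivity)
  · rintro _ ⟨g, hg, rfl⟩ _ ⟨g', hg', rfl⟩ hdist
    have h1 : d (g⁻¹ * g') = 1 := by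
      apply hd
      have : d (g⁻¹ * g') - 1 = d g⁻¹ * (d g' - d g) := by
        rw [mul_sub, ← map_mul, ← map_mul]; simp
      rw [this]
      refine lt_of_le_of_lt (norm_mul_le _ _) ?_
      rw [dist_comm, dist_eq_norm, lt_div_iff₀ (by positivity)] at hdist
      refine lt_of_le_of_lt ?_ hdist
      rw [mul_comm]
      gcongr
      exact (hS g hg).2.trans (le_max_left _ _)
    rw [map_mul] at h1
    have h2 := congrArg (fun T => d g * T) h1
    simp only [mul_one] at h2
    rw [← mul_assoc, ← map_mul] at h2
    simpa using h2.symm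
  · rw [isBounded_iff_forall_norm_le]
    refine ⟨C, ?_⟩
    rintro _ ⟨g, hg, rfl⟩
    exact (hS g hg).1

/-- hermitian form of Lorentz signature -/
structure Herm (V : Type*) [AddCommGroup V] [Module ℂ V] where
  h : V →ₗ⋆[ℂ] V →ₗ[ℂ] ℂ
  symm : ∀ x y, conj (h x y) = h y x
  nondeg : ∀ x, (∀ y, h x y = 0) → x = 0
  ν : V →ₗ[ℂ] ℂ
  pos : ∀ z, ν z = 0 → z ≠ 0 → 0 < (h z z).re
  neg : ∃ o, (h o o).re < 0

namespace Herm
section alg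
variable {V : Type*} [AddCommGroup V] [Module ℂ V] (B : Herm V)

def q (x : V) : ℝ := (B.h x x).re

theorem h_self (x : V) : B.h x x = (B.q x : ℂ) := by
  have := B.symm x x
  rw [Complex.conj_eq_iff_real] at this
  obtain ⟨r, hr⟩ := this
  rw [hr, q, hr]; simp

theorem h_eq_zero_symm {x y : V} (h : B.h x y = 0) : B.h y x = 0 := by
  rw [← B.symm, h, map_zero]

theorem norm_h_symm (x y : V) : ‖B.h x y‖ = ‖B.h y x‖ := by
  rw [← B.symm, RCLike.norm_conj]

theorem q_smul (c : ℂ) (x : V) : B.q (c • x) = ‖c‖ ^ 2 * B.q x := by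
  have : B.h (c • x) (c • x) = ((‖c‖ ^ 2 * B.q x : ℝ) : ℂ) := by
    simp only [map_smulₛₗ, LinearMap.smul_apply, map_smul, smul_eq_mul, B.h_self]
    push_cast
    rw [← Complex.conj_mul']
    simp; ring
  rw [q, this, Complex.ofReal_re]

theorem q_add (x y : V) : B.q (x + y) = B.q x + B.q y + 2 * (B.h x y).re := by
  have h1 : (B.h y x).re = (B.h x y).re := by rw [← B.symm]; simp
  simp only [q, map_add, LinearMap.add_apply, Complex.add_re]
  rw [h1]; ring

theorem q_zero : B.q 0 = 0 := by simp [q]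

theorem q_add_orth {x y : V} (h : B.h x y = 0) : B.q (x + y) = B.q x + B.q y := by
  rw [q_add, h]; simp

theorem core {x y : V} (hx : B.q x ≤ 0) (hx0 : x ≠ 0) (hxy : B.h x y = 0) :
    0 ≤ B.q y ∧ (B.q y = 0 → ∃ c : ℂ, y = c • x) := by
  have hν : B.ν x ≠ 0 := fun h => not_lt.2 hx (B.pos x h hx0)
  set c := B.ν y / B.ν x
  set z := y - c • x with hz
  have hνz : B.ν z = 0 := by simp [hz, c, hν]
  have hy : y = c • x + z := by simp [hz]
  have hxz : z ≠ 0 → 0 < B.q z := B.pos z hνz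
  have hqz : B.q z = B.q y + ‖c‖ ^ 2 * B.q x := by
    have : z = y + (-c) • x := by rw [hz, neg_smul, sub_eq_add_neg]
    rw [this, q_add_orth, q_smul, norm_neg]
    rw [map_smul, B.h_eq_zero_symm hxy, smul_zero]
  have hle : B.q z ≤ B.q y := by nlinarith [sq_nonneg ‖c‖]
  by_cases hz0 : z = 0
  · rw [hz0, q_zero] at hle
    exact ⟨hle, fun _ => ⟨c, by rw [hy, hz0, add_zero]⟩⟩
  · have := hxz hz0
    exact ⟨by linarith, fun h => by linarith⟩

theorem pos_of_orth_neg {x y : V} (hx : B.q x < 0) (hxy : B.h x y = 0) (hy : y ≠ 0) :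
    0 < B.q y := by
  have hx0 : x ≠ 0 := fun h => by rw [h, q_zero] at hx; exact lt_irrefl _ hx
  obtain ⟨h1, h2⟩ := B.core hx.le hx0 hxy
  refine lt_of_le_of_ne h1 fun h => ?_
  obtain ⟨c, rfl⟩ := h2 h.symm
  rw [q_smul] at h
  have : ‖c‖ ^ 2 = 0 := by
    rcases mul_eq_zero.1 h.symm with h | h
    · exact h
    · exact absurd h hx.ne
  have hc : c = 0 := by simpa using this
  exact hy (by simp [hc])

/-- positive definite form attached to a negative vector -/
def N (o v : V) : ℝ := B.q v + 2 * ‖B.h o v‖ ^ 2 / |B.q o|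

theorem decomp {o : V} (ho : B.q o ≠ 0) (v : V) :
    ∃ c : ℂ, ∃ w, v = c • o + w ∧ B.h o w = 0 ∧ B.h o v = c * B.q o := by
  have : (B.q o : ℂ) ≠ 0 := by exact_mod_cast ho
  refine ⟨B.h o v / B.q o, v - (B.h o v / B.q o) • o, by simp, ?_, ?_⟩
  · simp only [map_sub, map_smul, B.h_self, smul_eq_mul]; field_simp; simp
  · field_simp

theorem N_pos {o : V} (ho : B.q o < 0) {v : V} (hv : v ≠ 0) : 0 < B.N o v := by
  obtain ⟨c, w, hw, how, hov⟩ := B.decomp ho.ne v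
  have h1 : B.N o v = ‖c‖ ^ 2 * |B.q o| + B.q w := by
    rw [N, hov, norm_mul, Complex.norm_real, Real.norm_eq_abs, abs_of_neg ho]
    have : B.q v = ‖c‖ ^ 2 * B.q o + B.q w := by
      rw [hw, q_add_orth, q_smul]
      simp [how]
    rw [this]
    have := ho.ne
    field_simp; ring
  have h2 : 0 < |B.q o| := abs_pos.2 ho.ne
  by_cases hw0 : w = 0
  · have hc : c ≠ 0 := by
      rintro rfl; apply hv; rw [hw, hw0]; simp
    rw [h1, hw0, q_zero]
    positivity
  · have := B.pos_of_orth_neg ho how hw0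
    rw [h1]; positivity

/-- orthogonal complement -/
def orth (S : Submodule ℂ V) : Submodule ℂ V where
  carrier := {y | ∀ x ∈ S, B.h x y = 0}
  add_mem' := by intro a b ha hb x hx; rw [map_add, ha x hx, hb x hx, add_zero]
  zero_mem' := by intro x _; simp
  smul_mem' := by intro c a ha x hx; rw [map_smul, ha x hx, smul_zero]

theorem mem_orth {S : Submodule ℂ V} {y : V} : y ∈ B.orth S ↔ ∀ x ∈ S, B.h x y = 0 := Iff.rfl

theorem mem_orth' {S : Submodule ℂ V} {y : V} : y ∈ B.orth S ↔ ∀ x ∈ S, B.h y x = 0 :=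
  ⟨fun h x hx => B.h_eq_zero_symm (h x hx), fun h x hx => B.h_eq_zero_symm (h x hx)⟩

/-- if a subspace `S` is nondegenerate, it is complemented by its orthogonal -/
theorem exists_orth_decomp [FiniteDimensional ℂ V] (S : Submodule ℂ V)
    (hS : ∀ x ∈ S, x ∈ B.orth S → x = 0) (v : V) : ∃ s ∈ S, v - s ∈ B.orth S := by
  -- the map S → (S → conj-dual)
  let φ : S →ₗ[ℂ] (S →ₗ⋆[ℂ] ℂ) :=
    { toFun := fun s => 
        { toFun := fun x => B.h x s
          map_add' := by intro a b; simp
          map_smul' := by intro c a; simp }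
      map_add' := by intro a b; ext x; simp
      map_smul' := by intro c a; ext x; simp }
  let φ' : S →ₗ⋆[ℂ] (S →ₗ[ℂ] ℂ) :=
    { toFun := fun s => (B.h s).domRestrict S
      map_add' := by intro a b; ext x; simp
      map_smul' := by intro c a; ext x; simp }
  have hinj : Function.Injective φ' := by
    rw [injective_iff_map_eq_zero]
    intro a ha
    apply Subtype.ext
    apply hS _ a.2
    rw [mem_orth']
    intro x hx
    exact congrArg (fun l => l ⟨x, hx⟩) ha
  -- count real dimensions
  let φr : S →ₗ[ℝ] (S →ₗ[ℂ] ℂ) :=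
    { toFun := φ', map_add' := φ'.map_add, map_smul' := by
        intro r x
        have h1 := φ'.map_smulₛₗ (r : ℂ) x
        simp only [Complex.conj_ofReal, Complex.coe_smul] at h1
        exact h1 }
  have hdim : Module.finrank ℝ S = Module.finrank ℝ (S →ₗ[ℂ] ℂ) := by
    have h1 := Module.finrank_mul_finrank ℝ ℂ S
    have h2 := Module.finrank_mul_finrank ℝ ℂ (S →ₗ[ℂ] ℂ)
    have h3 : Module.finrank ℂ (S →ₗ[ℂ] ℂ) = Module.finrank ℂ S := Subspace.dual_finrank_eq
    rw [← h1, ← h2, h3]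
  have : FiniteDimensional ℝ S := FiniteDimensional.trans ℝ ℂ S
  have : FiniteDimensional ℝ (S →ₗ[ℂ] ℂ) := FiniteDimensional.trans ℝ ℂ _
  have hsurj : Function.Surjective φr :=
    (LinearMap.injective_iff_surjective_of_finrank_eq_finrank hdim).1 hinj
  obtain ⟨s, hs⟩ := hsurj ((B.h v).domRestrict S)
  refine ⟨s, s.2, ?_⟩
  rw [mem_orth']
  intro x hx
  have := congrArg (fun l => l ⟨x, hx⟩) hs
  rw [map_sub, LinearMap.sub_apply, sub_eq_zero]
  exact this.symm

end alg

section norm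
variable {V : Type*} [NormedAddCommGroup V] [NormedSpace ℂ V] [FiniteDimensional ℂ V] (B : Herm V)

/-- continuous version -/
def hc (x : V) : V →L[ℂ] ℂ := LinearMap.toContinuousLinearMap (B.h x)

theorem exists_bound : ∃ M > 0, ∀ x y, ‖B.h x y‖ ≤ M * ‖x‖ * ‖y‖ := by
  let φ : V →ₗ⋆[ℂ] (V →L[ℂ] ℂ) :=
    { toFun := fun x => LinearMap.toContinuousLinearMap (B.h x)
      map_add' := by intro a b; simp
      map_smul' := by intro c a; simp }
  let φr : V →ₗ[ℝ] (V →L[ℂ] ℂ) :=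
    { toFun := φ, map_add' := φ.map_add, map_smul' := by
        intro r x
        have h1 := φ.map_smulₛₗ (r : ℂ) x
        simp only [Complex.conj_ofReal, Complex.coe_smul] at h1
        rw [h1]; ext y; simp }
  have : FiniteDimensional ℝ V := FiniteDimensional.trans ℝ ℂ V
  let φc : V →L[ℝ] (V →L[ℂ] ℂ) := LinearMap.toContinuousLinearMap φr
  refine ⟨‖φc‖ + 1, by positivity, fun x y => ?_⟩
  have h1 : ‖φc x y‖ ≤ ‖φc‖ * ‖x‖ * ‖y‖ :=
    ((φc x).le_opNorm y).trans (by gcongr; exact φc.le_opNorm x)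
  have h2 : φc x y = B.h x y := rfl
  rw [← h2]
  refine h1.trans ?_
  gcongr; linarith

theorem continuous_h : Continuous fun p : V × V => B.h p.1 p.2 := by
  obtain ⟨M, hM, hb⟩ := B.exists_bound
  rw [continuous_iff_continuousAt]
  rintro ⟨a, b⟩
  rw [ContinuousAt, tendsto_iff_norm_sub_tendsto_zero]
  have : Tendsto (fun p : V × V => M * ‖p.1 - a‖ * ‖p.2‖ + M * ‖a‖ * ‖p.2 - b‖) (𝓝 (a, b)) (𝓝 0) := by
    have : Continuous (fun p : V × V => M * ‖p.1 - a‖ * ‖p.2‖ + M * ‖a‖ * ‖p.2 - b‖) := by fun_prop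
    have h := this.tendsto (a, b)
    simpa using h
  refine squeeze_zero (fun _ => norm_nonneg _) ?_ this
  rintro ⟨x, y⟩
  have : B.h x y - B.h a b = B.h (x - a) y + B.h a (y - b) := by simp
  simp only
  rw [this]
  exact (norm_add_le _ _).trans (add_le_add (hb _ _) (hb _ _))

theorem continuous_q : Continuous B.q := by
  have := B.continuous_h.comp (continuous_id.prodMk continuous_id)
  exact Complex.continuous_re.comp this

theorem continuous_h_right (o : V) : Continuous fun v => B.h o v :=
  B.continuous_h.comp (continuous_const.prodMk continuous_id)

theorem exists_N_lower {o : V} (ho : B.q o < 0) : ∃ m > 0, ∀ v, m * ‖v‖ ^ 2 ≤ B.N o v := by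
  have hN : Continuous (B.N o) := by
    unfold N
    have := B.continuous_q
    have := B.continuous_h_right o
    fun_prop
  have : ProperSpace V := FiniteDimensional.proper ℂ V
  have hsc : ∀ (c : ℝ) v, B.N o ((c : ℂ) • v) = c ^ 2 * B.N o v := by
    intro c v
    simp only [N, q_smul, map_smul, norm_smul, Complex.norm_real, Real.norm_eq_abs, sq_abs]
    rw [mul_pow, sq_abs]; ring
  have hcomp := isCompact_sphere (0 : V) 1
  rcases (Metric.sphere (0 : V) 1).eq_empty_or_nonempty with he | hne
  · refine ⟨1, one_pos, fun v => ?_⟩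
    have : v = 0 := by
      by_contra hv
      have : ((‖v‖⁻¹ : ℝ) : ℂ) • v ∈ Metric.sphere (0 : V) 1 := by
        simp [norm_smul, hv]
      rw [he] at this; exact this
    simp [this, N, q_zero]
  · obtain ⟨v0, hv0, hmin⟩ := hcomp.exists_isMinOn hne hN.continuousOn
    have hv0' : v0 ≠ 0 := by rintro rfl; simp at hv0
    refine ⟨B.N o v0, B.N_pos ho hv0', fun v => ?_⟩
    by_cases hv : v = 0
    · simp [hv, N, q_zero]
    · have h1 : ((‖v‖⁻¹ : ℝ) : ℂ) • v ∈ Metric.sphere (0 : V) 1 := by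
        simp [norm_smul, hv]
      have h2 := hmin h1
      rw [Set.mem_ofPred_eq, hsc] at h2
      have h3 : 0 < ‖v‖ := norm_pos_iff.2 hv
      have h4 : ‖v‖⁻¹ ^ 2 * B.N o v * ‖v‖ ^ 2 = B.N o v := by field_simp
      calc _ ≤ ‖v‖⁻¹ ^ 2 * B.N o v * ‖v‖ ^ 2 := by gcongr
        _ = _ := h4

/-- BD : an isometry is bounded in terms of the displacement of a negative vector -/
theorem bd {o : V} (ho : B.q o < 0) (C : ℝ) : ∃ C' > 0, ∀ T S : V →L[ℝ] V,
    (∀ x y, B.h (T x) (T y) = B.h x y) → (∀ x, T (S x) = x) → ‖B.h o (T o)‖ ≤ C → ‖T‖ ≤ C' := by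
  obtain ⟨m, hm, hN⟩ := B.exists_N_lower ho
  obtain ⟨M, hM, hb⟩ := B.exists_bound
  have hqo : 0 < |B.q o| := abs_pos.2 ho.ne
  -- bound for S o
  set D := Real.sqrt ((|B.q o| + 2 * C ^ 2 / |B.q o|) / m) with hD
  set K := (M + 2 * (M * D) ^ 2 / |B.q o|) / m with hK
  refine ⟨Real.sqrt K + 1, by positivity, fun T S hT hS hC => ?_⟩
  have hq : ∀ x, B.q (T x) = B.q x := fun x => by simp [q, hT]
  have hTS : ∀ x y, B.h x (T y) = B.h (S x) y := by
    intro x y; rw [← hT (S x) y, hS]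
  have hC0 : 0 ≤ C := (norm_nonneg _).trans hC
  have hSo : ‖S o‖ ≤ D := by
    apply Real.le_sqrt_of_sq_le
    rw [le_div_iff₀ hm]
    have h1 := hN (S o)
    rw [N] at h1
    have h2 : B.q (S o) = B.q o := by rw [← hq, hS]
    have h3 : ‖B.h o (S o)‖ = ‖B.h o (T o)‖ := by rw [hTS, norm_h_symm]
    rw [h2, h3] at h1
    rw [mul_comm]
    refine h1.trans ?_
    gcongr
    exact le_abs_self _
  have hD0 : 0 ≤ D := Real.sqrt_nonneg _
  refine ContinuousLinearMap.opNorm_le_bound _ (by positivity) fun v => ?_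
  have h1 := hN (T v)
  rw [N, hq, hTS] at h1
  have h2 : ‖B.h (S o) v‖ ≤ M * D * ‖v‖ := (hb _ _).trans (by gcongr)
  have h3 : B.q v ≤ M * ‖v‖ ^ 2 := by
    have := hb v v
    rw [B.h_self, Complex.norm_real] at this
    calc B.q v ≤ ‖B.q v‖ := le_abs_self _
      _ ≤ _ := this
      _ = _ := by ring
  have h4 : m * ‖T v‖ ^ 2 ≤ m * (K * ‖v‖ ^ 2) := by
    refine h1.trans ?_
    have : m * (K * ‖v‖ ^ 2) = M * ‖v‖ ^ 2 + 2 * (M * D * ‖v‖) ^ 2 / |B.q o| := by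
      rw [hK]; field_simp
    rw [this]
    gcongr
  have h5 : ‖T v‖ ^ 2 ≤ K * ‖v‖ ^ 2 := le_of_mul_le_mul_left h4 hm
  have hK0 : 0 ≤ K := by rw [hK]; positivity
  have h6 : ‖T v‖ ≤ Real.sqrt K * ‖v‖ := by
    rw [← Real.sqrt_sq (norm_nonneg v), ← Real.sqrt_mul hK0]
    exact Real.le_sqrt_of_sq_le h5
  refine h6.trans ?_
  gcongr; linarith

end norm
end Herm
end HLC
end

noncomputable section
namespace HLC
open Filter Topology
set_option linter.unusedSectionVars false
open scoped ComplexConjugate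

structure Setup {G V : Type*} [Group G] [NormedAddCommGroup V] [NormedSpace ℂ V]
    (B : Herm V) (A : AffAct G V) : Prop where
  crys : A.Crys
  smul : ∀ g (c : ℂ) x, A.L g (c • x) = c • A.L g x
  inv : ∀ g x y, B.h (A.L g x) (A.L g y) = B.h x y

namespace Setup
variable {G V : Type*} [Group G] [NormedAddCommGroup V] [NormedSpace ℂ V] 
  {B : Herm V} {A : AffAct G V} 

theorem res (S : Setup B A) (H : Subgroup G) [H.FiniteIndex] : Setup B (A.res H) :=
  ⟨S.crys.res H, fun g => S.smul g, fun g => S.inv g⟩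

theorem h_L (S : Setup B A) (g : G) (x y : V) : B.h x (A.L g y) = B.h (A.L g⁻¹ x) y := by
  rw [← S.inv g⁻¹ x, A.L_inv_L]

theorem q_L (S : Setup B A) (g : G) (x : V) : B.q (A.L g x) = B.q x := by
  simp [Herm.q, S.inv]

theorem orth_inv (S : Setup B A) {F : Submodule ℂ V} (hF : ∀ g, ∀ x ∈ F, A.L g x ∈ F) (g : G)
    {x : V} (hx : x ∈ B.orth F) : A.L g x ∈ B.orth F := by
  intro y hy
  rw [S.h_L]
  exact hx _ (hF _ _ hy)

def Parab (B : Herm V) (A : AffAct G V) : Prop :=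
  ∃ e : V, e ≠ 0 ∧ B.q e = 0 ∧ ∀ g, ∃ c : ℂ, A.L g e = c • e

def Discr (A : AffAct G V) : Prop := ∃ c > 0, ∀ g, ‖A.L g - 1‖ < c → A.L g = 1

variable [FiniteDimensional ℂ V]

theorem finReal : FiniteDimensional ℝ V := FiniteDimensional.trans ℝ ℂ V

theorem step4 (S : Setup B A) : Parab B A ∨ Discr A := by
  have : FiniteDimensional ℝ V := finReal
  let sc : ℝ → ((V × ℝ) →L[ℝ] (V × ℝ)) := fun r =>
    (r • ContinuousLinearMap.id ℝ V).prodMap (ContinuousLinearMap.id ℝ ℝ)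
  have hsc : ∀ r z, sc r z = (r • z.1, z.2) := fun r z => rfl
  obtain ⟨c0, hc0, hF0⟩ := A.Rprime S.crys.noInv S.crys.disc A.L (fun k => sc ((2⁻¹:ℝ)^k))
    (fun k => sc ((2:ℝ)^k)) (by
      intro k; ext z <;> simp [hsc])
    (by intro k; ext z <;> simp [hsc]) (by
      intro g
      let T : (V × ℝ) →L[ℝ] (V × ℝ) := ((ContinuousLinearMap.snd ℝ V ℝ).smulRight (A.u g)).prod 0
      have h1 : ∀ k : ℕ, sc ((2⁻¹:ℝ)^k) * A.hat g * sc ((2:ℝ)^k) =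
          AffAct.dhat (A.L g) + ((2⁻¹:ℝ)^k) • T := by
        intro k; ext z <;> simp [hsc, T, AffAct.dhat]
      simp_rw [h1]
      have h2 : Tendsto (fun k : ℕ => ((2⁻¹:ℝ)^k) • T) atTop (𝓝 ((0:ℝ) • T)) :=
        (tendsto_pow_atTop_nhds_zero_of_lt_one (by norm_num) (by norm_num)).smul_const T
      have h3 := (tendsto_const_nhds (x := AffAct.dhat (A.L g))).add h2
      simpa using h3)
  set N := Module.finrank ℝ (V × ℝ) with hN
  let F : ℝ → Submodule ℂ V := fun c =>
    { carrier := {x | ∀ g, ‖A.L g - 1‖ < c → A.L g x = x}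
      add_mem' := by intro a b ha hb g hg; rw [map_add, ha g hg, hb g hg]
      zero_mem' := by intro g _; simp
      smul_mem' := by intro c a ha g hg; rw [S.smul, ha g hg] }
  have hFmem : ∀ c x, x ∈ F c ↔ ∀ g, ‖A.L g - 1‖ < c → A.L g x = x := fun c x => Iff.rfl
  have hFanti : ∀ c c', c ≤ c' → F c' ≤ F c := fun c c' h x hx g hg => hx g (hg.trans_le h)
  obtain ⟨c, ⟨hcpos, hcc0⟩, hcmax⟩ := exists_max_nat (fun c : ℝ => 0 < c ∧ c ≤ c0)
    (fun c => Module.finrank ℂ (F c)) (Module.finrank ℂ V) (fun c => Submodule.finrank_le _)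
    ⟨c0, hc0, le_rfl⟩
  have hFstab : ∀ c', 0 < c' → c' ≤ c → F c' = F c := by
    intro c' h1 h2
    exact (Submodule.eq_of_le_of_finrank_le (hFanti _ _ h2) (hcmax c' ⟨h1, h2.trans hcc0⟩)).symm
  have hFinv : ∀ γ, ∀ x ∈ F c, A.L γ x ∈ F c := by
    intro γ x hx
    set c' := min c (c / (‖A.L γ⁻¹‖ * ‖A.L γ‖ + 1)) with hc'
    have hc'pos : 0 < c' := lt_min hcpos (by positivity)
    rw [← hFstab c' hc'pos (min_le_left _ _)]
    intro g hg
    have h1 : ‖A.L (γ⁻¹ * g * γ) - 1‖ < c := by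
      have e : A.L (γ⁻¹ * g * γ) - 1 = A.L γ⁻¹ * (A.L g - 1) * A.L γ := by
        rw [mul_sub, sub_mul, mul_one, ← map_mul, ← map_mul, ← map_mul]; simp
      rw [e]
      have h2 : ‖A.L γ⁻¹ * (A.L g - 1) * A.L γ‖ ≤ ‖A.L γ⁻¹‖ * ‖A.L g - 1‖ * ‖A.L γ‖ :=
        (norm_mul_le _ _).trans (by gcongr; exact norm_mul_le _ _)
      have h3 : ‖A.L g - 1‖ < c / (‖A.L γ⁻¹‖ * ‖A.L γ‖ + 1) := hg.trans_le (min_le_right _ _)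
      rw [lt_div_iff₀ (by positivity)] at h3
      nlinarith [norm_nonneg (A.L g - 1), norm_nonneg (A.L γ), norm_nonneg (A.L γ⁻¹)]
    have h2 := hx _ h1
    rw [A.L_mul, A.L_mul] at h2
    have h3 := congrArg (A.L γ) h2
    rwa [A.L_L_inv] at h3
  by_cases hFt : F c = ⊤
  · right
    refine ⟨c, hcpos, fun g hg => ?_⟩
    ext x
    have : x ∈ F c := by rw [hFt]; trivial
    exact this g hg
  left
  have hFl : Fl (A.Sc A.L c) ⊥ N = ⊤ := by
    rw [eq_top_iff, ← hF0]
    apply Fl_anti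
    exact Set.image_mono fun g hg => lt_of_lt_of_le hg hcc0
  obtain ⟨v1, hv1, hv10⟩ : ∃ v ∈ B.orth (F c), v ≠ 0 := by
    by_contra! hcon
    apply hFt
    rw [eq_top_iff]
    rintro v -
    obtain ⟨s, hs, hvs⟩ := B.exists_orth_decomp (F c) (fun x _ hx => hcon x hx) v
    have := hcon _ hvs
    rw [sub_eq_zero] at this
    rwa [this]
  classical
  have hex : ∃ i, ∃ v ∈ B.orth (F c), v ≠ 0 ∧ ((v, (0:ℝ)) : V × ℝ) ∈ Fl (A.Sc A.L c) ⊥ i :=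
    ⟨N, v1, hv1, hv10, by rw [hFl]; trivial⟩
  obtain ⟨v, hv, hv0, hvi⟩ := Nat.find_spec hex
  have hmin := fun j hj => Nat.find_min hex (m := j) hj
  set i := Nat.find hex
  have hvF : v ∈ F c := by
    rcases hi : i with _ | j
    · rw [hi] at hvi
      simp [Fl] at hvi
      exact absurd hvi hv0
    · intro g hg
      rw [hi, mem_Fl_succ] at hvi
      have h1 := hvi _ ⟨g, hg, rfl⟩
      by_contra hne
      apply hmin j (by omega)
      refine ⟨A.L g v - v, sub_mem (S.orth_inv hFinv g hv) hv, sub_ne_zero.2 hne, ?_⟩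
      simpa using h1
  have hself : B.q v = 0 := by rw [Herm.q, hv v hvF]; simp
  refine ⟨v, hv0, hself, fun g => ?_⟩
  have h1 := hFinv g v hvF
  have h2 := S.orth_inv hFinv g hv
  exact (B.core hself.le hv0 (h2 v hvF)).2 (by rw [S.q_L, hself])

end Setup
end HLC
end

noncomputable section
namespace HLC
open Filter Topology
set_option linter.unusedSectionVars false
open scoped ComplexConjugate

/-- parabolic frame -/
structure PF {G V : Type*} [Group G] [NormedAddCommGroup V] [NormedSpace ℂ V]
    (B : Herm V) (A : AffAct G V) where
  e : V
  e' : V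
  lam : G → ℂ
  ee : B.h e e = 0
  ee2 : B.h e' e' = 0
  ef : B.h e e' = 1
  fe : B.h e' e = 1
  Le : ∀ g, A.L g e = lam g • e

namespace PF
variable {G V : Type*} [Group G] [NormedAddCommGroup V] [NormedSpace ℂ V]
  {B : Herm V} {A : AffAct G V} (P : PF B A)

theorem e_ne : P.e ≠ 0 := by
  intro h; have := P.ef; rw [h] at this; simp at this

theorem lam_mul (S : Setup B A) (g k : G) : P.lam (g * k) = P.lam g * P.lam k := by
  have h1 := P.Le (g * k)
  rw [A.L_mul, P.Le, S.smul, P.Le, smul_smul] at h1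
  have h2 := congrArg (B.h P.e') h1
  simp only [map_smul, P.fe, smul_eq_mul, mul_one] at h2
  rw [← h2, mul_comm]

theorem lam_one : P.lam 1 = 1 := by
  have h1 := P.Le 1
  have h2 := congrArg (B.h P.e') h1
  simp [P.fe] at h2
  exact h2.symm

def lamHom (S : Setup B A) : G →* ℂ := ⟨⟨P.lam, P.lam_one⟩, P.lam_mul S⟩

theorem lam_inv (S : Setup B A) (g : G) : P.lam g⁻¹ = (P.lam g)⁻¹ := by
  have : P.lam g⁻¹ * P.lam g = 1 := by rw [← P.lam_mul S, inv_mul_cancel, P.lam_one]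
  exact eq_inv_of_mul_eq_one_left this

theorem lam_ne (S : Setup B A) (g : G) : P.lam g ≠ 0 := by
  intro h
  have : P.lam g⁻¹ * P.lam g = 1 := by rw [← P.lam_mul S, inv_mul_cancel, P.lam_one]
  rw [h] at this; simp at this

theorem lam_pow (S : Setup B A) (g : G) (n : ℕ) : P.lam (g ^ n) = P.lam g ^ n := map_pow (P.lamHom S) g n
theorem lam_zpow (S : Setup B A) (g : G) (n : ℤ) : P.lam (g ^ n) = P.lam g ^ n := by
  rcases n with n | n
  · simp [P.lam_pow S]
  · simp only [zpow_negSucc]; rw [P.lam_inv S, P.lam_pow S]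

def mu (g : G) : ℂ := (conj (P.lam g))⁻¹

theorem mu_ne (S : Setup B A) (g : G) : P.mu g ≠ 0 := by
  simp [mu, P.lam_ne S g]

theorem norm_mu (g : G) : ‖P.mu g‖ = ‖P.lam g‖⁻¹ := by simp [mu]

theorem h_e_L (S : Setup B A) (g : G) (x : V) : B.h P.e (A.L g x) = P.mu g * B.h P.e x := by
  rw [S.h_L, P.Le, P.lam_inv S, map_smulₛₗ]
  simp [mu]

theorem h_L_e (S : Setup B A) (g : G) (x : V) : B.h (A.L g x) P.e = conj (P.mu g) * B.h x P.e := by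
  rw [← B.symm, P.h_e_L S, map_mul, B.symm]

variable [FiniteDimensional ℂ V]

/-- projections -/
def cl (x : V) (y : V) : V →L[ℝ] V := ((B.hc x).smulRight y).restrictScalars ℝ

@[simp] theorem cl_apply (x y z : V) : cl (B := B) x y z = B.h x z • y := rfl

def p1 : V →L[ℝ] V := cl (B := B) P.e' P.e
def p3 : V →L[ℝ] V := cl (B := B) P.e P.e'
def p2 : V →L[ℝ] V := 1 - P.p1 - P.p3

theorem p1_apply (x : V) : P.p1 x = B.h P.e' x • P.e := rfl
theorem p3_apply (x : V) : P.p3 x = B.h P.e x • P.e' := rfl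
theorem p2_apply (x : V) : P.p2 x = x - B.h P.e' x • P.e - B.h P.e x • P.e' := rfl

theorem p_sum : P.p1 + P.p2 + P.p3 = 1 := by unfold p2; abel

theorem p_decomp (x : V) : x = B.h P.e' x • P.e + P.p2 x + B.h P.e x • P.e' := by
  rw [p2_apply]; abel

theorem h_e_p2 (x : V) : B.h P.e (P.p2 x) = 0 := by
  rw [p2_apply]; simp [P.ee, P.ef]
theorem h_f_p2 (x : V) : B.h P.e' (P.p2 x) = 0 := by
  rw [p2_apply]; simp [P.ee2, P.fe]

theorem p11 : P.p1 * P.p1 = P.p1 := by ext x; simp [p1_apply, P.fe]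
theorem p33 : P.p3 * P.p3 = P.p3 := by ext x; simp [p3_apply, P.ef]
theorem p13 : P.p1 * P.p3 = 0 := by ext x; simp [p1_apply, p3_apply, P.ee2]
theorem p31 : P.p3 * P.p1 = 0 := by ext x; simp [p1_apply, p3_apply, P.ee]
theorem p12 : P.p1 * P.p2 = 0 := by unfold p2; rw [mul_sub, mul_sub, p11, p13]; simp
theorem p32 : P.p3 * P.p2 = 0 := by unfold p2; rw [mul_sub, mul_sub, p33, p31]; simp
theorem p21 : P.p2 * P.p1 = 0 := by unfold p2; rw [sub_mul, sub_mul, p11, p31]; simp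
theorem p23 : P.p2 * P.p3 = 0 := by unfold p2; rw [sub_mul, sub_mul, p33, p13]; simp
theorem p22 : P.p2 * P.p2 = P.p2 := by
  conv_lhs => enter [1]; unfold p2
  rw [sub_mul, sub_mul, p12, p32]; simp

theorem p2Lp1 (S : Setup B A) (g : G) : P.p2 * A.L g * P.p1 = 0 := by
  ext x; simp [p1_apply, p2_apply, S.smul, P.Le, P.fe, P.ee, smul_smul]
theorem p3Lp1 (S : Setup B A) (g : G) : P.p3 * A.L g * P.p1 = 0 := by
  ext x; simp [p1_apply, p3_apply, S.smul, P.Le, P.ee]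
theorem p3Lp2 (S : Setup B A) (g : G) : P.p3 * A.L g * P.p2 = 0 := by
  ext x; simp [p3_apply, P.h_e_L S, P.h_e_p2]

def d0 (g : G) : V →L[ℝ] V := P.p1 * A.L g * P.p1 + P.p2 * A.L g * P.p2 + P.p3 * A.L g * P.p3

theorem d0_mul (S : Setup B A) (g k : G) : P.d0 (g * k) = P.d0 g * P.d0 k := by
  have e : A.L (g * k) = A.L g * (P.p1 + P.p2 + P.p3) * A.L k := by rw [p_sum, mul_one, map_mul]
  have a1 := P.p2Lp1 S k
  have a2 := P.p3Lp1 S k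
  have a3 := P.p3Lp2 S k
  have b1 := P.p2Lp1 S g
  have b2 := P.p3Lp1 S g
  have b3 := P.p3Lp2 S g
  unfold d0
  rw [e]
  have L1 : P.p1 * (A.L g * (P.p1 + P.p2 + P.p3) * A.L k) * P.p1 = P.p1 * A.L g * P.p1 * (P.p1 * A.L k * P.p1) := by
    calc _ = P.p1 * A.L g * P.p1 * A.L k * P.p1 + P.p1 * A.L g * (P.p2 * A.L k * P.p1)
          + P.p1 * A.L g * (P.p3 * A.L k * P.p1) := by noncomm_ring
      _ = P.p1 * A.L g * P.p1 * A.L k * P.p1 := by rw [a1, a2]; simp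
      _ = P.p1 * A.L g * (P.p1 * P.p1) * A.L k * P.p1 := by rw [p11]
      _ = _ := by noncomm_ring
  have L2 : P.p2 * (A.L g * (P.p1 + P.p2 + P.p3) * A.L k) * P.p2 = P.p2 * A.L g * P.p2 * (P.p2 * A.L k * P.p2) := by
    calc _ = P.p2 * A.L g * P.p1 * A.L k * P.p2 + P.p2 * A.L g * P.p2 * A.L k * P.p2
          + P.p2 * A.L g * (P.p3 * A.L k * P.p2) := by noncomm_ring
      _ = P.p2 * A.L g * P.p2 * A.L k * P.p2 := by rw [b1, a3]; simp
      _ = P.p2 * A.L g * (P.p2 * P.p2) * A.L k * P.p2 := by rw [p22]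
      _ = _ := by noncomm_ring
  have L3 : P.p3 * (A.L g * (P.p1 + P.p2 + P.p3) * A.L k) * P.p3 = P.p3 * A.L g * P.p3 * (P.p3 * A.L k * P.p3) := by
    calc _ = P.p3 * A.L g * P.p1 * A.L k * P.p3 + P.p3 * A.L g * P.p2 * A.L k * P.p3
          + P.p3 * A.L g * P.p3 * A.L k * P.p3 := by noncomm_ring
      _ = P.p3 * A.L g * P.p3 * A.L k * P.p3 := by rw [b2, b3]; simp
      _ = P.p3 * A.L g * (P.p3 * P.p3) * A.L k * P.p3 := by rw [p33]
      _ = _ := by noncomm_ring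
  rw [L1, L2, L3]
  have z : ∀ a b c d' : V →L[ℝ] V, b * c = 0 → a * b * (c * d') = 0 := by
    intro a b c d' h
    rw [mul_assoc, ← mul_assoc b, h]; simp
  simp only [add_mul, mul_add]
  rw [mul_assoc P.p2 (A.L k), mul_assoc P.p3 (A.L k), mul_assoc P.p1 (A.L k)]
  rw [z _ _ _ _ P.p12, z _ _ _ _ P.p13, z _ _ _ _ P.p21, z _ _ _ _ P.p23, z _ _ _ _ P.p31, z _ _ _ _ P.p32]
  simp

theorem d0_one : P.d0 1 = 1 := by
  unfold d0; simp only [map_one, mul_one, p11, p22, p33, p_sum]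

def d (S : Setup B A) : G →* (V →L[ℝ] V) := ⟨⟨P.d0, P.d0_one⟩, P.d0_mul S⟩

theorem d_apply (S : Setup B A) (g : G) (x : V) : P.d S g x =
    (P.lam g * B.h P.e' x) • P.e + P.p2 (A.L g (P.p2 x)) + (P.mu g * B.h P.e x) • P.e' := by
  change P.d0 g x = _
  simp [d0, p1_apply, p3_apply, S.smul, P.Le, P.fe, P.h_e_L S, P.ef, mul_comm]

theorem h_decomp (x y : V) : B.h x y = conj (B.h P.e' x) * B.h P.e y + conj (B.h P.e x) * B.h P.e' y
    + B.h (P.p2 x) (P.p2 y) := by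
  have h1 : ∀ z, B.h (P.p2 z) P.e = 0 := fun z => B.h_eq_zero_symm (P.h_e_p2 z)
  have h2 : ∀ z, B.h (P.p2 z) P.e' = 0 := fun z => B.h_eq_zero_symm (P.h_f_p2 z)
  conv_lhs => rw [P.p_decomp x, P.p_decomp y]
  simp only [map_add, LinearMap.add_apply, map_smul, map_smulₛₗ, LinearMap.smul_apply, smul_eq_mul,
    P.ee, P.ee2, P.ef, P.fe, P.h_e_p2, P.h_f_p2, h1, h2]
  ring

theorem h_p2L (S : Setup B A) (g : G) {x y : V} (hx : B.h P.e x = 0) (hy : B.h P.e y = 0) :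
    B.h (P.p2 (A.L g x)) (P.p2 (A.L g y)) = B.h x y := by
  have := P.h_decomp (A.L g x) (A.L g y)
  rw [P.h_e_L S, P.h_e_L S, hx, hy, S.inv] at this
  simpa using this.symm

theorem d_inv (S : Setup B A) (g : G) (x y : V) : B.h (P.d S g x) (P.d S g y) = B.h x y := by
  have h0 : ∀ x, B.h P.e' (P.d S g x) = P.lam g * B.h P.e' x := by
    intro x; rw [P.d_apply S]; simp [P.fe, P.ee2, P.h_f_p2]
  have h1 : ∀ x, B.h P.e (P.d S g x) = P.mu g * B.h P.e x := by
    intro x; rw [P.d_apply S]; simp [P.ef, P.ee, P.h_e_p2]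
  have hp : P.p2 P.e = 0 := by rw [p2_apply]; simp [P.fe, P.ee]
  have hp' : P.p2 P.e' = 0 := by rw [p2_apply]; simp [P.ef, P.ee2]
  have hps : ∀ (c : ℂ) x, P.p2 (c • x) = c • P.p2 x := by
    intro c x; simp [p2_apply, smul_sub, smul_smul]
  have h2 : ∀ x, P.p2 (P.d S g x) = P.p2 (A.L g (P.p2 x)) := by
    intro x; rw [P.d_apply S, map_add, map_add, hps, hps, hp, hp']
    have := congrArg (fun T => T (A.L g (P.p2 x))) P.p22
    simpa using this
  rw [P.h_decomp (P.d S g x), h0, h1, h0, h1, h2, h2, P.h_p2L S g (P.h_e_p2 x) (P.h_e_p2 y), P.h_decomp x y]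
  have hl := P.lam_ne S g
  have hl' : conj (P.lam g) ≠ 0 := by simpa using hl
  simp only [mu, map_mul, map_inv₀, Complex.conj_conj]
  field_simp

theorem q_o : B.q (P.e - P.e') = -2 := by
  simp [Herm.q, P.ee, P.ee2, P.ef, P.fe]; norm_num

theorem d_bound (S : Setup B A) (C : ℝ) : ∃ C' > 0, ∀ g, ‖P.lam g‖ ≤ C → ‖P.lam g‖⁻¹ ≤ C →
    ‖P.d S g‖ ≤ C' := by
  obtain ⟨C', hC', hb⟩ := B.bd (o := P.e - P.e') (by rw [q_o]; norm_num) (C + C)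
  refine ⟨C', hC', fun g h1 h2 => hb (P.d S g) (P.d S g⁻¹) (P.d_inv S g) (fun x => ?_) ?_⟩
  · rw [← ContinuousLinearMap.mul_apply, ← map_mul]; simp
  · have hp : P.p2 (P.e - P.e') = 0 := by rw [p2_apply]; simp [P.fe, P.ee, P.ef, P.ee2]
    have : B.h (P.e - P.e') (P.d S g (P.e - P.e')) = - P.mu g - P.lam g := by
      rw [P.d_apply S, hp]
      simp [P.fe, P.ee, P.ef, P.ee2]
    rw [this]
    refine (norm_sub_le _ _).trans ?_
    rw [norm_neg, P.norm_mu]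
    linarith

end PF
end HLC
end

noncomputable section
namespace HLC
open Filter Topology
set_option linter.unusedSectionVars false
open scoped ComplexConjugate

namespace PF
variable {G V : Type*} [Group G] [NormedAddCommGroup V] [NormedSpace ℂ V]
  {B : Herm V} {A : AffAct G V} (P : PF B A)
variable [FiniteDimensional ℂ V]

def Ms (a b c : ℝ) : V →L[ℝ] V := a • P.p1 + b • P.p2 + c • P.p3

theorem Ms_mul (a b c a' b' c' : ℝ) : P.Ms a b c * P.Ms a' b' c' = P.Ms (a * a') (b * b') (c * c') := by
  simp only [Ms, add_mul, mul_add, smul_mul_assoc, mul_smul_comm, p11, p12, p13, p21, p22, p23, p31,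
    p32, p33, smul_smul, smul_zero, add_zero, zero_add]
  simp only [mul_comm]

theorem Ms_one : P.Ms 1 1 1 = 1 := by simp [Ms, p_sum]

theorem Ms_conj (S : Setup B A) (g : G) (r : ℝ) (hr : r ≠ 0) :
    P.Ms (r^3) (r^2) r * A.L g * P.Ms (r⁻¹^3) (r⁻¹^2) r⁻¹ =
    P.d S g + r • (P.p1 * A.L g * P.p2 + P.p2 * A.L g * P.p3) + r^2 • (P.p1 * A.L g * P.p3) := by
  change _ = P.d0 g + _ + _
  have a1 := P.p2Lp1 S g
  have a2 := P.p3Lp1 S g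
  have a3 := P.p3Lp2 S g
  simp only [Ms, d0, add_mul, mul_add, smul_mul_assoc, mul_smul_comm, smul_smul, a1, a2, a3, smul_zero, add_zero,
    zero_add, smul_add]
  have h1 : r⁻¹^3 * r^3 = 1 := by field_simp
  have h2 : r⁻¹^2 * r^2 = 1 := by field_simp
  have h3 : r⁻¹ * r = 1 := by field_simp
  have h4 : r⁻¹ ^2* r^3 = r := by field_simp
  have h5 : r⁻¹ * r^3 = r^2 := by field_simp
  have h6 : r⁻¹ * r^2 = r := by field_simp
  rw [h1, h2, h3, h4, h5, h6]
  simp only [one_smul]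
  abel

def Dh (T : V →L[ℝ] V) : (V × ℝ) →L[ℝ] (V × ℝ) := T.prodMap (ContinuousLinearMap.id ℝ ℝ)

theorem Dh_mul (T T' : V →L[ℝ] V) : Dh T * Dh T' = Dh (T * T') := by ext z <;> simp [Dh]
theorem Dh_one : Dh (1 : V →L[ℝ] V) = 1 := by ext z <;> simp [Dh]

def uh (x : V) : (V × ℝ) →L[ℝ] (V × ℝ) := ((ContinuousLinearMap.snd ℝ V ℝ).smulRight x).prod 0

theorem uh_smul (r : ℝ) (x : V) : uh (r • x) = r • uh x := by
  ext z <;> simp [uh]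
theorem uh_add (x y : V) : uh (x + y) = uh x + uh y := by
  ext z <;> simp [uh]

theorem hat_conj (g : G) (T T' : V →L[ℝ] V) : Dh T * A.hat g * Dh T' = Dh (T * A.L g * T') + uh (T (A.u g)) := by
  ext z <;> simp [Dh, uh]

theorem key (S : Setup B A) : ∃ c > 0, Fl (A.Sc (P.d S) c) ⊥ (Module.finrank ℝ (V × ℝ)) = ⊤ ∧
    ∀ g, ‖P.d S g - 1‖ < c → P.d S g = 1 := by
  have : FiniteDimensional ℝ V := Setup.finReal
  let r : ℕ → ℝ := fun k => 2⁻¹^k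
  have hr : ∀ k, r k ≠ 0 := fun k => by positivity
  let D : ℕ → ((V × ℝ) →L[ℝ] (V × ℝ)) := fun k => Dh (P.Ms (r k^3) (r k^2) (r k))
  let D' : ℕ → ((V × ℝ) →L[ℝ] (V × ℝ)) := fun k => Dh (P.Ms ((r k)⁻¹^3) ((r k)⁻¹^2) (r k)⁻¹)
  have hDD : ∀ k, D k * D' k = 1 := by
    intro k
    simp only [D, D']
    rw [Dh_mul, Ms_mul, ← mul_pow, ← mul_pow, mul_inv_cancel₀ (hr k)]
    simp [Ms_one, Dh_one]
  have hDD' : ∀ k, D' k * D k = 1 := by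
    intro k
    simp only [D, D']
    rw [Dh_mul, Ms_mul, ← mul_pow, ← mul_pow, inv_mul_cancel₀ (hr k)]
    simp [Ms_one, Dh_one]
  have hr0 : Tendsto r atTop (𝓝 0) :=
    tendsto_pow_atTop_nhds_zero_of_lt_one (by norm_num) (by norm_num)
  have hr2 : Tendsto (fun k => r k ^ 2) atTop (𝓝 0) := by simpa using hr0.pow 2
  have hr3 : Tendsto (fun k => r k ^ 3) atTop (𝓝 0) := by simpa using hr0.pow 3
  have hlim : ∀ g, Tendsto (fun k => D k * A.hat g * D' k) atTop (𝓝 (AffAct.dhat (P.d S g))) := by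
    intro g
    let X := P.p1 * A.L g * P.p2 + P.p2 * A.L g * P.p3
    let Z := P.p1 * A.L g * P.p3
    have hk : ∀ k, D k * A.hat g * D' k = AffAct.dhat (P.d S g) + r k • (X.prodMap 0) + r k ^ 2 • (Z.prodMap 0)
      + (r k ^ 3 • uh (P.p1 (A.u g)) + r k ^ 2 • uh (P.p2 (A.u g)) + r k • uh (P.p3 (A.u g))) := by
      intro k
      simp only [D, D']
      rw [hat_conj, P.Ms_conj S g _ (hr k), ← uh_smul, ← uh_smul, ← uh_smul, ← uh_add, ← uh_add]
      congr 1
      ext z <;> simp [Dh, AffAct.dhat, X, Z]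
    simp_rw [hk]
    have t1 := hr0.smul_const ((X.prodMap 0 : (V × ℝ) →L[ℝ] (V × ℝ)))
    have t2 := hr2.smul_const ((Z.prodMap 0 : (V × ℝ) →L[ℝ] (V × ℝ)))
    have t3 := hr3.smul_const (uh (P.p1 (A.u g)))
    have t4 := hr2.smul_const (uh (P.p2 (A.u g)))
    have t5 := hr0.smul_const (uh (P.p3 (A.u g)))
    have t0 := tendsto_const_nhds (x := AffAct.dhat (P.d S g)) (f := (atTop : Filter ℕ))
    simpa using ((t0.add t1).add t2).add ((t3.add t4).add t5)
  obtain ⟨c, hc, hF⟩ := A.Rprime S.crys.noInv S.crys.disc (P.d S) D D' hDD hDD' hlim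
  refine ⟨c, hc, hF, fun g hg => ?_⟩
  have hpow := A.Rprime_pow (P.d S) D D' hDD hDD' hlim c _ hF g hg
  set N := Module.finrank ℝ (V × ℝ)
  have hde : P.d S g P.e = P.lam g • P.e := by
    rw [P.d_apply S]
    have hp : P.p2 P.e = 0 := by rw [p2_apply]; simp [P.fe, P.ee]
    simp [hp, P.fe, P.ee]
  have hsm : ∀ (a : ℂ) , P.d S g (a • P.e) = (a * P.lam g) • P.e := by
    intro a
    rw [P.d_apply S]
    have hp : P.p2 (a • P.e) = 0 := by rw [p2_apply]; simp [P.fe, P.ee]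
    simp [hp, P.fe, P.ee, mul_comm]
  have hpw : ∀ j : ℕ, ((P.d S g - 1)^j) P.e = (P.lam g - 1)^j • P.e := by
    intro j
    induction j with
    | zero => simp
    | succ j ih =>
      rw [pow_succ', mul_apply_eq_comp, ih]
      rw [_root_.sub_apply, hsm, one_apply_eq_self, ← sub_smul]
      congr 1; ring
  have hl : P.lam g = 1 := by
    have := hpw N
    rw [hpow] at this
    have h2 := smul_eq_zero.1 this.symm
    have h3 := eq_zero_of_pow_eq_zero (h2.resolve_right P.e_ne)
    exact sub_eq_zero.1 h3
  obtain ⟨C', hC', hb⟩ := P.d_bound S 1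
  refine bounded_unipotent _ N hpow C' fun j => ?_
  rw [← map_pow]
  apply hb <;> simp [P.lam_pow S, hl]

theorem d_finite (S : Setup B A) (C : ℝ) (F : Set G)
    (hF : ∀ g ∈ F, ‖P.lam g‖ ≤ C ∧ ‖P.lam g‖⁻¹ ≤ C) : (P.d S '' F).Finite := by
  have : FiniteDimensional ℝ V := Setup.finReal
  obtain ⟨c, hc, -, hd⟩ := P.key S
  obtain ⟨C', hC', hb⟩ := P.d_bound S C
  refine finite_image (P.d S) c hc hd C' F fun g hg => ⟨hb g (hF g hg).1 (hF g hg).2, hb _ ?_ ?_⟩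
  · rw [P.lam_inv S, norm_inv]; exact (hF g hg).2
  · rw [P.lam_inv S, norm_inv, inv_inv]; exact (hF g hg).1

theorem hatl_inj (S : Setup B A) (g : G) (h : A.hatl g = 1) : g = 1 := by
  apply S.crys.faithful
  intro x
  have := congrArg (fun T => (T (x, (1:ℝ))).1) h
  simpa [AffAct.hat_apply, AffAct.act_def] using this

theorem P2 (S : Setup B A) (h : ∀ g, ‖P.lam g‖ = 1) : Concl G := by
  have : FiniteDimensional ℝ V := Setup.finReal
  obtain ⟨c, hc, hF, hd⟩ := P.key S
  have hfin : (Set.range (P.d S)).Finite := by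
    rw [← Set.image_univ]
    exact P.d_finite S 1 _ fun g _ => by simp [h]
  have : (P.d S).ker.FiniteIndex := by
    refine fi_of_finite_range _ (P.d S) hfin fun b b' hb => ?_
    rw [MonoidHom.mem_ker, map_mul, ← hb, ← map_mul]; simp
  refine concl_of_nilpotent_fi (P.d S).ker ?_
  refine FlagNil (A.hatl.comp (P.d S).ker.subtype) (fun g hg => Subtype.ext (hatl_inj S _ hg))
    (Module.finrank ℝ (V × ℝ)) ?_
  refine top_le_iff.1 (hF ▸ Fl_anti ?_ _ _)
  rintro _ ⟨g, rfl⟩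
  refine ⟨g, ?_, rfl⟩
  have := g.2
  rw [MonoidHom.mem_ker] at this
  simp [this, hc]

/-- frame from a null eigenvector `e` and any `y` with `h e y ≠ 0`. -/
theorem exists_frame {e : V} (he : e ≠ 0) (hq : B.q e = 0)
    (hL : ∀ g, ∃ c : ℂ, A.L g e = c • e) : ∃ P : PF B A, P.e = e := by
  choose lam hlam using hL
  have : ∃ y, B.h e y ≠ 0 := by
    by_contra hcon
    push Not at hcon
    exact he (B.nondeg e hcon)
  obtain ⟨y, hy⟩ := this
  have hee : B.h e e = 0 := by rw [B.h_self, hq]; simp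
  set y1 := (B.h e y)⁻¹ • y with hy1
  have h1 : B.h e y1 = 1 := by simp [hy1, hy]
  have h2 : B.h y1 e = 1 := by rw [← B.symm, h1, map_one]
  refine ⟨⟨e, y1 - ((B.q y1 / 2 : ℝ) : ℂ) • e, lam, hee, ?_, ?_, ?_, hlam⟩, rfl⟩
  · simp only [map_sub, map_smul, map_smulₛₗ, LinearMap.sub_apply, LinearMap.smul_apply, h1, h2, hee, B.h_self]
    simp only [Complex.conj_ofReal, hq, Complex.ofReal_zero, smul_eq_mul]; push_cast; ring
  · simp [h1, hee]
  · simp [h2, hee]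

end PF
end HLC
end

noncomputable section
namespace HLC
open Filter Topology
set_option linter.unusedSectionVars false
open scoped ComplexConjugate

namespace AffAct
variable {G E : Type*} [Group G] [NormedAddCommGroup E] [NormedSpace ℝ E] (A : AffAct G E)

/-- change of origin -/
def conjBy (x0 : E) : AffAct G E where
  L := A.L
  u g := A.L g x0 + A.u g - x0
  u_mul g h := by simp only [map_mul, mul_apply_eq_comp, A.u_mul, map_sub, map_add]; abel

theorem conjBy_act (x0 : E) (g : G) (x : E) : (A.conjBy x0).act g x = A.act g (x + x0) - x0 := by
  simp only [act_def, conjBy, map_add]; abel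

theorem Crys.conjBy {A : AffAct G E} (h : A.Crys) (x0 : E) : (A.conjBy x0).Crys := by
  refine ⟨fun R => ?_, ?_, h.unimod, ?_⟩
  · refine (h.proper (R + ‖x0‖)).subset ?_
    rintro g ⟨x, hx, hx'⟩
    refine ⟨x + x0, (norm_add_le _ _).trans (by linarith), ?_⟩
    rw [conjBy_act] at hx'
    have := norm_add_le (A.act g (x + x0) - x0) x0
    rw [sub_add_cancel] at this
    linarith
  · obtain ⟨R, hR⟩ := h.cocpt
    refine ⟨R + ‖x0‖, fun x => ?_⟩
    obtain ⟨g, hg⟩ := hR (x + x0)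
    refine ⟨g, ?_⟩
    rw [conjBy_act]
    exact (norm_sub_le _ _).trans (by linarith)
  · intro g hg
    apply h.faithful
    intro x
    have := hg (x - x0)
    rw [conjBy_act, sub_add_cancel] at this
    simpa using this
end AffAct

theorem Setup.conjBy {G V : Type*} [Group G] [NormedAddCommGroup V] [NormedSpace ℂ V]
    {B : Herm V} {A : AffAct G V} (S : Setup B A) (x0 : V) : Setup B (A.conjBy x0) :=
  ⟨S.crys.conjBy x0, S.smul, S.inv⟩

namespace PF
variable {G V : Type*} [Group G] [NormedAddCommGroup V] [NormedSpace ℂ V]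
  {B : Herm V} {A : AffAct G V} 
variable [FiniteDimensional ℂ V]

theorem exists_eig_frame (P : PF B A) (S : Setup B A) (g0 : G) (h : 1 < ‖P.lam g0‖) :
    ∃ P' : PF B A, P'.lam = P.lam ∧ A.L g0 P'.e' = P'.mu g0 • P'.e' := by
  let T : V →ₗ[ℂ] V :=
    { toFun := fun x => A.L g0 x - P.mu g0 • x
      map_add' := by intro a b; simp only [map_add, smul_add]; abel
      map_smul' := by intro c a; simp only [S.smul, RingHom.id_apply, smul_sub, smul_comm c] }
  have hT : ∀ x, T x = A.L g0 x - P.mu g0 • x := fun x => rfl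
  have hns : ¬ Function.Surjective T := by
    intro hs
    obtain ⟨x, hx⟩ := hs P.e'
    have := congrArg (B.h P.e) hx
    rw [hT, map_sub, P.h_e_L S, map_smul, smul_eq_mul, sub_self, P.ef] at this
    exact zero_ne_one this
  rw [← LinearMap.injective_iff_surjective] at hns
  have : ∃ v, v ≠ 0 ∧ A.L g0 v = P.mu g0 • v := by
    by_contra hcon
    push Not at hcon
    apply hns
    rw [injective_iff_map_eq_zero]
    intro a ha
    by_contra ha0
    exact hcon a ha0 (sub_eq_zero.1 ha)
  obtain ⟨v, hv, hLv⟩ := this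
  have hmu : ‖P.mu g0‖ < 1 := by rw [norm_mu]; exact inv_lt_one_of_one_lt₀ h
  have hqv : B.q v = 0 := by
    have h1 := S.q_L g0 v
    rw [hLv, B.q_smul] at h1
    have h2 : ‖P.mu g0‖ ^ 2 < 1 := by
      have := norm_nonneg (P.mu g0); nlinarith
    have : (1 - ‖P.mu g0‖ ^ 2) * B.q v = 0 := by linarith
    rcases mul_eq_zero.1 this with h3 | h3
    · linarith
    · exact h3
  have hev : B.h P.e v ≠ 0 := by
    intro h0
    obtain ⟨c, hc⟩ := (B.core (by simp [Herm.q, P.ee]) P.e_ne h0).2 hqv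
    have h1 : P.lam g0 • v = P.mu g0 • v := by
      rw [← hLv, hc, S.smul, P.Le, smul_comm]
    have h2 := smul_left_injective ℂ hv h1
    rw [h2] at h
    linarith
  refine ⟨⟨P.e, (B.h P.e v)⁻¹ • v, P.lam, P.ee, ?_, ?_, ?_, P.Le⟩, rfl, ?_⟩
  · simp [B.h_self, hqv]
  · simp [hev]
  · rw [← B.symm]; simp [hev]
  · change A.L g0 ((B.h P.e v)⁻¹ • v) = P.mu g0 • ((B.h P.e v)⁻¹ • v)
    rw [S.smul, hLv, smul_comm]

/-- normalised hyperbolic situation -/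
structure Hyp (P : PF B A) (g0 : G) : Prop where
  S : Setup B A
  lt : 1 < ‖P.lam g0‖
  Lf : A.L g0 P.e' = P.mu g0 • P.e'
  ue : B.h P.e (A.u g0) = 0
  uf : B.h P.e' (A.u g0) = 0

namespace Hyp
variable {P : PF B A} {g0 : G}

theorem mu_lt (H : Hyp P g0) : ‖P.mu g0‖ < 1 := by rw [norm_mu]; exact inv_lt_one_of_one_lt₀ H.lt

theorem mu0 (H : Hyp P g0) : P.mu g0 ≠ 0 := P.mu_ne H.S g0
theorem lam0 (H : Hyp P g0) : P.lam g0 ≠ 0 := P.lam_ne H.S g0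

theorem Lf_inv (H : Hyp P g0) : A.L g0⁻¹ P.e' = (P.mu g0)⁻¹ • P.e' := by
  have := congrArg (A.L g0⁻¹) H.Lf
  rw [A.L_inv_L, H.S.smul] at this
  rw [this, smul_smul, inv_mul_cancel₀ H.mu0, one_smul]
  rw [← this]

theorem h_f_L (H : Hyp P g0) (x : V) : B.h P.e' (A.L g0 x) = P.lam g0 * B.h P.e' x := by
  rw [H.S.h_L, H.Lf_inv]
  simp [mu]

theorem h_f_Lp (H : Hyp P g0) (k : ℕ) (x : V) : B.h P.e' (A.L (g0 ^ k) x) = P.lam g0 ^ k * B.h P.e' x := by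
  induction k with
  | zero => simp
  | succ k ih => rw [pow_succ', A.L_mul, H.h_f_L, ih]; ring

theorem h_e_Lp (H : Hyp P g0) (k : ℕ) (x : V) : B.h P.e (A.L (g0 ^ k) x) = P.mu g0 ^ k * B.h P.e x := by
  induction k with
  | zero => simp
  | succ k ih => rw [pow_succ', A.L_mul, P.h_e_L H.S, ih]; ring

/-- boundedness on U0 -/
theorem bdU (H : Hyp P g0) : ∃ C > 0, ∀ x, B.h P.e x = 0 → B.h P.e' x = 0 → ∀ k : G, B.h P.e (A.L k x) = 0 →
    B.h P.e' (A.L k x) = 0 → ‖A.L k x‖ ≤ C * ‖x‖ := by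
  obtain ⟨m, hm, hN⟩ := B.exists_N_lower (o := P.e - P.e') (by rw [q_o]; norm_num)
  obtain ⟨M, hM, hb⟩ := B.exists_bound
  refine ⟨Real.sqrt (M / m), by positivity, fun x _ _ k h1 h2 => ?_⟩
  have h3 := hN (A.L k x)
  have h4 : B.N (P.e - P.e') (A.L k x) = B.q x := by
    rw [Herm.N, H.S.q_L]; simp [h1, h2]
  rw [h4] at h3
  have h5 : B.q x ≤ M * ‖x‖ * ‖x‖ := by
    have := hb x x
    rw [B.h_self, Complex.norm_real] at this
    exact (le_abs_self _).trans this
  rw [← pow_le_pow_iff_left₀ (norm_nonneg _) (by positivity) two_ne_zero]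
  rw [mul_pow, Real.sq_sqrt (by positivity), div_mul_eq_mul_div, le_div_iff₀ hm]
  nlinarith

theorem u_e (H : Hyp P g0) (k : ℕ) : B.h P.e (A.u (g0 ^ k)) = 0 := by
  induction k with
  | zero => simp [A.u_one]
  | succ k ih => rw [pow_succ', A.u_mul, map_add, P.h_e_L H.S, ih, H.ue]; simp

theorem u_f (H : Hyp P g0) (k : ℕ) : B.h P.e' (A.u (g0 ^ k)) = 0 := by
  induction k with
  | zero => simp [A.u_one]
  | succ k ih => rw [pow_succ', A.u_mul, map_add, H.h_f_L, ih, H.uf]; simp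

theorem u_growth (H : Hyp P g0) : ∃ C > 0, ∀ k : ℕ, ‖A.u (g0 ^ k)‖ ≤ C * k := by
  obtain ⟨C, hC, hb⟩ := H.bdU
  refine ⟨C * ‖A.u g0‖ + 1, by positivity, fun k => ?_⟩
  induction k with
  | zero => simp [A.u_one]
  | succ k ih =>
    rw [pow_succ, A.u_mul]
    have h1 := hb (A.u g0) H.ue H.uf (g0 ^ k) (by rw [H.h_e_Lp, H.ue]; simp) (by rw [H.h_f_Lp, H.uf]; simp)
    refine (norm_add_le _ _).trans ?_
    push_cast
    nlinarith [norm_nonneg (A.u g0)]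

end Hyp
end PF
end HLC
end

noncomputable section
namespace HLC
open Filter Topology
set_option linter.unusedSectionVars false
open scoped ComplexConjugate

namespace PF
variable {G V : Type*} [Group G] [NormedAddCommGroup V] [NormedSpace ℂ V]
  {B : Herm V} {A : AffAct G V} 
variable [FiniteDimensional ℂ V]
variable {P : PF B A} 

theorem ker_lam {S : Setup B A} {g : G} (hg : P.d S g = 1) : P.lam g = 1 := by
  have h1 := P.d_apply S g P.e
  have hp : P.p2 P.e = 0 := by rw [p2_apply]; simp [P.fe, P.ee]
  rw [hg, hp] at h1
  have h2 := congrArg (B.h P.e') h1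
  simp [P.fe, P.ee] at h2
  exact h2.symm

theorem ker_mu {S : Setup B A} {g : G} (hg : P.d S g = 1) : P.mu g = 1 := by simp [mu, ker_lam hg]

theorem ker_e {S : Setup B A} {g : G} (hg : P.d S g = 1) (x : V) : B.h P.e (A.L g x) = B.h P.e x := by
  rw [P.h_e_L S, ker_mu hg, one_mul]

/-- displacement of the second null vector -/
def y (P : PF B A) (g : G) : V := A.L g P.e' - P.e'

theorem h_e_y {S : Setup B A} {g : G} (hg : P.d S g = 1) : B.h P.e (P.y g) = 0 := by
  rw [y, map_sub, ker_e hg, sub_self]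

theorem h_y_e {S : Setup B A} {g : G} (hg : P.d S g = 1) : B.h (P.y g) P.e = 0 :=
  B.h_eq_zero_symm (h_e_y hg)

theorem ker_L {S : Setup B A} {g : G} (hg : P.d S g = 1) {w : V} (hw : B.h P.e w = 0) :
    A.L g w = w - B.h (P.y g) w • P.e := by
  have h1 := P.d_apply S g w
  rw [hg, hw, ker_lam hg] at h1
  have h2 : P.p2 (A.L g (P.p2 w)) = P.p2 w := by
    have h3 := P.p_decomp w
    rw [hw] at h3
    simp at h1 h3
    rw [h3] at h1
    have := h1.symm
    conv at this => rhs; rw [h3]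
    rw [← h3] at this
    exact add_left_cancel this
  have h4 : P.p2 (A.L g w) = P.p2 w := by
    conv_lhs => rw [P.p_decomp w, hw]
    have h5 : P.p2 (B.h P.e' w • P.e) = 0 := by rw [p2_apply]; simp [P.fe, P.ee]
    rw [zero_smul, add_zero, map_add, S.smul, P.Le, ker_lam hg, one_smul, map_add, h2, h5, zero_add]
  have h6 : A.L g w = w + (B.h P.e' (A.L g w) - B.h P.e' w) • P.e := by
    have h7 := P.p_decomp (A.L g w)
    have h8 := P.p_decomp w
    rw [ker_e hg, hw, h4] at h7
    rw [hw] at h8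
    rw [sub_smul]
    conv_lhs => rw [h7]
    conv_rhs => enter [1]; rw [h8]
    abel
  set a := B.h P.e' (A.L g w) - B.h P.e' w with ha
  have h9 := S.inv g P.e' w
  have h10 : A.L g P.e' = P.e' + P.y g := by rw [y]; abel
  rw [h10, h6] at h9
  simp only [map_add, LinearMap.add_apply, map_smul, P.fe, h_y_e hg, smul_eq_mul] at h9
  have h11 : a = - B.h (P.y g) w := by linear_combination h9
  rw [h6, h11, neg_smul, sub_eq_add_neg]

theorem ker_L' {S : Setup B A} {g : G} (hg : P.d S g = 1) (x : V) :
    A.L g x = x + B.h P.e x • P.y g - B.h (P.y g) (x - B.h P.e x • P.e') • P.e := by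
  have h1 : B.h P.e (x - B.h P.e x • P.e') = 0 := by simp [P.ef]
  have h2 := ker_L hg h1
  rw [map_sub, S.smul] at h2
  have h10 : A.L g P.e' = P.e' + P.y g := by rw [y]; abel
  rw [h10, sub_eq_iff_eq_add] at h2
  rw [h2, smul_add]; abel

theorem L_one_of_y {S : Setup B A} {g : G} (hg : P.d S g = 1) (hy : P.y g = 0) : A.L g = 1 := by
  ext x
  rw [ker_L' hg, hy]; simp

theorem ker_s_mul {S : Setup B A} {g : G} (hg : P.d S g = 1) (k : G) :
    B.h P.e (A.u (g * k)) = B.h P.e (A.u g) + B.h P.e (A.u k) := by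
  rw [A.u_mul, map_add, ker_e hg]

namespace Hyp
variable {g0 : G}

theorem q_zero_of_scale (_H : Hyp P g0) {r : ℝ} (_hr0 : 0 ≤ r) (hr : r < 1) {q : ℝ} (h : r * q = q) : q = 0 := by
  have : (1 - r) * q = 0 := by linarith
  rcases mul_eq_zero.1 this with h3 | h3
  · linarith
  · exact h3

theorem commute_L (H : Hyp P g0) {g : G} (hg : P.d H.S g = 1) {m : ℕ} (hm : 0 < m) (hc : g * g0 ^ m = g0 ^ m * g) :
    A.L g = 1 ∧ B.h P.e' (A.u g) = 0 := by
  have hmu := H.mu_lt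
  have hlam := H.lt
  have hLe : ∀ k : ℕ, A.L (g0 ^ k) P.e' = P.mu g0 ^ k • P.e' := by
    intro k
    induction k with
    | zero => simp
    | succ k ih => rw [pow_succ', A.L_mul, ih, H.S.smul, H.Lf, smul_smul, pow_succ]
  have hy : A.L (g0 ^ m) (P.y g) = P.mu g0 ^ m • P.y g := by
    rw [y, map_sub, ← A.L_mul, ← hc, A.L_mul, hLe, H.S.smul, smul_sub]
  have hl1 : ‖P.mu g0‖ ^ m < 1 := pow_lt_one₀ (norm_nonneg _) hmu hm.ne'
  have hl2 : 1 < ‖P.lam g0‖ ^ m := one_lt_pow₀ hlam hm.ne'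
  have hq : B.q (P.y g) = 0 := by
    have h1 := H.S.q_L (g0 ^ m) (P.y g)
    rw [hy, B.q_smul, norm_pow] at h1
    refine H.q_zero_of_scale (by positivity) ?_ h1
    exact pow_lt_one₀ (by positivity) hl1 two_ne_zero
  have hy0 : P.y g = 0 := by
    obtain ⟨c, hcc⟩ := (B.core (by simp [Herm.q, P.ee]) P.e_ne (h_e_y hg)).2 hq
    by_contra hne
    have h1 : P.lam g0 ^ m • P.y g = P.mu g0 ^ m • P.y g := by
      rw [← hy, hcc, H.S.smul, P.Le, P.lam_pow H.S, smul_comm]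
    have h2 := congrArg norm (smul_left_injective ℂ hne h1)
    rw [norm_pow, norm_pow] at h2
    linarith
  have hL := L_one_of_y hg hy0
  refine ⟨hL, ?_⟩
  have h1 := congrArg A.u hc
  rw [A.u_mul, A.u_mul, hL] at h1
  have h2 : A.u g = A.L (g0 ^ m) (A.u g) := by
    rw [add_comm] at h1
    exact add_left_cancel h1
  have h3 := congrArg (B.h P.e') h2
  rw [H.h_f_Lp] at h3
  have h4 := congrArg norm h3
  rw [norm_mul, norm_pow] at h4
  by_contra hne
  have := norm_pos_iff.2 hne
  nlinarith

theorem F1 (H : Hyp P g0) {g : G} (hg : P.d H.S g = 1) (hs : B.h P.e (A.u g) = 0) :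
    A.L g = 1 ∧ B.h P.e' (A.u g) = 0 := by
  have hmu := H.mu_lt
  have hlam := H.lt
  obtain ⟨C, hC, hgrow⟩ := H.u_growth
  obtain ⟨C1, hC1, hbU⟩ := H.bdU
  obtain ⟨M, hM, hb⟩ := B.exists_bound
  set gk : ℕ → G := fun k => (g0 ^ k)⁻¹ * g * g0 ^ k with hgk
  set w := A.u g - B.h P.e' (A.u g) • P.e with hw
  have hwe : B.h P.e w = 0 := by simp [hw, hs, P.ee]
  have hwf : B.h P.e' w = 0 := by simp [hw, P.fe]
  have hue : ∀ k, A.u (gk k) = ((P.lam g0)⁻¹ ^ k * (B.h P.e' (A.u g) - B.h (P.y g) (A.u (g0 ^ k)))) • P.e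
      + A.L (g0 ^ k)⁻¹ w := by
    intro k
    have h1 : A.u (g0 ^ k * gk k) = A.u (g * g0 ^ k) := by rw [hgk]; congr 1; group
    rw [A.u_mul (g0 ^ k), A.u_mul g, ker_L hg (H.u_e k)] at h1
    have h2 : A.L (g0 ^ k) (A.u (gk k)) = (B.h P.e' (A.u g) - B.h (P.y g) (A.u (g0 ^ k))) • P.e + w := by
      rw [hw, sub_smul]
      have := eq_sub_of_add_eq' h1
      rw [this]; abel
    have h3 := congrArg (A.L (g0 ^ k)⁻¹) h2
    rw [A.L_inv_L, map_add, H.S.smul, P.Le, P.lam_inv H.S, P.lam_pow H.S, smul_smul] at h3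
    rw [h3, inv_pow, mul_comm]
  have hbound : ∃ R, ∀ k, ‖A.u (gk k)‖ ≤ R := by
    have ht : Tendsto (fun k : ℕ => (k : ℝ) * ‖(P.lam g0)⁻¹‖ ^ k) atTop (𝓝 0) := by
      apply tendsto_self_mul_const_pow_of_lt_one (norm_nonneg _)
      rw [norm_inv]; exact inv_lt_one_of_one_lt₀ hlam
    obtain ⟨R1, hR1⟩ := ht.bddAbove_range
    have hR1' : ∀ k : ℕ, (k : ℝ) * ‖(P.lam g0)⁻¹‖ ^ k ≤ R1 := fun k => hR1 ⟨k, rfl⟩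
    have hpow : ∀ k : ℕ, ‖(P.lam g0)⁻¹‖ ^ k ≤ 1 := fun k => pow_le_one₀ (norm_nonneg _)
      (by rw [norm_inv]; exact (inv_lt_one_of_one_lt₀ hlam).le)
    refine ⟨(‖B.h P.e' (A.u g)‖ + M * ‖P.y g‖ * C * R1) * ‖P.e‖ + C1 * ‖w‖, fun k => ?_⟩
    rw [hue]
    refine (norm_add_le _ _).trans (add_le_add ?_ ?_)
    · rw [norm_smul, norm_mul, norm_pow]
      refine mul_le_mul_of_nonneg_right ?_ (norm_nonneg _)
      have h1 := norm_sub_le (B.h P.e' (A.u g)) (B.h (P.y g) (A.u (g0 ^ k)))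
      have h2 := hb (P.y g) (A.u (g0 ^ k))
      have h3 := hgrow k
      have h5 : M * ‖P.y g‖ * ‖A.u (g0 ^ k)‖ ≤ M * ‖P.y g‖ * (C * k) :=
        mul_le_mul_of_nonneg_left h3 (by positivity)
      have h4 : ‖B.h P.e' (A.u g) - B.h (P.y g) (A.u (g0 ^ k))‖ ≤ ‖B.h P.e' (A.u g)‖ + M * ‖P.y g‖ * (C * k) := by
        linarith
      calc _ ≤ ‖(P.lam g0)⁻¹‖ ^ k * (‖B.h P.e' (A.u g)‖ + M * ‖P.y g‖ * (C * k)) :=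
            mul_le_mul_of_nonneg_left h4 (by positivity)
        _ = ‖(P.lam g0)⁻¹‖ ^ k * ‖B.h P.e' (A.u g)‖ + M * ‖P.y g‖ * C * (k * ‖(P.lam g0)⁻¹‖ ^ k) := by ring
        _ ≤ _ := by
            refine add_le_add ?_ (mul_le_mul_of_nonneg_left (hR1' k) (by positivity))
            exact mul_le_of_le_one_left (norm_nonneg _) (hpow k)
    · apply hbU w hwe hwf
      · rw [P.h_e_L H.S, hwe, mul_zero]
      · have := H.h_f_Lp k (A.L (g0 ^ k)⁻¹ w)
        rw [A.L_L_inv, hwf] at this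
        exact (mul_eq_zero.1 this.symm).resolve_left (pow_ne_zero _ H.lam0)
  obtain ⟨R, hR⟩ := hbound
  have hfin : (Set.range gk).Finite := by
    refine (H.S.crys.proper R).subset ?_
    rintro _ ⟨k, rfl⟩
    refine ⟨0, ?_, ?_⟩
    · rw [norm_zero]; exact (norm_nonneg _).trans (hR 0)
    · rw [A.act_zero]; exact hR k
  have hninj : ¬ Function.Injective gk := fun hi => Set.infinite_range_of_injective hi hfin
  have : ∃ k l, k < l ∧ gk k = gk l := by
    rw [Function.Injective] at hninj
    push Not at hninj
    obtain ⟨k, l, h1, h2⟩ := hninj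
    rcases lt_or_gt_of_ne h2 with h3 | h3
    · exact ⟨k, l, h3, h1⟩
    · exact ⟨l, k, h3, h1.symm⟩
  obtain ⟨k, l, hkl, he⟩ := this
  obtain ⟨m, rfl⟩ := Nat.exists_eq_add_of_lt hkl
  refine H.commute_L hg (m := m + 1) (by omega) ?_
  have e1 : (g0 ^ k)⁻¹ * g * g0 ^ k = (g0 ^ k)⁻¹ * ((g0 ^ (m+1))⁻¹ * g * g0 ^ (m+1)) * g0 ^ k := by
    have e2 : g0 ^ (k + m + 1) = g0 ^ (m + 1) * g0 ^ k := by rw [← pow_add]; congr 1; omega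
    have : gk (k + m + 1) = (g0 ^ k)⁻¹ * ((g0 ^ (m+1))⁻¹ * g * g0 ^ (m+1)) * g0 ^ k := by
      simp only [hgk]; rw [e2]; group
    rw [← this]; exact he
  have e3 := mul_left_cancel (mul_right_cancel e1)
  rw [mul_assoc, eq_inv_mul_iff_mul_eq] at e3
  exact e3.symm

theorem ker_comm (H : Hyp P g0) {g k : G} (hg : P.d H.S g = 1) (hk : P.d H.S k = 1) :
    B.h P.e' (A.L g (A.u k) - A.u k - (A.L k (A.u g) - A.u g)) = 0 ∧
    B.h (P.y g) (A.L g (A.u k) - A.u k - (A.L k (A.u g) - A.u g)) = 0 := by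
  -- for any two elements
  have gen : ∀ {g k : G}, P.d H.S g = 1 → P.d H.S k = 1 → ∃ t : G, t * (k * g) = g * k ∧ P.d H.S t = 1 ∧
      A.L t = 1 ∧ A.u t = A.L g (A.u k) - A.u k - (A.L k (A.u g) - A.u g) ∧ B.h P.e' (A.u t) = 0 ∧
      B.h P.e (A.u t) = 0 := by
    intro g k hg hk
    set t := g * k * (k * g)⁻¹ with ht
    have h1 : t * (k * g) = g * k := by rw [ht]; group
    have hdi : ∀ z, P.d H.S z = 1 → P.d H.S z⁻¹ = 1 := by
      intro z hz
      have : P.d H.S z⁻¹ * P.d H.S z = 1 := by rw [← map_mul]; simp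
      rwa [hz, mul_one] at this
    have hdt : P.d H.S t = 1 := by
      rw [ht, map_mul, map_mul, hg, hk, hdi _ (by rw [map_mul, hg, hk, mul_one])]; simp
    have hst : B.h P.e (A.u t) = 0 := by
      have h2 := congrArg (fun z => B.h P.e (A.u z)) h1
      rw [ker_s_mul hdt (k * g), ker_s_mul hg, ker_s_mul hk] at h2
      linear_combination h2
    obtain ⟨hL, hf⟩ := H.F1 hdt hst
    refine ⟨t, h1, hdt, hL, ?_, hf, hst⟩
    have h2 := congrArg A.u h1
    rw [A.u_mul t, A.u_mul g, A.u_mul k, hL, one_apply_eq_self] at h2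
    rw [eq_sub_of_add_eq h2]; abel
  obtain ⟨t, -, hdt, hLt, hut, hf, hst⟩ := gen hg hk
  rw [← hut]
  refine ⟨hf, ?_⟩
  obtain ⟨t', -, -, -, hut', hf', -⟩ := gen hg hdt
  rw [hLt] at hut'
  rw [hut', ker_L hg hst] at hf'
  simpa [P.fe] using hf'

theorem ker_L_one (H : Hyp P g0) {g : G} (hg : P.d H.S g = 1) : A.L g = 1 := by
  by_cases hs : B.h P.e (A.u g) = 0
  · exact (H.F1 hg hs).1
  set s := B.h P.e (A.u g) with hsdef
  have hmu := H.mu_lt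
  have hlam := H.lt
  have hmu0 := H.mu0
  set k := g0⁻¹ * g * g0 with hk
  have hdk : P.d H.S k = 1 := by
    rw [hk, map_mul, map_mul, hg, mul_one, ← map_mul]; simp
  have hyk : P.y k = P.mu g0 • A.L g0⁻¹ (P.y g) := by
    rw [y, y, hk, A.L_mul, A.L_mul, H.Lf, H.S.smul, H.S.smul, map_sub, H.Lf_inv, smul_sub, smul_smul,
      mul_inv_cancel₀ hmu0, one_smul]
  have hsk : B.h P.e (A.u k) = (P.mu g0)⁻¹ * s := by
    have h1 : g0 * k = g * g0 := by rw [hk]; group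
    have h2 := congrArg (fun z => B.h P.e (A.u z)) h1
    rw [A.u_mul g0 k, ker_s_mul hg, map_add, P.h_e_L H.S, H.ue] at h2
    field_simp
    linear_combination h2
  have hz := (H.ker_comm hg hdk)
  have hz' := (H.ker_comm hdk hg)
  have hgk : A.L g (A.u k) - A.u k = ((P.mu g0)⁻¹ * s) • P.y g - B.h (P.y g) (A.u k - ((P.mu g0)⁻¹ * s) • P.e') • P.e := by
    rw [ker_L' hg, hsk]; abel
  have hkg : A.L k (A.u g) - A.u g = s • P.y k - B.h (P.y k) (A.u g - s • P.e') • P.e := by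
    rw [ker_L' hdk]; abel
  have hy1 := h_y_e hg
  have hy2 := h_y_e hdk
  have E1 : (P.mu g0)⁻¹ * s * B.h (P.y g) (P.y g) = s * B.h (P.y g) (P.y k) := by
    have := hz.2
    rw [hgk, hkg] at this
    simp only [map_sub, map_smul, hy1, smul_eq_mul, mul_zero, sub_zero] at this
    linear_combination this
  have E2 : (P.mu g0)⁻¹ * s * B.h (P.y k) (P.y g) = s * B.h (P.y k) (P.y k) := by
    have := hz'.2
    rw [hgk, hkg] at this
    simp only [map_sub, map_smul, hy2, smul_eq_mul, mul_zero, sub_zero] at this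
    linear_combination - this
  have hqk : B.q (P.y k) = ‖P.mu g0‖ ^ 2 * B.q (P.y g) := by rw [hyk, B.q_smul, H.S.q_L]
  have hq : B.q (P.y g) = 0 := by
    rw [B.h_self, mul_comm (P.mu g0)⁻¹, mul_assoc] at E1
    rw [B.h_self, hqk, mul_comm (P.mu g0)⁻¹, mul_assoc] at E2
    have F1 := congrArg norm (mul_left_cancel₀ hs E1)
    have F2 := congrArg norm (mul_left_cancel₀ hs E2)
    rw [norm_mul, norm_inv, Complex.norm_real] at F1
    rw [norm_mul, norm_inv, Complex.norm_real, B.norm_h_symm, ← F1] at F2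
    have hm : 0 < ‖P.mu g0‖ := norm_pos_iff.2 hmu0
    rw [norm_mul, norm_pow, norm_norm] at F2
    field_simp at F2
    have : ‖B.q (P.y g)‖ = 0 := by
      refine H.q_zero_of_scale (r := ‖P.mu g0‖ ^ 4) (by positivity) (pow_lt_one₀ hm.le hmu (by norm_num)) ?_
      linear_combination -F2
    exact norm_eq_zero.1 this
  obtain ⟨c, hc⟩ := (B.core (by simp [Herm.q, P.ee]) P.e_ne (h_e_y hg)).2 hq
  have hyk2 : P.y k = (P.mu g0 * (P.lam g0)⁻¹ * c) • P.e := by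
    rw [hyk, hc, H.S.smul, P.Le, P.lam_inv H.S, smul_smul, smul_smul]; congr 1; ring
  have hw := hz.1
  have hee : ∀ x, B.h P.e x = 0 → B.h (P.y g) x = 0 := by
    intro x hx; rw [hc]; simp [hx]
  have hee2 : ∀ x, B.h P.e x = 0 → B.h (P.y k) x = 0 := by
    intro x hx; rw [hyk2]; simp [hx]
  rw [hgk, hkg, hee (A.u k - ((P.mu g0)⁻¹ * s) • P.e') (by simp [hsk, P.ef]),
    hee2 (A.u g - s • P.e') (by simp [← hsdef, P.ef]), hc, hyk2] at hw
  simp only [map_sub, map_smul, P.fe, smul_eq_mul, mul_zero, sub_zero, zero_smul, mul_one] at hw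
  have hfac : s * (c * ((P.mu g0)⁻¹ - P.mu g0 * (P.lam g0)⁻¹)) = 0 := by linear_combination hw
  have h2 := (mul_eq_zero.1 hfac).resolve_left hs
  have h3 : (P.mu g0)⁻¹ - P.mu g0 * (P.lam g0)⁻¹ ≠ 0 := by
    intro h0
    have h4 := congrArg norm (sub_eq_zero.1 h0)
    rw [norm_mul, norm_inv, norm_inv] at h4
    have h5 : 1 < ‖P.mu g0‖⁻¹ := (one_lt_inv₀ (norm_pos_iff.2 hmu0)).2 hmu
    have h6 : ‖P.lam g0‖⁻¹ < 1 := inv_lt_one_of_one_lt₀ hlam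
    have h7 : 0 < ‖P.lam g0‖⁻¹ := inv_pos.2 (by linarith)
    nlinarith [norm_nonneg (P.mu g0)]
  have hc0 := (mul_eq_zero.1 h2).resolve_right h3
  exact L_one_of_y hg (by rw [hc, hc0, zero_smul])

end Hyp
end PF
end HLC
end

noncomputable section
namespace HLC
open Filter Topology
set_option linter.unusedSectionVars false
open scoped ComplexConjugate

namespace PF
variable {G V : Type*} [Group G] [NormedAddCommGroup V] [NormedSpace ℂ V]
  {B : Herm V} {A : AffAct G V} 
variable [FiniteDimensional ℂ V]
variable {P : PF B A} 

theorem Hyp.concl {g0 : G} (H : Hyp P g0) : Concl G := by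
  let S := H.S
  let T : Subgroup G := (P.d S).ker
  have hT : ∀ g, g ∈ T ↔ P.d S g = 1 := fun g => MonoidHom.mem_ker
  have habel : ∀ g k, g ∈ T → k ∈ T → g * k = k * g := by
    intro g k hg hk
    have h1 := H.ker_L_one ((hT g).1 hg)
    have h2 := H.ker_L_one ((hT k).1 hk)
    have : (g * k) * (k * g)⁻¹ = 1 := by
      apply S.crys.faithful
      intro x
      have e1 : ∀ z, A.act (g * k) z = A.act (k * g) z := by
        intro z
        rw [A.act_mul, A.act_mul]; simp only [A.act_def, h1, h2, one_apply_eq_self]; abel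
      rw [A.act_mul, e1, A.act_act_inv]
    exact mul_inv_eq_one.1 this
  -- the log homomorphism
  let ℓ : G → ℝ := fun g => Real.log ‖P.lam g‖
  have hpos : ∀ g, 0 < ‖P.lam g‖ := fun g => norm_pos_iff.2 (P.lam_ne S g)
  have hℓmul : ∀ g k, ℓ (g * k) = ℓ g + ℓ k := by
    intro g k
    simp only [ℓ]
    rw [P.lam_mul S, norm_mul, Real.log_mul (hpos g).ne' (hpos k).ne']
  let Λ : AddSubgroup ℝ :=
    { carrier := Set.range ℓ
      add_mem' := by rintro _ _ ⟨a, rfl⟩ ⟨b, rfl⟩; exact ⟨a * b, hℓmul a b⟩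
      zero_mem' := ⟨1, by simp [ℓ, P.lam_one]⟩
      neg_mem' := by
        rintro _ ⟨a, rfl⟩
        exact ⟨a⁻¹, by simp [ℓ, P.lam_inv S]⟩ }
  have hiso : ∃ a > 0, Disjoint (Λ : Set ℝ) (Set.Ioo 0 a) := by
    let F : Set G := {g | ‖P.lam g‖ ≤ 2 ∧ ‖P.lam g‖⁻¹ ≤ 2}
    have hfin := P.d_finite S 2 F fun g hg => hg
    have hX : (ℓ '' F).Finite := by
      refine (hfin.image (fun M => Real.log ‖B.h P.e' (M P.e)‖)).subset ?_
      rintro _ ⟨g, hg, rfl⟩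
      refine ⟨P.d S g, ⟨g, hg, rfl⟩, ?_⟩
      have hp : P.p2 P.e = 0 := by rw [p2_apply]; simp [P.fe, P.ee]
      simp only [ℓ]
      rw [P.d_apply S, hp]; simp [P.fe, P.ee]
    have hcl : (ℓ '' F \ {0}).Finite := hX.subset Set.sdiff_subset
    have hnh : (ℓ '' F \ {0})ᶜ ∈ 𝓝 (0:ℝ) := hcl.isClosed.isOpen_compl.mem_nhds (by simp)
    obtain ⟨ε, hε, hball⟩ := Metric.mem_nhds_iff.1 hnh
    refine ⟨min ε (Real.log 2), lt_min hε (Real.log_pos (by norm_num)), ?_⟩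
    rw [Set.disjoint_left]
    rintro _ ⟨g, rfl⟩ ⟨h1, h2⟩
    have h3 : ℓ g ∈ Metric.ball (0:ℝ) ε := by
      rw [Metric.mem_ball, dist_zero_right, Real.norm_eq_abs, abs_of_pos h1]
      exact h2.trans_le (min_le_left _ _)
    refine hball h3 ⟨⟨g, ⟨?_, ?_⟩, rfl⟩, h1.ne'⟩
    · have := h2.trans_le (min_le_right _ _)
      exact ((Real.log_lt_log_iff (hpos g) (by norm_num)).1 this).le
    · have : (1:ℝ) < ‖P.lam g‖ := (Real.log_pos_iff (hpos g).le).1 h1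
      have := inv_lt_one_of_one_lt₀ this
      linarith
  obtain ⟨a, ha, hdisj⟩ := hiso
  obtain ⟨b, hb⟩ := AddSubgroup.cyclic_of_isolated_zero ha hdisj
  have hbm : b ∈ Λ := by rw [hb]; exact AddSubgroup.mem_closure_singleton_self b
  obtain ⟨g1, hg1⟩ := hbm
  have hk : ∀ g, ∃ k : ℤ, ℓ g = k * ℓ g1 := by
    intro g
    have : ℓ g ∈ Λ := ⟨g, rfl⟩
    rw [hb, AddSubgroup.mem_closure_singleton] at this
    obtain ⟨k, hk⟩ := this
    refine ⟨k, ?_⟩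
    rw [← hk, ← hg1]; simp
  choose kk hkk using hk
  have hℓz : ∀ k : ℤ, ℓ (g1 ^ k) = k * ℓ g1 := by
    intro k; simp only [ℓ]; rw [P.lam_zpow S, norm_zpow, Real.log_zpow]
  let Γ0 : Subgroup G := (Subgroup.zpowers (g1 : G ⧸ T)).comap (QuotientGroup.mk' T)
  have hΓ0 : ∀ g, g ∈ Γ0 ↔ ∃ k : ℤ, g * (g1 ^ k)⁻¹ ∈ T := by
    intro g
    simp only [Γ0, Subgroup.mem_comap, Subgroup.mem_zpowers_iff]
    refine exists_congr fun k => ?_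
    rw [QuotientGroup.mk'_apply, ← QuotientGroup.mk_zpow, eq_comm, QuotientGroup.eq_iff_div_mem, div_eq_mul_inv]
  have hfi : Γ0.FiniteIndex := by
    refine fi_of_finite_range Γ0 (fun g => P.d S (g * (g1 ^ kk g)⁻¹)) ?_ ?_
    · refine (P.d_finite S 1 {g | ‖P.lam g‖ = 1} fun g hg => by
        rw [show ‖P.lam g‖ = 1 from hg]; simp).subset ?_
      rintro _ ⟨g, rfl⟩
      refine ⟨_, ?_, rfl⟩
      change ‖P.lam _‖ = 1
      have h1 : ℓ (g * (g1 ^ kk g)⁻¹) = 0 := by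
        rw [← _root_.zpow_neg, hℓmul, hℓz, hkk]; push_cast; ring
      exact Real.eq_one_of_pos_of_log_eq_zero (hpos _) h1
    · intro x x' hxx
      have h1 : (x * (g1 ^ kk x)⁻¹)⁻¹ * (x' * (g1 ^ kk x')⁻¹) ∈ T := by
        rw [hT, map_mul, ← hxx, ← map_mul]; simp
      have h2 : ((x * (g1 ^ kk x)⁻¹ : G) : G ⧸ T) = (x' * (g1 ^ kk x')⁻¹ : G) := QuotientGroup.eq.2 h1
      have h3 : ((x : G) : G ⧸ T) * ((g1 : G ⧸ T) ^ kk x)⁻¹ = x' * ((g1 : G ⧸ T) ^ kk x')⁻¹ := by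
        simpa using h2
      have h4 : ((x⁻¹ * x' : G) : G ⧸ T) = (g1 : G ⧸ T) ^ (-kk x + kk x') := by
        rw [_root_.zpow_add, _root_.zpow_neg, QuotientGroup.mk_mul, QuotientGroup.mk_inv, inv_mul_eq_iff_eq_mul,
          ← mul_assoc, h3]; simp
      exact ⟨_, h4.symm⟩
  refine Or.inr ⟨Γ0, hfi, T.subgroupOf Γ0, inferInstance, ?_, ⟨g1, (hΓ0 g1).2 ⟨1, by simp [T.one_mem]⟩⟩, ?_⟩
  · rintro ⟨x, hx⟩ ⟨y, hy⟩
    rw [Subgroup.mem_subgroupOf] at hx hy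
    ext
    exact habel _ _ hx hy
  · rintro ⟨x, hx⟩
    obtain ⟨k, hk⟩ := (hΓ0 x).1 hx
    refine ⟨k, ?_⟩
    rw [Subgroup.mem_subgroupOf]
    simpa using hk
end PF

theorem Setup.concl_of_parab {G V : Type*} [Group G] [NormedAddCommGroup V] [NormedSpace ℂ V]
    [FiniteDimensional ℂ V] {B : Herm V} {A : AffAct G V} (S : Setup B A) (h : Setup.Parab B A) : Concl G := by
  obtain ⟨e, he, hq, hL⟩ := h
  obtain ⟨P, rfl⟩ := PF.exists_frame he hq hL
  by_cases hall : ∀ g, ‖P.lam g‖ = 1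
  · exact P.P2 S hall
  push Not at hall
  obtain ⟨g, hg⟩ := hall
  have : ∃ g0, 1 < ‖P.lam g0‖ := by
    rcases lt_or_gt_of_ne hg with h1 | h1
    · refine ⟨g⁻¹, ?_⟩
      rw [P.lam_inv S, norm_inv]
      exact (one_lt_inv₀ (norm_pos_iff.2 (P.lam_ne S g))).2 h1
    · exact ⟨g, h1⟩
  obtain ⟨g0, hg0⟩ := this
  obtain ⟨P', hlam, hLf⟩ := P.exists_eig_frame S g0 hg0
  rw [← hlam] at hg0
  have hmu : ‖P'.mu g0‖ < 1 := by rw [PF.norm_mu]; exact inv_lt_one_of_one_lt₀ hg0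
  have n1 : P'.lam g0 - 1 ≠ 0 := by
    intro h0; rw [sub_eq_zero.1 h0] at hg0; simp at hg0
  have n2 : P'.mu g0 - 1 ≠ 0 := by
    intro h0; rw [sub_eq_zero.1 h0] at hmu; simp at hmu
  set a := - B.h P'.e' (A.u g0) / (P'.lam g0 - 1) with ha
  set b := - B.h P'.e (A.u g0) / (P'.mu g0 - 1) with hb
  set x0 := a • P'.e + b • P'.e' with hx0
  have hLx : A.L g0 x0 = (a * P'.lam g0) • P'.e + (b * P'.mu g0) • P'.e' := by
    rw [hx0, map_add, S.smul, S.smul, P'.Le, hLf, smul_smul, smul_smul]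
  let P'' : PF B (A.conjBy x0) := ⟨P'.e, P'.e', P'.lam, P'.ee, P'.ee2, P'.ef, P'.fe, P'.Le⟩
  have H : PF.Hyp P'' g0 := by
    refine ⟨S.conjBy x0, hg0, hLf, ?_, ?_⟩
    · change B.h P'.e (A.L g0 x0 + A.u g0 - x0) = 0
      rw [hLx, hx0]
      simp only [map_add, map_sub, map_smul, P'.ee, P'.ef, smul_eq_mul, hb]
      field_simp; ring
    · change B.h P'.e' (A.L g0 x0 + A.u g0 - x0) = 0
      rw [hLx, hx0]
      simp only [map_add, map_sub, map_smul, P'.ee2, P'.fe, smul_eq_mul, ha]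
      field_simp; ring
  exact H.concl
end HLC
end

noncomputable section
namespace HLC
open Filter Topology
set_option linter.unusedSectionVars false
open scoped ComplexConjugate

/-- the discrete situation, with `E` strongly irreducible containing a negative vector `o` -/
structure Irr {G V : Type*} [Group G] [NormedAddCommGroup V] [NormedSpace ℂ V]
    (B : Herm V) (A : AffAct G V) (E : Submodule ℂ V) (o : V) : Prop where
  S : Setup B A
  discr : Setup.Discr A
  nconc : ¬ Concl G
  inv : ∀ g, ∀ x ∈ E, A.L g x ∈ E
  oE : o ∈ E
  qo : B.q o < 0
  irr : ∀ K : Subgroup G, K.FiniteIndex → ∀ Z : Submodule ℂ V, Z ≤ E →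
    (∀ g ∈ K, ∀ x ∈ Z, A.L g x ∈ Z) → Z = ⊥ ∨ Z = E

variable {G V : Type*} [Group G] [NormedAddCommGroup V] [NormedSpace ℂ V] [FiniteDimensional ℂ V]
  {B : Herm V} {A : AffAct G V}

theorem Setup.noNull (S : Setup B A) (hn : ¬ Concl G) (K : Subgroup G) [K.FiniteIndex]
    (e : V) (he : e ≠ 0) (hq : B.q e = 0) (h : ∀ g ∈ K, ∃ c : ℂ, A.L g e = c • e) : False :=
  hn (concl_of_subgroup K ((S.res K).concl_of_parab ⟨e, he, hq, fun g => h g g.2⟩))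

theorem Setup.exists_irr (S : Setup B A) (hd : Setup.Discr A) (hn : ¬ Concl G) :
    ∃ H : Subgroup G, H.FiniteIndex ∧ ∃ E o, Irr B (A.res H) E o := by
  obtain ⟨⟨H, E⟩, ⟨hfi, hinv, o, hoE, hqo⟩, hmin⟩ := exists_min_nat
    (fun p : Subgroup G × Submodule ℂ V => p.1.FiniteIndex ∧ (∀ g ∈ p.1, ∀ x ∈ p.2, A.L g x ∈ p.2)
      ∧ ∃ o ∈ p.2, B.q o < 0) (fun p => Module.finrank ℂ p.2)
    ⟨(⊤, ⊤), inferInstance, fun _ _ _ _ => trivial, by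
      obtain ⟨o, ho⟩ := B.neg; exact ⟨o, trivial, ho⟩⟩
  dsimp only at hfi hinv hoE hmin
  refine ⟨H, hfi, E, o, S.res H, ?_, fun h => hn (concl_of_subgroup H h), fun g => hinv g g.2,
    hoE, hqo, ?_⟩
  · obtain ⟨c, hc, h⟩ := hd
    exact ⟨c, hc, fun g => h g⟩
  intro K hK Z hZE hZ
  -- the image of K in G
  have hfi' : (K.map H.subtype).FiniteIndex := by
    constructor
    rw [Subgroup.index_map_subtype]
    exact mul_ne_zero hK.index_ne_zero hfi.index_ne_zero
  have hKmem : ∀ g ∈ K.map H.subtype, ∃ g' ∈ K, g = (g' : G) := by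
    rintro _ ⟨g', hg', rfl⟩; exact ⟨g', hg', rfl⟩
  have hmin' : ∀ Z' : Submodule ℂ V, Z' ≤ E → (∀ g ∈ K, ∀ x ∈ Z', A.L g x ∈ Z') →
      (∃ o ∈ Z', B.q o < 0) → Z' = E := by
    intro Z' hle hinv' hneg
    refine Submodule.eq_of_le_of_finrank_le hle (hmin (K.map H.subtype, Z') ⟨hfi', ?_, hneg⟩)
    intro g hg x hx
    obtain ⟨g', hg', rfl⟩ := hKmem g hg
    exact hinv' g' hg' x hx
  by_cases hZneg : ∃ o ∈ Z, B.q o < 0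
  · exact Or.inr (hmin' Z hZE hZ hZneg)
  push Not at hZneg
  left
  have horth : ∀ g ∈ K, ∀ x ∈ B.orth Z, A.L (g : G) x ∈ B.orth Z := by
    intro g hg x hx y hy
    rw [S.h_L]
    exact hx _ (hZ g⁻¹ (K.inv_mem hg) y hy)
  by_cases hdeg : ∃ e ∈ Z, e ∈ B.orth Z ∧ e ≠ 0
  · exfalso
    obtain ⟨e, heZ, heo, he0⟩ := hdeg
    have hqe : ∀ x ∈ Z, x ∈ B.orth Z → B.q x = 0 := by
      intro x hx hxo; simp [Herm.q, hxo x hx]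
    refine S.noNull hn (K.map H.subtype) e he0 (hqe e heZ heo) ?_
    intro g hg
    obtain ⟨g', hg', rfl⟩ := hKmem g hg
    have h1 := hZ g' hg' e heZ
    have h2 := horth g' hg' e heo
    exact (B.core (hqe e heZ heo).le he0 (h2 e heZ)).2 (hqe _ h1 h2)
  push Not at hdeg
  obtain ⟨s, hs, hos⟩ := B.exists_orth_decomp Z hdeg o
  have hneg : B.q (o - s) < 0 := by
    have h1 : B.q (s + (o - s)) = B.q s + B.q (o - s) := B.q_add_orth (hos s hs)
    rw [add_sub_cancel] at h1
    have := hZneg s hs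
    linarith
  have h3 := hmin' (E ⊓ B.orth Z) inf_le_left (fun g hg x hx => ⟨hinv g g.2 x hx.1, horth g hg x hx.2⟩)
    ⟨o - s, ⟨E.sub_mem hoE (hZE hs), hos⟩, hneg⟩
  rw [eq_bot_iff]
  intro z hz
  have : z ∈ E ⊓ B.orth Z := by rw [h3]; exact hZE hz
  exact (Submodule.mem_bot ℂ).2 (hdeg z hz this.2)

namespace Irr
variable {E : Submodule ℂ V} {o : V}

theorem bd (I : Irr B A E o) (C : ℝ) : (A.L '' {g | ‖B.h o (A.L g o)‖ ≤ C}).Finite := by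
  have : FiniteDimensional ℝ V := Setup.finReal
  obtain ⟨c, hc, hd⟩ := I.discr
  obtain ⟨C', _, hb⟩ := B.bd I.qo C
  refine finite_image A.L c hc hd C' _ ?_
  intro g hg
  refine ⟨hb _ (A.L g⁻¹) (I.S.inv g) (A.L_L_inv g) hg, hb _ (A.L g) (I.S.inv _) (A.L_inv_L g) ?_⟩
  rw [I.S.h_L, inv_inv, B.norm_h_symm]; exact hg

/-- the linear holonomy of a finite index subgroup is infinite -/
theorem infinite (I : Irr B A E o) (K : Subgroup G) [hK : K.FiniteIndex] :
    (A.L '' (K : Set G)).Finite → False := by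
  intro hfin
  apply I.nconc
  apply concl_of_subgroup K
  let T : Subgroup K := (A.L.comp K.subtype).ker
  have hT : ∀ t : T, A.L ((t : K) : G) = 1 := fun t => t.2
  have : T.FiniteIndex := by
    apply fi_of_finite_range T (fun k : K => A.L k)
    · refine hfin.subset ?_
      rintro _ ⟨k, rfl⟩
      exact ⟨k, k.2, rfl⟩
    · intro b b' h
      change A.L ((b⁻¹ * b' : K) : G) = 1
      have h' : A.L (b : G) = A.L (b' : G) := h
      push_cast
      rw [map_mul, ← h', ← map_mul]; simp
  apply concl_of_nilpotent_fi T
  have hcomm : ∀ s t : T, s * t = t * s := by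
    intro s t
    have h1 : ∀ x, A.act (((s : K) : G) * ((t : K) : G) * ((((t : K) : G) * ((s : K) : G)))⁻¹) x = x := by
      intro x
      rw [A.act_mul]
      have h2 : ∀ y, A.act (((s : K) : G) * ((t : K) : G)) y =
          A.act (((t : K) : G) * ((s : K) : G)) y := by
        intro y
        rw [A.act_mul, A.act_mul]
        simp only [A.act_def, hT, one_apply_eq_self]
        abel
      rw [h2, A.act_act_inv]
    have := I.S.crys.faithful _ h1
    rw [mul_inv_eq_one] at this
    exact Subtype.ext (Subtype.ext this)
  let _ : CommGroup T := { (inferInstance : Group T) with mul_comm := hcomm }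
  exact CommGroup.isNilpotent

theorem infinite_of_bd (I : Irr B A E o) (K : Subgroup G) [hK : K.FiniteIndex] (C : ℝ)
    (h : ∀ g ∈ K, ‖B.h o (A.L g o)‖ ≤ C) : False :=
  I.infinite K ((I.bd C).subset (Set.image_mono h))

/-- vectors of `E` orthogonal to `E` vanish -/
theorem E_nondeg (I : Irr B A E o) {x : V} (hx : x ∈ E) (hxo : x ∈ B.orth E) : x = 0 := by
  rcases I.irr ⊤ inferInstance (E ⊓ B.orth E) inf_le_left
    (fun g _ x hx => ⟨I.inv g x hx.1, I.S.orth_inv I.inv g hx.2⟩) with h | h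
  · have : x ∈ E ⊓ B.orth E := ⟨hx, hxo⟩
    rw [h] at this
    simpa using this
  · have : o ∈ E ⊓ B.orth E := by rw [h]; exact I.oE
    have h2 := this.2 o I.oE
    have h3 := I.qo
    simp [Herm.q, h2] at h3

end Irr

end HLC
end

noncomputable section
namespace HLC
open Filter Topology
set_option linter.unusedSectionVars false
open scoped ComplexConjugate

/-- averaged rank one operators -/
structure Herm.Avop {V : Type*} [NormedAddCommGroup V] [NormedSpace ℂ V]
    (B : Herm V) (K : V →L[ℂ] V) : Prop where
  sa : ∀ v w, B.h (K v) w = B.h v (K w)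
  nonneg : ∀ v, 0 ≤ (B.h v (K v)).re
  pos : ∃ a > 0, ∀ v, v ≠ 0 → 0 < B.q v + a * (B.h v (K v)).re

namespace Herm.Avop
variable {V : Type*} [NormedAddCommGroup V] [NormedSpace ℂ V]
  {B : Herm V} {K : V →L[ℂ] V}

theorem ne_zero_of_neg {v : V} (hv : B.q v < 0) : v ≠ 0 := by
  rintro rfl; simp [Herm.q] at hv

/-- the eigenvalue on a negative eigenvector is a negative real -/
theorem eig_neg (hK : B.Avop K) {v : V} {κ : ℂ} (hv : B.q v < 0) (h : K v = κ • v) :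
    ∃ r : ℝ, r < 0 ∧ κ = r := by
  have h1 := hK.sa v v
  rw [h] at h1
  simp only [map_smulₛₗ, LinearMap.smul_apply, smul_eq_mul, RingHom.id_apply] at h1
  rw [B.h_self] at h1
  have h2 := mul_right_cancel₀ (by exact_mod_cast hv.ne) h1
  obtain ⟨r, hr⟩ := Complex.conj_eq_iff_real.1 h2
  refine ⟨r, ?_, hr⟩
  obtain ⟨a, ha, hp⟩ := hK.pos
  have h3 := hp v (ne_zero_of_neg hv)
  rw [h, hr, map_smul, B.h_self, smul_eq_mul, ← Complex.ofReal_mul, Complex.ofReal_re] at h3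
  by_contra hcon
  push Not at hcon
  nlinarith [mul_nonneg ha.le hcon]

theorem eig_simple (hK : B.Avop K) {v w : V} {κ : ℂ} (hv : B.q v < 0) (h : K v = κ • v)
    (hw : K w = κ • w) : ∃ t : ℂ, w = t • v := by
  obtain ⟨r, hr, rfl⟩ := hK.eig_neg hv h
  set t := B.h v w / B.h v v
  have hvv : B.h v v ≠ 0 := by rw [B.h_self]; exact_mod_cast hv.ne
  refine ⟨t, ?_⟩
  by_contra hne
  have h0 : B.h v (w - t • v) = 0 := by
    simp only [map_sub, map_smul, smul_eq_mul, t]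
    field_simp; simp
  have h1 := B.pos_of_orth_neg hv h0 (sub_ne_zero.2 hne)
  have h2 : K (w - t • v) = (r:ℂ) • (w - t • v) := by
    rw [map_sub, map_smul, h, hw, smul_sub, smul_comm]
  have h3 := hK.nonneg (w - t • v)
  rw [h2, map_smul, B.h_self, smul_eq_mul, ← Complex.ofReal_mul, Complex.ofReal_re] at h3
  nlinarith

theorem unique (hK : B.Avop K) {v v' : V} {κ κ' : ℂ} (hv : B.q v < 0) (h : K v = κ • v)
    (hv' : B.q v' < 0) (h' : K v' = κ' • v') : ∃ t : ℂ, v' = t • v := by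
  by_cases hk : κ = κ'
  · exact hK.eig_simple hv h (hk ▸ h')
  exfalso
  have h1 := hK.sa v v'
  obtain ⟨r, hr, rfl⟩ := hK.eig_neg hv h
  rw [h, h'] at h1
  simp only [map_smulₛₗ, LinearMap.smul_apply, smul_eq_mul, RingHom.id_apply,
    Complex.conj_ofReal] at h1
  have h2 : B.h v v' = 0 := by
    have : ((r:ℂ) - κ') * B.h v v' = 0 := by rw [sub_mul, h1, sub_self]
    exact (mul_eq_zero.1 this).resolve_left (sub_ne_zero.2 hk)
  have := B.pos_of_orth_neg hv h2 (ne_zero_of_neg hv')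
  linarith

theorem exists_eig [FiniteDimensional ℂ V] (hK : B.Avop K) :
    ∃ v, B.q v < 0 ∧ ∃ κ : ℂ, K v = κ • v := by
  obtain ⟨o, ho⟩ := B.neg
  have ho : B.q o < 0 := ho
  have ho0 := ne_zero_of_neg ho
  obtain ⟨a, ha, hp⟩ := hK.pos
  have : ProperSpace V := FiniteDimensional.proper ℂ V
  set N : V → ℝ := fun v => B.q v + a * (B.h v (K v)).re with hN
  have hNc : Continuous N := by
    have h1 : Continuous fun v => B.h v (K v) :=
      B.continuous_h.comp (continuous_id.prodMk K.continuous)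
    have := B.continuous_q
    simp only [hN]
    fun_prop
  have hNs : ∀ (c : ℂ) v, N (c • v) = ‖c‖ ^ 2 * N v := by
    intro c v
    simp only [hN, B.q_smul, map_smulₛₗ, LinearMap.smul_apply, smul_eq_mul, RingHom.id_apply]
    rw [mul_left_comm c, ← mul_assoc, ← Complex.normSq_eq_conj_mul_self, Complex.re_ofReal_mul,
      Complex.normSq_eq_norm_sq]
    ring
  obtain ⟨v, hv, hmin⟩ := (isCompact_sphere (0:V) 1).exists_isMinOn
    ⟨((‖o‖⁻¹ : ℝ) : ℂ) • o, by simp [norm_smul, ho0]⟩ (f := fun v => B.q v / N v) (by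
      refine B.continuous_q.continuousOn.div hNc.continuousOn ?_
      intro v hv
      exact (hp v (by rintro rfl; simp at hv)).ne')
  have hv0 : v ≠ 0 := by rintro rfl; simp at hv
  have hall : ∀ w, w ≠ 0 → B.q v / N v ≤ B.q w / N w := by
    intro w hw
    have h1 := hmin (show ((‖w‖⁻¹ : ℝ) : ℂ) • w ∈ Metric.sphere (0:V) 1 by
      simp [norm_smul, hw])
    simp only [Set.mem_ofPred_eq] at h1
    rw [B.q_smul, hNs, mul_div_mul_left] at h1
    · exact h1
    · simp [hw]
  set c := -(B.q v / N v) with hc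
  have hcpos : 0 < c := by
    have h1 := hall o ho0
    have h2 : B.q o / N o < 0 := div_neg_of_neg_of_pos ho (hp o ho0)
    linarith
  have hQ : ∀ w, 0 ≤ B.q w + c * N w := by
    intro w
    by_cases hw : w = 0
    · simp [hw, hN, Herm.q]
    have h1 := hall w hw
    have h2 := hp w hw
    rw [le_div_iff₀ h2] at h1
    rw [hc]; linarith
  have hQv : B.q v + c * N v = 0 := by
    have : N v ≠ 0 := (hp v hv0).ne'
    rw [hc, neg_mul, div_mul_cancel₀ _ this, add_neg_cancel]
  have hqv : B.q v < 0 := by nlinarith [hp v hv0, mul_pos hcpos (hp v hv0)]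
  refine ⟨v, hqv, ?_⟩
  let z := ((1 + c : ℝ) : ℂ) • v + ((c * a : ℝ) : ℂ) • K v
  have hre : ∀ w, (B.h z w).re = 0 := by
    intro w
    have hexp : ∀ t : ℝ, B.q (v + (t:ℂ) • w) + c * N (v + (t:ℂ) • w) =
        2 * t * (B.h z w).re + t ^ 2 * (B.q w + c * N w) := by
      intro t
      have e1 : (B.h (v + (t:ℂ) • w) (K (v + (t:ℂ) • w))).re = (B.h v (K v)).re +
          2 * t * (B.h (K v) w).re + t ^ 2 * (B.h w (K w)).re := by
        have e2 : (B.h w (K v)).re = (B.h (K v) w).re := by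
          rw [← B.symm, Complex.conj_re]
        simp only [map_add, map_smulₛₗ, LinearMap.add_apply, LinearMap.smul_apply, smul_eq_mul,
          RingHom.id_apply, Complex.conj_ofReal, Complex.add_re, Complex.re_ofReal_mul, e2,
          ← hK.sa v w]
        ring
      have e3 : (B.h z w).re = (1 + c) * (B.h v w).re + c * a * (B.h (K v) w).re := by
        simp only [z, map_add, map_smulₛₗ, LinearMap.add_apply, LinearMap.smul_apply, smul_eq_mul,
          Complex.conj_ofReal, Complex.add_re, Complex.re_ofReal_mul]
      have e4 : B.q (v + (t:ℂ) • w) = B.q v + 2 * t * (B.h v w).re + t ^ 2 * B.q w := by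
        rw [B.q_add, B.q_smul, map_smul, smul_eq_mul, Complex.re_ofReal_mul, Complex.norm_real,
          Real.norm_eq_abs, sq_abs]
        ring
      have hQv' := hQv
      simp only [hN] at hQv' ⊢
      rw [e1, e3, e4]
      linear_combination hQv'
    have hge : ∀ t : ℝ, 0 ≤ 2 * t * (B.h z w).re + t ^ 2 * (B.q w + c * N w) := by
      intro t; rw [← hexp]; exact hQ _
    by_contra hne
    set b := (B.h z w).re
    set d := B.q w + c * N w
    have hd : 0 ≤ d := hQ w
    have h1 := hge (-b / (d + 1))
    have h2 : 2 * (-b / (d + 1)) * b + (-b / (d + 1)) ^ 2 * d = -(b ^ 2 * (d + 2)) / (d + 1) ^ 2 := by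
      field_simp; ring
    rw [h2] at h1
    have h3 : 0 < b ^ 2 * (d + 2) := by positivity
    have h4 : -(b ^ 2 * (d + 2)) / (d + 1) ^ 2 < 0 := div_neg_of_neg_of_pos (by linarith) (by positivity)
    linarith
  have hz : z = 0 := by
    apply B.nondeg
    intro w
    apply Complex.ext
    · simpa using hre w
    · have := hre (Complex.I • w)
      simpa using this
  have hca : ((c * a : ℝ) : ℂ) ≠ 0 := by exact_mod_cast (mul_pos hcpos ha).ne'
  refine ⟨-(((1 + c : ℝ) : ℂ) / ((c * a : ℝ) : ℂ)), ?_⟩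
  have h1 : ((c * a : ℝ) : ℂ) • K v = -(((1 + c : ℝ) : ℂ) • v) := eq_neg_of_add_eq_zero_right hz
  have h2 := congrArg (fun y => ((c * a : ℝ) : ℂ)⁻¹ • y) h1
  simp only [smul_smul, inv_mul_cancel₀ hca, one_smul, smul_neg] at h2
  rw [h2, neg_smul]; congr 2; field_simp

/-- normalised eigenvector -/
theorem exists_norm_eig [FiniteDimensional ℂ V] (hK : B.Avop K) {o : V} (ho : B.q o < 0) :
    ∃ v, B.q v < 0 ∧ B.h o v = 1 ∧ ∃ κ : ℂ, K v = κ • v := by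
  obtain ⟨v, hv, κ, h⟩ := hK.exists_eig
  have h0 : B.h o v ≠ 0 := by
    intro h0
    have := B.pos_of_orth_neg ho h0 (ne_zero_of_neg hv)
    linarith
  refine ⟨(B.h o v)⁻¹ • v, ?_, by simp [h0], κ, by rw [map_smul, h, smul_comm]⟩
  rw [B.q_smul]
  have : 0 < ‖(B.h o v)⁻¹‖ ^ 2 := by
    have := norm_pos_iff.2 (inv_ne_zero h0)
    positivity
  nlinarith

end Herm.Avop
end HLC
end

noncomputable section
namespace HLC
open Filter Topology
set_option linter.unusedSectionVars false
open scoped ComplexConjugate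

namespace Setup
variable {G V : Type*} [Group G] [NormedAddCommGroup V] [NormedSpace ℂ V] [FiniteDimensional ℂ V]
  {B : Herm V} {A : AffAct G V}

/-- averaged operator -/
def Kop (B : Herm V) (P : A.PU) (o : V) (x : V) : V →L[ℂ] V :=
  ∑ᶠ g, P.χ (A.act g x) • (B.hc (A.L g⁻¹ o)).smulRight (A.L g⁻¹ o)

theorem Kop_contDiff (S : Setup B A) (P : A.PU) (o : V) : ContDiff ℝ 1 (Kop B P o) :=
  AffAct.finsum_contDiff S.crys.proper P.supp P.smooth _ (fun _ => contDiff_const)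

theorem Kop_apply (S : Setup B A) (P : A.PU) (o x v : V) :
    Kop B P o x v = ∑ᶠ g, P.χ (A.act g x) • (B.h (A.L g⁻¹ o) v • A.L g⁻¹ o) :=
  P.map_sum S.crys.proper x
    ({ toFun := fun T => T v, map_add' := fun _ _ => rfl, map_smul' := fun _ _ => rfl } :
      (V →L[ℂ] V) →ₗ[ℝ] V) _

theorem h_Kop (S : Setup B A) (P : A.PU) (o x v w : V) :
    B.h w (Kop B P o x v) = ∑ᶠ g, P.χ (A.act g x) • (B.h (A.L g⁻¹ o) v * B.h w (A.L g⁻¹ o)) := by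
  rw [S.Kop_apply]
  refine (P.map_sum S.crys.proper x ((B.h w).restrictScalars ℝ) _).trans ?_
  simp

theorem Kop_equiv (S : Setup B A) (P : A.PU) (o x v : V) (γ : G) :
    Kop B P o (A.act γ x) (A.L γ v) = A.L γ (Kop B P o x v) := by
  rw [S.Kop_apply, S.Kop_apply]
  refine (A.finsum_shift P.χ _ γ x).trans ?_
  refine Eq.trans ?_ (P.map_sum S.crys.proper x (A.L γ : V →ₗ[ℝ] V) _).symm
  apply finsum_congr
  intro g
  simp only [_root_.mul_inv_rev, inv_inv, A.L_mul, S.inv, ContinuousLinearMap.coe_coe, S.smul]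

theorem Kop_mem (S : Setup B A) (P : A.PU) {o : V} {E : Submodule ℂ V} (ho : o ∈ E)
    (hE : ∀ g, ∀ x ∈ E, A.L g x ∈ E) (x v : V) : Kop B P o x v ∈ E := by
  rw [S.Kop_apply]
  exact P.mem_sum x (E.restrictScalars ℝ) _ (fun g => E.smul_mem _ (hE _ _ ho))

theorem Kop_avop (S : Setup B A) (P : A.PU) {o : V} (ho : B.q o < 0) (x : V) :
    B.Avop (Kop B P o x) := by
  have key : ∀ v, (B.h v (Kop B P o x v)).re =
      ∑ᶠ g, P.χ (A.act g x) • ‖B.h (A.L g⁻¹ o) v‖ ^ 2 := by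
    intro v
    rw [S.h_Kop]
    refine (P.map_sum S.crys.proper x Complex.reLm _).trans ?_
    apply finsum_congr
    intro g
    congr 1
    rw [← B.symm _ v, Complex.mul_conj, Complex.normSq_eq_norm_sq]
    exact Complex.ofReal_re _
  refine ⟨?_, ?_, 2 / |B.q o|, ?_, ?_⟩
  · intro v w
    rw [← B.symm w, S.h_Kop, S.h_Kop]
    refine (P.map_sum S.crys.proper x (Complex.conjAe.toLinearEquiv : ℂ →ₗ[ℝ] ℂ) _).trans ?_
    apply finsum_congr
    intro g
    congr 1
    change conj (_ * _) = _
    rw [map_mul, B.symm, B.symm, mul_comm]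
  · intro v
    rw [key]
    exact finsum_nonneg fun g => smul_nonneg (P.nonneg _) (by positivity)
  · have := abs_pos.2 ho.ne
    positivity
  · intro v hv
    have e : B.q v + 2 / |B.q o| * (B.h v (Kop B P o x v)).re =
        ∑ᶠ g, P.χ (A.act g x) • B.N (A.L g⁻¹ o) v := by
      rw [key]
      have h1 : ∀ g, B.N (A.L g⁻¹ o) v = B.q v + 2 / |B.q o| * ‖B.h (A.L g⁻¹ o) v‖ ^ 2 := by
        intro g; rw [Herm.N, S.q_L]; ring
      simp_rw [h1]
      rw [P.sum_add S.crys.proper, P.sum_const S.crys.proper]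
      congr 1
      exact P.map_sum S.crys.proper x (LinearMap.mulLeft ℝ (2 / |B.q o|)) _
    rw [e]
    have hN : ∀ g, 0 < B.N (A.L g⁻¹ o) v := fun g => B.N_pos (by rw [S.q_L]; exact ho) hv
    apply finsum_pos
    · intro g; exact smul_nonneg (P.nonneg _) (hN g).le
    · by_contra! hcon
      have h0 : ∀ g, P.χ (A.act g x) = 0 := by
        intro g
        refine le_antisymm ?_ (P.nonneg _)
        have := hcon g
        rw [smul_eq_mul] at this
        exact nonpos_of_mul_nonpos_left this (hN g)
      have := P.sum x
      simp [h0] at this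
    · exact P.fin_smul S.crys.proper x _

/-- The equivariant map to negative lines. -/
theorem exists_f (S : Setup B A) {o : V} (ho : B.q o < 0) :
    ∃ f : V → V, ContDiff ℝ 1 f ∧ (∀ x, B.q (f x) < 0) ∧ 
      (∀ γ x, ∃ c : ℂ, c ≠ 0 ∧ f (A.act γ x) = c • A.L γ (f x)) ∧
      (∀ E : Submodule ℂ V, o ∈ E → (∀ g, ∀ x ∈ E, A.L g x ∈ E) → ∀ x, f x ∈ E) ∧
      (∀ Y : Submodule ℝ V, o ∈ Y → (∀ g, ∀ x ∈ Y, A.L g x ∈ Y) →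
        (∀ x ∈ Y, ∀ y ∈ Y, (B.h x y).im = 0) → ∀ x, f x ∈ Y) := by
  have : FiniteDimensional ℝ V := finReal
  obtain ⟨P⟩ := AffAct.exists_PU S.crys.proper S.crys.cocpt
  set K := Kop B P o with hKdef
  have hK : ∀ x, B.Avop (K x) := S.Kop_avop P ho
  choose f hf1 hf2 κ hf3 using fun x => (hK x).exists_norm_eig ho
  -- uniqueness
  have huniq : ∀ x v (k : ℂ), B.q v < 0 → B.h o v = 1 → K x v = k • v → v = f x := by
    intro x v k h1 h2 h3
    obtain ⟨t, ht⟩ := (hK x).unique (hf1 x) (hf3 x) h1 h3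
    have : t = 1 := by
      rw [ht, map_smul, hf2, smul_eq_mul, mul_one] at h2; exact h2
    rw [ht, this, one_smul]
  have hf0 : ∀ x, f x ≠ 0 := fun x => Herm.Avop.ne_zero_of_neg (hf1 x)
  have hκ : ∀ x, ∃ r : ℝ, r < 0 ∧ κ x = r := fun x => (hK x).eig_neg (hf1 x) (hf3 x)
  refine ⟨f, ?_, hf1, ?_, ?_, ?_⟩
  · rw [contDiff_iff_contDiffAt]
    intro x0
    let Φ : V × (V × ℂ) → V × (V × ℂ) := fun p =>
      (p.1, (K p.1 p.2.1 - p.2.2 • p.2.1, B.h o p.2.1 - 1))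
    have hKc : ContDiff ℝ 1 K := S.Kop_contDiff P o
    let res : (V →L[ℂ] V) →L[ℝ] (V →L[ℝ] V) := ContinuousLinearMap.restrictScalarsL ℂ V V ℝ ℝ
    have hKr : ContDiff ℝ 1 (fun x => res (K x)) := res.contDiff.comp hKc
    let ho' : V →L[ℝ] ℂ := (B.hc o).restrictScalars ℝ
    have hΦ1 : ContDiff ℝ 1 (fun p : V × (V × ℂ) => res (K p.1) p.2.1) :=
      (hKr.comp contDiff_fst).clm_apply (contDiff_fst.comp contDiff_snd)
    have hΦc : ContDiff ℝ 1 Φ := by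
      refine contDiff_fst.prodMk (ContDiff.prodMk ?_ ?_)
      · refine ContDiff.sub hΦ1 ?_
        exact (contDiff_snd.comp contDiff_snd).smul (contDiff_fst.comp contDiff_snd)
      · exact (ho'.contDiff.comp (contDiff_fst.comp contDiff_snd)).sub contDiff_const
    let p0 : V × (V × ℂ) := (x0, (f x0, κ x0))
    have hΦ0 : Φ p0 = (x0, (0, 0)) := by
      simp [Φ, p0, hf3, hf2]
    set D := fderiv ℝ Φ p0 with hD
    have hDd : HasFDerivAt Φ D p0 := (hΦc.differentiable (by norm_num) p0).hasFDerivAt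
    -- derivative along directions
    have hD1 : ∀ z, (D z).1 = z.1 := by
      intro z
      have h1 : HasFDerivAt (fun p : V × (V × ℂ) => p.1) (ContinuousLinearMap.fst ℝ V (V × ℂ)) p0 :=
        hasFDerivAt_fst
      have h2 : HasFDerivAt (fun p : V × (V × ℂ) => (Φ p).1)
        ((ContinuousLinearMap.fst ℝ V (V × ℂ)).comp D) p0 := hDd.fst
      have := h2.unique h1
      exact congrArg (fun T => T z) this
    have hD2 : ∀ w (μ : ℂ), D (0, (w, μ)) = (0, (K x0 w - κ x0 • w - μ • f x0, B.h o w)) := by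
      intro w μ
      let c : ℝ → V × (V × ℂ) := fun t => p0 + t • (0, (w, μ))
      have hc : HasDerivAt c (0, (w, μ)) 0 := by
        have := (hasDerivAt_id (0:ℝ)).smul_const ((0, (w, μ)) : V × (V × ℂ))
        simpa [c] using this.const_add p0
      have h1 : HasDerivAt (Φ ∘ c) (D (0, (w, μ))) 0 := by
        have hc0 : c 0 = p0 := by simp [c]
        exact HasFDerivAt.comp_hasDerivAt (0:ℝ) (by rw [hc0]; exact hDd) hc
      have h2 : Φ ∘ c = fun t : ℝ => (x0, (t • (K x0 w - κ x0 • w - μ • f x0) - (t ^ 2) • (μ • w), t • B.h o w)) := by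
        funext t
        refine Prod.ext ?_ (Prod.ext ?_ ?_)
        · simp [Φ, c, p0]
        · have hcr : ∀ (a : V), K x0 (t • a) = t • K x0 a := fun a => (res (K x0)).map_smul t a
          simp only [Φ, c, p0, Function.comp, Prod.fst_add, Prod.smul_fst, smul_zero, add_zero,
            Prod.snd_add, Prod.smul_snd, map_add, hf3, hcr, smul_add, add_smul, smul_sub,
            smul_assoc]
          rw [smul_comm (κ x0) t w, smul_comm μ t w, smul_smul t t, sq]
          abel
        · have hcr : B.h o (t • w) = t • B.h o w := ho'.map_smul t w
          simp only [Φ, c, p0, Function.comp, Prod.fst_add, Prod.smul_fst, smul_zero, add_zero,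
            Prod.snd_add, Prod.smul_snd, map_add, hf2, hcr]
          ring
      have h3 : HasDerivAt (fun t : ℝ => (x0, (t • (K x0 w - κ x0 • w - μ • f x0) - (t ^ 2) • (μ • w), t • B.h o w)))
          (0, (K x0 w - κ x0 • w - μ • f x0, B.h o w)) 0 := by
        refine (hasDerivAt_const (0:ℝ) x0).prodMk (HasDerivAt.prodMk ?_ ?_)
        · have a1 := (hasDerivAt_id (0:ℝ)).smul_const (K x0 w - κ x0 • w - μ • f x0)
          have a2 := ((hasDerivAt_id (0:ℝ)).pow 2).smul_const (μ • w)
          have a3 := a1.sub a2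
          have e : (id (0:ℝ)) = 0 := rfl
          refine a3.congr_deriv ?_
          simp
        · simpa using (hasDerivAt_id (0:ℝ)).smul_const (B.h o w)
      rw [h2] at h1
      exact h1.unique h3
    have hinj : Function.Injective (D : V × (V × ℂ) →ₗ[ℝ] V × (V × ℂ)) := by
      rw [← LinearMap.ker_eq_bot, LinearMap.ker_eq_bot']
      rintro ⟨a, w, μ⟩ hz
      have hz : D (a, (w, μ)) = 0 := hz
      have ha : a = 0 := by
        have := hD1 (a, (w, μ))
        rw [hz] at this; exact this.symm
      subst ha
      rw [hD2] at hz
      simp only [Prod.mk_eq_zero, true_and] at hz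
      obtain ⟨hz1, hz2⟩ := hz
      obtain ⟨r, hr, hkr⟩ := hκ x0
      have hμ : μ = 0 := by
        have h1 := congrArg (B.h (f x0)) hz1
        simp only [map_sub, map_smul, smul_eq_mul, map_zero, ← (hK x0).sa] at h1
        rw [hf3, hkr] at h1
        simp only [map_smulₛₗ, LinearMap.smul_apply, smul_eq_mul, Complex.conj_ofReal, sub_self,
          zero_sub, neg_eq_zero, B.h_self] at h1
        exact (mul_eq_zero.1 h1).resolve_right (by exact_mod_cast (hf1 x0).ne)
      subst hμ
      rw [zero_smul, sub_zero, sub_eq_zero] at hz1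
      obtain ⟨t, rfl⟩ := (hK x0).eig_simple (hf1 x0) (hf3 x0) hz1
      rw [map_smul, hf2, smul_eq_mul, mul_one] at hz2
      simp [hz2]
    let e : (V × (V × ℂ)) ≃L[ℝ] (V × (V × ℂ)) :=
      (LinearEquiv.ofInjectiveEndo _ hinj).toContinuousLinearEquiv
    have heD : (e : (V × (V × ℂ)) →L[ℝ] (V × (V × ℂ))) = D := by
      exact ContinuousLinearMap.ext fun z => rfl
    have hDe : HasFDerivAt Φ (e : (V × (V × ℂ)) →L[ℝ] (V × (V × ℂ))) p0 := by rw [heD]; exact hDd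
    have hst : HasStrictFDerivAt Φ (e : (V × (V × ℂ)) →L[ℝ] (V × (V × ℂ))) p0 :=
      hΦc.contDiffAt.hasStrictFDerivAt' hDe (by norm_num)
    let ψ := hΦc.contDiffAt.localInverse hDe (by norm_num)
    have hψc : ContDiffAt ℝ 1 ψ (Φ p0) := ContDiffAt.to_localInverse _ hDe (by norm_num)
    have hψ0 : ψ (Φ p0) = p0 := hst.localInverse_apply_image
    have hψr : ∀ᶠ y in 𝓝 (Φ p0), Φ (ψ y) = y := hst.eventually_right_inverse
    let ι : V → V × (V × ℂ) := fun x => (x, (0, 0))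
    have hι : ContDiff ℝ 1 ι := contDiff_id.prodMk contDiff_const
    have hι0 : ι x0 = Φ p0 := hΦ0.symm
    have hψι : ContDiffAt ℝ 1 (fun x => ψ (ι x)) x0 :=
      ContDiffAt.comp x0 (by rw [hι0]; exact hψc) hι.contDiffAt
    have hF : ContDiffAt ℝ 1 (fun x => (ψ (ι x)).2.1) x0 := hψι.snd.fst
    refine hF.congr_of_eventuallyEq ?_
    have hev1 : ∀ᶠ x in 𝓝 x0, Φ (ψ (ι x)) = ι x :=
      (hι.continuous.tendsto x0).eventually (by rw [hι0]; exact hψr)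
    have hev2 : ∀ᶠ x in 𝓝 x0, B.q ((ψ (ι x)).2.1) < 0 := by
      have : ContinuousAt (fun x => B.q ((ψ (ι x)).2.1)) x0 :=
        B.continuous_q.continuousAt.comp hF.continuousAt
      refine this.eventually (Iio_mem_nhds ?_)
      change B.q ((ψ (ι x0)).2.1) < 0
      rw [hι0, hψ0]; exact hf1 x0
    filter_upwards [hev1, hev2] with x h1 h2
    have e1 := congrArg Prod.fst h1
    have e2 := congrArg (fun z => z.2.1) h1
    have e3 := congrArg (fun z => z.2.2) h1
    simp only [Φ, ι] at e1 e2 e3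
    symm
    rw [e1, sub_eq_zero] at e2
    rw [sub_eq_zero] at e3
    exact huniq x _ _ h2 e3 e2
  · intro γ x
    have h1 : K (A.act γ x) (A.L γ (f x)) = κ x • A.L γ (f x) := by
      rw [hKdef, S.Kop_equiv, ← hKdef, hf3, S.smul]
    obtain ⟨c, hc⟩ := (hK (A.act γ x)).unique (by rw [S.q_L]; exact hf1 x) h1 (hf1 _) (hf3 _)
    refine ⟨c, ?_, hc⟩
    rintro rfl
    exact hf0 _ (by rw [hc, zero_smul])
  · intro E hoE hE x
    obtain ⟨r, hr, hkr⟩ := hκ x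
    have h1 := S.Kop_mem P hoE hE x (f x)
    rw [← hKdef, hf3, hkr] at h1
    exact (E.smul_mem_iff (by exact_mod_cast hr.ne)).1 h1
  · intro Y hoY hY him x
    obtain ⟨r, hr, hkr⟩ := hκ x
    let y1 : V := r⁻¹ • ∑ᶠ g, P.χ (A.act g x) • ((B.h (A.L g⁻¹ o) (f x)).re • A.L g⁻¹ o)
    let y2 : V := r⁻¹ • ∑ᶠ g, P.χ (A.act g x) • ((B.h (A.L g⁻¹ o) (f x)).im • A.L g⁻¹ o)
    have hy1 : y1 ∈ Y := Y.smul_mem _ (P.mem_sum x Y _ fun g => Y.smul_mem _ (hY _ _ hoY))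
    have hy2 : y2 ∈ Y := Y.smul_mem _ (P.mem_sum x Y _ fun g => Y.smul_mem _ (hY _ _ hoY))
    have hfy : f x = y1 + Complex.I • y2 := by
      have h1 : K x (f x) = (r:ℂ) • f x := by rw [hf3, hkr]
      have h2 : f x = r⁻¹ • K x (f x) := by
        rw [h1, Complex.coe_smul, smul_smul, inv_mul_cancel₀ hr.ne, one_smul]
      rw [h2, hKdef, S.Kop_apply]
      simp only [y1, y2]
      rw [smul_comm Complex.I, ← smul_add]
      congr 1
      have h3 : Complex.I • ∑ᶠ g, P.χ (A.act g x) • ((B.h (A.L g⁻¹ o) (f x)).im • A.L g⁻¹ o) =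
          ∑ᶠ g, P.χ (A.act g x) • (Complex.I • ((B.h (A.L g⁻¹ o) (f x)).im • A.L g⁻¹ o)) :=
        P.map_sum S.crys.proper x (Module.toModuleEnd ℝ V (S := ℂ) Complex.I) _
      rw [h3, ← P.sum_add S.crys.proper]
      apply finsum_congr
      intro g
      congr 1
      conv_lhs => rw [← Complex.re_add_im (B.h (A.L g⁻¹ o) (f x))]
      rw [add_smul, mul_comm, mul_smul, Complex.coe_smul, Complex.coe_smul]
    clear_value y1 y2
    -- totally real
    have htr : ∀ y ∈ Y, ∀ y' ∈ Y, y + Complex.I • y' = 0 → y = 0 ∧ y' = 0 := by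
      intro y hy y' hy' h0
      have e1 : y = -(Complex.I • y') := eq_neg_of_add_eq_zero_left h0
      have e2 : B.h o y' = 0 := by
        have h1 := him o hoY y hy
        have h2 := him o hoY y' hy'
        rw [e1] at h1
        simp at h1
        exact Complex.ext h1 h2
      have e3 : B.q y' = 0 := by
        have h1 := him y' hy' y hy
        rw [e1, map_neg, map_smul, B.h_self] at h1
        simpa using h1
      have e4 : y' = 0 := by
        by_contra hne
        have := B.pos_of_orth_neg ho e2 hne
        linarith
      exact ⟨by rw [e1, e4]; simp, e4⟩
    have hKY : ∀ y ∈ Y, K x y ∈ Y := by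
      intro y hy
      rw [hKdef, S.Kop_apply]
      refine P.mem_sum x Y _ fun g => ?_
      have hre : B.h (A.L g⁻¹ o) y = ((B.h (A.L g⁻¹ o) y).re : ℂ) :=
        Complex.ext rfl (by simpa using him _ (hY _ _ hoY) y hy)
      rw [hre, Complex.coe_smul]
      exact Y.smul_mem _ (hY _ _ hoY)
    have hz := htr (K x y1 - r • y1) (Y.sub_mem (hKY _ hy1) (Y.smul_mem _ hy1))
      (K x y2 - r • y2) (Y.sub_mem (hKY _ hy2) (Y.smul_mem _ hy2)) (by
        have h1 : K x (f x) = (r:ℂ) • f x := by rw [hf3, hkr]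
        rw [hfy, map_add, map_smul, smul_add, Complex.coe_smul, Complex.coe_smul] at h1
        rw [smul_sub, smul_comm Complex.I r y2, sub_add_sub_comm, h1, sub_self])
    have ho1 : B.h o y1 + Complex.I * B.h o y2 = 1 := by
      rw [← hf2 x, hfy, map_add, map_smul, smul_eq_mul]
    have i1 := him o hoY y1 hy1
    have i2 := him o hoY y2 hy2
    have hoy2 : B.h o y2 = 0 := by
      have := congrArg Complex.im ho1
      simp [i1] at this
      exact Complex.ext this i2
    have hoy1 : B.h o y1 = 1 := by simpa [hoy2] using ho1
    have hq1 : B.q y1 < 0 := by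
      have h1 := hf1 x
      rw [hfy, B.q_add, B.q_smul, map_smul] at h1
      have i3 := him y1 hy1 y2 hy2
      simp [i3] at h1
      have h2 := (B.core ho.le (Herm.Avop.ne_zero_of_neg ho) hoy2).1
      linarith
    have : y1 = f x := huniq x y1 r hq1 hoy1 (by
      rw [Complex.coe_smul]; exact sub_eq_zero.1 hz.1)
    rw [← this]; exact hy1

end Setup
end HLC
end

noncomputable section
namespace HLC
open Filter Topology
set_option linter.unusedSectionVars false
open scoped ComplexConjugate

namespace AffAct
variable {G E : Type*} [Group G] [NormedAddCommGroup E] [NormedSpace ℝ E] (A : AffAct G E)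

/-- the lattice of translations -/
def Lam : AddSubgroup E where
  carrier := {w | ∃ t, A.L t = 1 ∧ A.u t = w}
  zero_mem' := ⟨1, by simp, A.u_one⟩
  add_mem' := by
    rintro _ _ ⟨s, hs, rfl⟩ ⟨t, ht, rfl⟩
    exact ⟨s * t, by rw [map_mul, hs, ht, one_mul], by rw [A.u_mul, hs]; simp⟩
  neg_mem' := by
    rintro _ ⟨s, hs, rfl⟩
    have h1 : A.L s⁻¹ = 1 := by
      have := map_mul A.L s⁻¹ s
      rw [hs, inv_mul_cancel, map_one, mul_one] at this
      exact this.symm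
    refine ⟨s⁻¹, h1, ?_⟩
    have := A.u_mul s⁻¹ s
    rw [h1, inv_mul_cancel, u_one] at this
    simp only [one_apply_eq_self] at this
    exact eq_neg_of_add_eq_zero_left this.symm

theorem mem_Lam {w : E} : w ∈ A.Lam ↔ ∃ t, A.L t = 1 ∧ A.u t = w := Iff.rfl

/-- the real span of the translations -/
def W : Submodule ℝ E := Submodule.span ℝ (A.Lam : Set E)

theorem u_mem_W {t : G} (h : A.L t = 1) : A.u t ∈ A.W := Submodule.subset_span ⟨t, h, rfl⟩

theorem L_mem_W (g : G) {x : E} (hx : x ∈ A.W) : A.L g x ∈ A.W := by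
  have : A.W ≤ A.W.comap (A.L g : E →ₗ[ℝ] E) := by
    refine Submodule.span_le.2 ?_
    rintro _ ⟨t, ht, rfl⟩
    change A.L g (A.u t) ∈ A.W
    have h1 : A.L (g * t * g⁻¹) = 1 := by
      rw [map_mul, map_mul, ht, mul_one, ← map_mul, mul_inv_cancel, map_one]
    have h2 : A.u (g * t * g⁻¹) = A.L g (A.u t) := by
      have := A.u_mul (g * t * g⁻¹) g
      rw [h1, inv_mul_cancel_right, A.u_mul g t] at this
      simp only [one_apply_eq_self] at this
      have h3 : A.u g + A.L g (A.u t) = A.u g + A.u (g * t * g⁻¹) := by rw [this]; abel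
      exact (add_left_cancel h3).symm
    rw [← h2]; exact A.u_mem_W h1
  exact this hx

/-- the translations are cobounded in their span -/
theorem Lam_cobdd [FiniteDimensional ℝ E] :
    ∃ C : ℝ, ∀ w ∈ A.W, ∃ l ∈ A.Lam, ‖w + l‖ ≤ C := by
  have hfg : (Submodule.span ℝ (A.Lam : Set E)).FG := IsNoetherian.noetherian _
  rw [Submodule.fg_span_iff_fg_span_finset_subset] at hfg
  obtain ⟨s, hs, hspan⟩ := hfg
  have key : ∀ s : Finset E, (s : Set E) ⊆ A.Lam →
      ∃ C : ℝ, ∀ w ∈ Submodule.span ℝ (s : Set E), ∃ l ∈ A.Lam, ‖w + l‖ ≤ C := by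
    intro s
    classical
    induction s using Finset.induction_on with
    | empty => 
      intro _
      refine ⟨0, fun w hw => ⟨0, A.Lam.zero_mem, ?_⟩⟩
      simp at hw
      simp [hw]
    | insert a s _ ih =>
      intro hsub
      obtain ⟨C, hC⟩ := ih (fun x hx => hsub (by simp [Finset.mem_coe.1 hx]))
      have ha : a ∈ A.Lam := hsub (by simp)
      refine ⟨‖a‖ + C, fun w hw => ?_⟩
      rw [Finset.coe_insert, Submodule.mem_span_insert] at hw
      obtain ⟨c, z, hz, rfl⟩ := hw
      obtain ⟨l, hl, hlC⟩ := hC z hz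
      refine ⟨(-⌊c⌋) • a + l, A.Lam.add_mem (A.Lam.zsmul_mem ha _) hl, ?_⟩
      have e : c • a + z + ((-⌊c⌋) • a + l) = (Int.fract c) • a + (z + l) := by
        rw [← Int.self_sub_floor, sub_smul, neg_smul, Int.cast_smul_eq_zsmul]; abel
      rw [e]
      refine (norm_add_le _ _).trans (add_le_add ?_ hlC)
      rw [norm_smul, Real.norm_eq_abs, abs_of_nonneg (Int.fract_nonneg _)]
      exact mul_le_of_le_one_left (norm_nonneg _) (Int.fract_lt_one _).le
  obtain ⟨C, hC⟩ := key s hs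
  refine ⟨C, fun w hw => hC w ?_⟩
  rwa [← hspan]

theorem exists_quot [FiniteDimensional ℝ E] (W : Submodule ℝ E)
    (hW : ∀ g, ∀ x ∈ W, A.L g x ∈ W) :
    ∃ (C : Submodule ℝ E) (Bq : AffAct G C) (S : Semi A Bq), (∀ x, S.π x = 0 ↔ x ∈ W) ∧
      (∀ c : C, S.π (c : E) = c) ∧
      Module.finrank ℝ W + Module.finrank ℝ C = Module.finrank ℝ E := by
  obtain ⟨C, hC⟩ := Submodule.exists_isCompl W
  obtain ⟨π, hπ⟩ : ∃ π : E →L[ℝ] C, ∀ x, π x = Submodule.projectionOnto C W hC.symm x :=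
    ⟨LinearMap.toContinuousLinearMap (Submodule.projectionOnto C W hC.symm), fun x => rfl⟩
  have hπ0 : ∀ x, π x = 0 ↔ x ∈ W := fun x => by
    rw [hπ]; exact Submodule.projectionOnto_apply_eq_zero_iff hC.symm
  have hπc : ∀ c : C, π (c : E) = c := fun c => by
    rw [hπ]; exact Submodule.projectionOnto_apply_left hC.symm c
  have hdiff : ∀ x : E, (π x : E) - x ∈ W := by
    intro x
    rw [← hπ0, map_sub, hπc, sub_self]
  have hLπ : ∀ g x, π (A.L g (π x : E)) = π (A.L g x) := by
    intro g x
    rw [← sub_eq_zero, ← map_sub, ← map_sub, hπ0]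
    exact hW g _ (hdiff x)
  let Bq : AffAct G C :=
    { L := 
        { toFun := fun g => (π.comp (A.L g)).comp C.subtypeL
          map_one' := by ext x; simp [hπc]
          map_mul' := by
            intro g h
            ext x
            simp [hLπ] }
      u := fun g => π (A.u g)
      u_mul := by
        intro g h
        simp [A.u_mul, hLπ] }
  refine ⟨C, Bq, ⟨π, fun c => ⟨c, hπc c⟩, fun g x => hLπ g x, fun g => rfl⟩, hπ0, hπc,
    Submodule.finrank_add_eq_of_isCompl hC⟩

theorem exists_proj [FiniteDimensional ℝ E] (W : Submodule ℝ E) :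
    ∃ p : E →L[ℝ] E, ∀ x, p x = 0 ↔ x ∈ W := by
  obtain ⟨C, hC⟩ := Submodule.exists_isCompl W
  refine ⟨C.subtypeL.comp (LinearMap.toContinuousLinearMap
    (Submodule.projectionOnto C W hC.symm)), fun x => ?_⟩
  simp

/-- quotient by the translations: the action is proper modulo translations -/
theorem exists_tquot [FiniteDimensional ℝ E] (hA : A.Proper) :
    ∃ (C : Submodule ℝ E) (Bq : AffAct G C) (S : Semi A Bq), (∀ x, S.π x = 0 ↔ x ∈ A.W) ∧
      (∀ c : C, S.π (c : E) = c) ∧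
      Module.finrank ℝ A.W + Module.finrank ℝ C = Module.finrank ℝ E ∧
      ∀ R : ℝ, (A.L '' {g | ∃ x : C, ‖x‖ ≤ R ∧ ‖Bq.act g x‖ ≤ R}).Finite := by
  obtain ⟨C, Bq, S, h0, hc, hfr⟩ := A.exists_quot A.W (fun g x hx => A.L_mem_W g hx)
  refine ⟨C, Bq, S, h0, hc, hfr, fun R => ?_⟩
  obtain ⟨D, hD⟩ := A.Lam_cobdd
  refine ((hA (R + |D|)).image A.L).subset ?_
  rintro _ ⟨g, ⟨x, hx, hgx⟩, rfl⟩
  have h1 : A.act g x - (Bq.act g x : E) ∈ A.W := by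
    rw [← h0, map_sub, hc, ← S.act, hc, sub_self]
  obtain ⟨l, ⟨t, ht, rfl⟩, hl⟩ := hD _ h1
  refine ⟨t * g, ⟨x, ?_, ?_⟩, ?_⟩
  · have : ‖(x : E)‖ ≤ R := hx
    have := abs_nonneg D
    linarith
  · have e : A.act (t * g) x = (Bq.act g x : E) + (A.act g x - (Bq.act g x : E) + A.u t) := by
      rw [act_mul, act_def _ t, ht]; simp only [one_apply_eq_self]; abel
    rw [e]
    refine (norm_add_le _ _).trans (add_le_add hgx (hl.trans (le_abs_self _)))
  · rw [map_mul, ht, one_mul]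

end AffAct
end HLC
end

noncomputable section
namespace HLC
open Filter Topology
set_option linter.unusedSectionVars false
open scoped ComplexConjugate

section
variable {V : Type*} [NormedAddCommGroup V] [NormedSpace ℂ V] [FiniteDimensional ℂ V]
  (B : Herm V)

theorem Herm.contDiff_q : ContDiff ℝ 1 B.q := by
  have : IsBoundedBilinearMap ℝ (fun p : V × V => (B.h p.1 p.2).re) :=
    { add_left := by intro x y z; simp
      smul_left := by
        intro c x y
        have : c • x = (c : ℂ) • x := (RCLike.real_smul_eq_coe_smul (K := ℂ) c x)
        change (B.h (c • x) y).re = c • (B.h x y).re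
        rw [this, map_smulₛₗ, LinearMap.smul_apply]; simp
      add_right := by intro x y z; simp
      smul_right := by
        intro c x y
        have : c • y = (c : ℂ) • y := (RCLike.real_smul_eq_coe_smul (K := ℂ) c y)
        change (B.h x (c • y)).re = c • (B.h x y).re
        rw [this, map_smul]; simp
      bound := by
        obtain ⟨M, hM, hb⟩ := B.exists_bound
        exact ⟨M, hM, fun x y => (Complex.abs_re_le_norm _).trans (hb x y)⟩ }
  exact this.contDiff.comp (contDiff_id.prodMk contDiff_id)

/-- ratio measuring hyperbolic distance -/
def Herm.rat (o w v : V) : ℝ := ‖B.h w v‖ ^ 2 / (B.q v * B.q o)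

theorem Herm.contDiffAt_rat {o w v : V} (ho : B.q o < 0) (hv : B.q v < 0) :
    ContDiffAt ℝ 1 (B.rat o w) v := by
  unfold Herm.rat
  refine ContDiffAt.div ?_ ?_ (mul_ne_zero hv.ne ho.ne)
  · refine ContDiff.contDiffAt (ContDiff.norm_sq ℝ ?_)
    exact ((B.hc w).restrictScalars ℝ).contDiff
  · exact (B.contDiff_q.mul contDiff_const).contDiffAt

theorem Herm.rat_smul {o w v : V} {c : ℂ} (hc : c ≠ 0) : B.rat o w (c • v) = B.rat o w v := by
  unfold Herm.rat
  rw [B.q_smul, map_smul, norm_smul, mul_pow, mul_assoc, mul_div_mul_left]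
  have := norm_pos_iff.2 hc
  positivity

/-- local boundedness -/
theorem Herm.rat_bd {o v0 : V} (ho : B.q o < 0) (hv0 : B.q v0 < 0) (R : ℝ) (hR : 0 ≤ R) :
    ∃ C : ℝ, ∀ᶠ v in 𝓝 v0, ∀ w, B.q w = B.q o → B.rat o w v ≤ R → ‖B.h o w‖ ≤ C := by
  obtain ⟨m, hm, hN⟩ := B.exists_N_lower hv0
  obtain ⟨M, hM, hb⟩ := B.exists_bound
  have hq0 : 0 < |B.q v0| := abs_pos.2 hv0.ne
  obtain ⟨ε, hε, hεm⟩ : ∃ ε > 0, 4 * (M ^ 2 * ε ^ 2) / |B.q v0| ≤ m / 2 := by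
    refine ⟨Real.sqrt (m * |B.q v0| / (8 * M ^ 2)), Real.sqrt_pos.2 (by positivity), ?_⟩
    rw [Real.sq_sqrt (by positivity)]
    apply le_of_eq
    field_simp; ring
  refine ⟨M * ‖o‖ * Real.sqrt (2 / m * (8 * (R * |B.q o|))), ?_⟩
  have e1 : ∀ᶠ v in 𝓝 v0, ‖v - v0‖ < ε := by
    have := Metric.ball_mem_nhds v0 hε
    filter_upwards [this] with v hv
    rwa [Metric.mem_ball, dist_eq_norm] at hv
  have e2 : ∀ᶠ v in 𝓝 v0, 2 * B.q v0 < B.q v :=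
    B.continuous_q.continuousAt.eventually (lt_mem_nhds (by linarith))
  have e3 : ∀ᶠ v in 𝓝 v0, B.q v < 0 :=
    B.continuous_q.continuousAt.eventually (gt_mem_nhds hv0)
  filter_upwards [e1, e2, e3] with v h1 h2 h3 w hw hr
  have hqq : 0 < B.q v * B.q o := mul_pos_of_neg_of_neg h3 ho
  unfold Herm.rat at hr
  rw [div_le_iff₀ hqq] at hr
  have k1 := hN w
  unfold Herm.N at k1
  have k2 : ‖B.h v0 w‖ ≤ ‖B.h w v‖ + M * ε * ‖w‖ := by
    have : B.h v0 w = B.h v w - B.h (v - v0) w := by simp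
    rw [this, B.norm_h_symm w v]
    refine (norm_sub_le _ _).trans (add_le_add le_rfl ((hb _ _).trans ?_))
    gcongr
  have k3 : ‖B.h v0 w‖ ^ 2 ≤ 2 * ‖B.h w v‖ ^ 2 + 2 * (M * ε * ‖w‖) ^ 2 := by
    have := pow_le_pow_left₀ (norm_nonneg _) k2 2
    nlinarith [sq_nonneg (‖B.h w v‖ - M * ε * ‖w‖)]
  have k4 : B.q v * B.q o ≤ 2 * |B.q v0| * |B.q o| := by
    rw [abs_of_neg hv0, abs_of_neg ho]
    nlinarith
  have k5 : 2 * ‖B.h v0 w‖ ^ 2 / |B.q v0| ≤ 8 * (R * |B.q o|) + m / 2 * ‖w‖ ^ 2 := by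
    have : 2 * ‖B.h v0 w‖ ^ 2 / |B.q v0| ≤
        (4 * (R * (2 * |B.q v0| * |B.q o|)) + 4 * (M * ε * ‖w‖) ^ 2) / |B.q v0| := by
      gcongr
      have := mul_le_mul_of_nonneg_left k4 hR
      linarith
    refine this.trans ?_
    have e : (4 * (R * (2 * |B.q v0| * |B.q o|)) + 4 * (M * ε * ‖w‖) ^ 2) / |B.q v0|
      = 8 * (R * |B.q o|) + 4 * (M ^ 2 * ε ^ 2) / |B.q v0| * ‖w‖ ^ 2 := by field_simp; ring
    rw [e]
    gcongr
  have k6 : ‖w‖ ^ 2 ≤ 2 / m * (8 * (R * |B.q o|)) := by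
    rw [div_mul_eq_mul_div, le_div_iff₀ hm]
    linarith
  refine (hb _ _).trans ?_
  gcongr
  exact Real.le_sqrt_of_sq_le k6

end

variable {G V : Type*} [Group G] [NormedAddCommGroup V] [NormedSpace ℂ V] [FiniteDimensional ℂ V]
  {B : Herm V} {A : AffAct G V}

/-- finite sums of a locally finite family -/
theorem lf_contDiffAt {X V Q' : Type*} [NormedAddCommGroup V] [NormedSpace ℝ V]
    [NormedAddCommGroup Q'] [NormedSpace ℝ Q'] (θ : X → V → ℝ) (v0 : V) (s : Finset X)
    (hs : ∀ᶠ v in 𝓝 v0, ∀ q ∉ s, θ q v = 0) (hθ : ∀ q, ContDiffAt ℝ 1 (θ q) v0) (a : X → Q') :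
    ContDiffAt ℝ 1 (fun v => ∑ᶠ q, θ q v • a q) v0 := by
  have h1 : ContDiffAt ℝ 1 (fun v => ∑ q ∈ s, θ q v • a q) v0 :=
    ContDiffAt.sum fun q _ => (hθ q).smul contDiffAt_const
  refine h1.congr_of_eventuallyEq ?_
  filter_upwards [hs] with v hv
  apply finsum_eq_sum_of_support_subset
  intro q hq
  by_contra h
  apply hq
  simp only
  rw [hv q h, zero_smul]

/-- The dimension drop argument. -/
theorem Irr.drop {E : Submodule ℂ V} {o : V} (I : Irr B A E o) 
    {Q : Type*} [NormedAddCommGroup Q] [NormedSpace ℝ Q] [FiniteDimensional ℝ Q]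
    {C : AffAct G Q} (S : A.Semi C) (hS : ∀ t, A.L t = 1 → C.u t = 0)
    (f : V → V) (hf : ContDiff ℝ 1 f) (hfq : ∀ x, B.q (f x) < 0)
    (hfe : ∀ γ x, ∃ c : ℂ, c ≠ 0 ∧ f (A.act γ x) = c • A.L γ (f x))
    (E0 : Submodule ℝ V) (hE0 : ∀ x, f x ∈ E0)
    (hZ : ∀ x, ∃ Z : Submodule ℝ V, Z ≤ E0 ∧ (∀ z ∈ Z, ∃ c : ℂ, z = c • f x) ∧
      Module.finrank ℝ E0 < Module.finrank ℝ Q + Module.finrank ℝ Z) : False := by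
  have : FiniteDimensional ℝ V := Setup.finReal
  let X := G ⧸ A.L.ker
  let ω : X → V := fun q => A.L q.out o
  let p : X → Q := fun q => C.u q.out
  have hout : ∀ g : G, ∃ t, A.L t = 1 ∧ (QuotientGroup.mk g : X).out = g * t := by
    intro g
    obtain ⟨n, hn⟩ := QuotientGroup.mk_out_eq_mul A.L.ker g
    exact ⟨n, n.2, hn⟩
  have hωmk : ∀ g : G, ω (QuotientGroup.mk g) = A.L g o := by
    intro g
    obtain ⟨t, ht, e⟩ := hout g
    simp only [ω, e, map_mul, ht, mul_one]
  have hpmk : ∀ g : G, p (QuotientGroup.mk g) = C.u g := by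
    intro g
    obtain ⟨t, ht, e⟩ := hout g
    simp only [p, e, C.u_mul, hS t ht, map_zero, add_zero]
  have hω : ∀ (γ : G) (q : X), ω (γ • q) = A.L γ (ω q) := by
    intro γ q
    obtain ⟨g, rfl⟩ := QuotientGroup.mk_surjective q
    have : γ • (QuotientGroup.mk g : X) = QuotientGroup.mk (γ * g) := rfl
    rw [this, hωmk, hωmk, A.L_mul]
  have hp : ∀ (γ : G) (q : X), p (γ • q) = C.act γ (p q) := by
    intro γ q
    obtain ⟨g, rfl⟩ := QuotientGroup.mk_surjective q
    have : γ • (QuotientGroup.mk g : X) = QuotientGroup.mk (γ * g) := rfl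
    rw [this, hpmk, hpmk, C.u_mul, AffAct.act_def, add_comm]
  have hqω : ∀ q, B.q (ω q) = B.q o := fun q => I.S.q_L _ _
  have hfin : ∀ D : ℝ, {q | ‖B.h o (ω q)‖ ≤ D}.Finite := by
    intro D
    refine Set.Finite.of_finite_image (f := fun q : X => A.L q.out) ((I.bd D).subset ?_) ?_
    · rintro _ ⟨q, hq, rfl⟩
      exact ⟨q.out, hq, rfl⟩
    · intro q _ q' _ h
      have h : A.L q.out = A.L q'.out := h
      have : (QuotientGroup.mk q.out : X) = QuotientGroup.mk q'.out := by
        rw [QuotientGroup.eq]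
        change A.L _ = 1
        rw [map_mul, ← h, ← map_mul]; simp
      simpa using this
  clear_value ω p
  -- choice of R0
  obtain ⟨R, hR⟩ := I.S.crys.cocpt
  obtain ⟨R1, hR1⟩ : ∃ R1 : ℝ, ∀ x, ‖x‖ ≤ R → B.rat o o (f x) ≤ R1 := by
    have hc : Continuous fun x => B.rat o o (f x) := by
      rw [continuous_iff_continuousAt]
      intro x
      exact ContinuousAt.comp (f := f) (g := B.rat o o) (B.contDiffAt_rat I.qo (hfq x)).continuousAt hf.continuous.continuousAt
    obtain ⟨R1, h⟩ := (isCompact_closedBall (0 : V) R).bddAbove_image hc.continuousOn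
    exact ⟨R1, fun x hx => h ⟨x, by simpa using hx, rfl⟩⟩
  set R0 := |R1| + 1 with hR0
  have hR0pos : 0 < R0 := by positivity
  let θ : X → V → ℝ := fun q v => Real.smoothTransition (R0 - B.rat o (ω q) v)
  have hθnn : ∀ q v, 0 ≤ θ q v := fun q v => Real.smoothTransition.nonneg _
  have hθne : ∀ q v, θ q v ≠ 0 → B.rat o (ω q) v ≤ R0 := by
    intro q v h
    by_contra hlt
    push Not at hlt
    exact h (Real.smoothTransition.zero_of_nonpos (by linarith))
  have hθc : ∀ q v, B.q v < 0 → ContDiffAt ℝ 1 (θ q) v := by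
    intro q v hv
    exact ContDiffAt.comp v Real.smoothTransition.contDiffAt
      (contDiffAt_const.sub (B.contDiffAt_rat I.qo hv))
  have hθs : ∀ q v (c : ℂ), c ≠ 0 → θ q (c • v) = θ q v := by
    intro q v c hc
    simp only [θ, B.rat_smul hc]
  have hθγ : ∀ (γ : G) q v, θ (γ • q) (A.L γ v) = θ q v := by
    intro γ q v
    simp only [θ, Herm.rat, hω, I.S.inv, I.S.q_L]
  have hθpos : ∀ x, ∃ q, 0 < θ q (f x) := by
    intro x
    obtain ⟨γ, hγ⟩ := hR x
    obtain ⟨c, hc, hfc⟩ := hfe γ x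
    refine ⟨γ⁻¹ • QuotientGroup.mk 1, ?_⟩
    rw [← hθγ γ, smul_inv_smul, ← hθs _ _ c hc, ← hfc]
    refine Real.smoothTransition.pos_of_pos ?_
    have := hR1 _ hγ
    rw [hωmk, map_one, one_apply_eq_self]
    have := le_abs_self R1
    linarith
  have hlf : ∀ v0, B.q v0 < 0 → ∃ s : Finset X, ∀ᶠ v in 𝓝 v0, ∀ q ∉ s, θ q v = 0 := by
    intro v0 hv0
    obtain ⟨D, hD⟩ := B.rat_bd I.qo hv0 R0 hR0pos.le
    refine ⟨(hfin D).toFinset, ?_⟩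
    filter_upwards [hD] with v hv q hq
    by_contra h
    apply hq
    rw [Set.Finite.mem_toFinset]
    exact hv _ (hqω q) (hθne q v h)
  clear_value θ
  have hsupp : ∀ v, B.q v < 0 → (Function.support fun q => θ q v).Finite := by
    intro v hv
    obtain ⟨s, hs⟩ := hlf v hv
    refine s.finite_toSet.subset ?_
    intro q hq
    by_contra h
    exact hq (hs.self_of_nhds q h)
  let Z0 : V → ℝ := fun v => ∑ᶠ q, θ q v
  let Gm : V → Q := fun v => (Z0 v)⁻¹ • ∑ᶠ q, θ q v • p q
  have hZ0 : ∀ x, Z0 (f x) ≠ 0 := by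
    intro x
    obtain ⟨q, hq⟩ := hθpos x
    exact (finsum_pos (fun q => hθnn q _) ⟨q, hq⟩ (hsupp _ (hfq x))).ne'
  have hGc : ∀ x, ContDiffAt ℝ 1 Gm (f x) := by
    intro x
    refine ContDiffAt.smul (ContDiffAt.inv ?_ (hZ0 x)) ?_
    · obtain ⟨s, hs⟩ := hlf _ (hfq x)
      have := lf_contDiffAt θ (f x) s hs (fun q => hθc q _ (hfq x)) (fun _ => (1:ℝ))
      simpa using this
    · obtain ⟨s, hs⟩ := hlf _ (hfq x)
      exact lf_contDiffAt θ (f x) s hs (fun q => hθc q _ (hfq x)) p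
  have hGs : ∀ v (c : ℂ), c ≠ 0 → Gm (c • v) = Gm v := by
    intro v c hc
    simp only [Gm, Z0, hθs _ _ c hc]
  let hbar : V → Q := fun x => Gm (f x)
  have hbarc : ContDiff ℝ 1 hbar := by
    rw [contDiff_iff_contDiffAt]
    intro x
    exact ContDiffAt.comp x (hGc x) hf.contDiffAt
  have hbare : ∀ γ x, hbar (A.act γ x) = C.act γ (hbar x) := by
    intro γ x
    obtain ⟨c, hc, hfc⟩ := hfe γ x
    have e1 : Z0 (A.L γ (f x)) = Z0 (f x) := by
      change ∑ᶠ q, θ q _ = ∑ᶠ q, θ q _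
      rw [← finsum_comp_equiv (MulAction.toPerm γ)]
      apply finsum_congr
      intro q
      simp only [MulAction.toPerm_apply, hθγ]
    have hs1 : (Function.support fun q => θ q (f x) • p q).Finite := by
      refine (hsupp _ (hfq x)).subset ?_
      intro q hq h
      exact hq (by simp [h])
    have e2 : ∑ᶠ q, θ q (A.L γ (f x)) • p q
        = C.L γ (∑ᶠ q, θ q (f x) • p q) + Z0 (f x) • C.u γ := by
      rw [← finsum_comp_equiv (MulAction.toPerm γ)]
      have e3 : ∀ q, θ (MulAction.toPerm γ q) (A.L γ (f x)) • p (MulAction.toPerm γ q)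
          = C.L γ (θ q (f x) • p q) + θ q (f x) • C.u γ := by
        intro q
        simp only [MulAction.toPerm_apply, hθγ, hp, AffAct.act_def, smul_add, map_smul]
      rw [finsum_congr e3, finsum_add_distrib, finsum_smul]
      · congr 1
        exact ((C.L γ : Q →ₗ[ℝ] Q).toAddMonoidHom.map_finsum hs1).symm
      · refine hs1.subset ?_
        intro q hq h
        exact hq (by simp only at h ⊢; rw [h, map_zero])
      · refine (hsupp _ (hfq x)).subset ?_
        intro q hq h
        exact hq (by simp only at h ⊢; rw [h, zero_smul])
    change Gm _ = C.act γ (Gm _)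
    rw [hfc, hGs _ _ hc, AffAct.act_def]
    change (Z0 _)⁻¹ • _ = C.L γ ((Z0 _)⁻¹ • _) + _
    rw [e1, e2, map_smul, smul_add, inv_smul_smul₀ (hZ0 x)]
  -- lift
  obtain ⟨P⟩ := AffAct.exists_PU I.S.crys.proper I.S.crys.cocpt
  obtain ⟨σ0, hσ0⟩ := LinearMap.exists_rightInverse_of_surjective (S.π : V →ₗ[ℝ] Q)
    (LinearMap.range_eq_top.2 S.surj)
  obtain ⟨σ, hσ⟩ : ∃ σ : Q →L[ℝ] V, ∀ y, S.π (σ y) = y :=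
    ⟨LinearMap.toContinuousLinearMap σ0, fun y => LinearMap.congr_fun hσ0 y⟩
  let F : V → V := fun x => σ (hbar x)
  have hF : ContDiff ℝ 1 F := σ.contDiff.comp hbarc
  obtain ⟨x, hx⟩ := A.exists_surj I.S.crys (P.Av F) (P.Av_contDiff I.S.crys.proper F hF)
    (fun γ x => P.Av_equiv I.S.crys.proper F γ x)
  have hπh : ∀ x, S.π (P.Av F x) = hbar x := by
    intro x
    unfold AffAct.PU.Av
    have := P.map_sum I.S.crys.proper x (S.π : V →ₗ[ℝ] Q)
      (fun g => A.act g⁻¹ (F (A.act g x)))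
    simp only [ContinuousLinearMap.coe_coe] at this
    rw [this]
    have e : ∀ g, S.π (A.act g⁻¹ (F (A.act g x))) = hbar x := by
      intro g
      rw [← S.act, hσ, hbare, C.act_inv_act]
    simp only [e]
    exact P.sum_const I.S.crys.proper x _
  have hAvd : DifferentiableAt ℝ (P.Av F) x :=
    (P.Av_contDiff I.S.crys.proper F hF).differentiable (by norm_num) x
  have hGd : HasFDerivAt Gm (fderiv ℝ Gm (f x)) (f x) :=
    ((hGc x).differentiableAt (by norm_num)).hasFDerivAt
  have hfd : HasFDerivAt f (fderiv ℝ f x) x := (hf.differentiable (by norm_num) x).hasFDerivAt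
  set D := fderiv ℝ Gm (f x) with hD
  have hd1 : HasFDerivAt hbar (S.π.comp (fderiv ℝ (P.Av F) x)) x := by
    have : hbar = fun x => S.π (P.Av F x) := funext fun y => (hπh y).symm
    rw [this]
    exact S.π.hasFDerivAt.comp x hAvd.hasFDerivAt
  have hd2 : HasFDerivAt hbar (D.comp (fderiv ℝ f x)) x := hGd.comp x hfd
  have hdd := hd1.unique hd2
  have hsurj : ∀ y, ∃ v, D (fderiv ℝ f x v) = y := by
    intro y
    obtain ⟨z, hz⟩ := S.surj y
    obtain ⟨v, hv⟩ := hx z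
    refine ⟨v, ?_⟩
    have := congrArg (fun T : V →L[ℝ] Q => T v) hdd
    simp only [ContinuousLinearMap.comp_apply, hv, hz] at this
    exact this.symm
  have hrange : ∀ v, fderiv ℝ f x v ∈ E0 := by
    obtain ⟨pr, hpr⟩ := AffAct.exists_proj E0
    intro v
    rw [← hpr]
    have h1 : HasFDerivAt (fun x => pr (f x)) (pr.comp (fderiv ℝ f x)) x :=
      pr.hasFDerivAt.comp x hfd
    have h2 : (fun x => pr (f x)) = fun _ => 0 := funext fun y => (hpr _).2 (hE0 y)
    rw [h2] at h1
    have := h1.unique (hasFDerivAt_const (0:V) x)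
    exact congrArg (fun T : V →L[ℝ] V => T v) this
  obtain ⟨Z, hZE, hZf, hlt⟩ := hZ x
  have hker : ∀ z ∈ Z, D z = 0 := by
    intro z hz
    obtain ⟨c, hc⟩ := hZf z hz
    have hl : HasDerivAt (fun t : ℝ => f x + t • z) z 0 := by
      have := ((hasDerivAt_id (0:ℝ)).smul_const z).const_add (f x)
      simpa using this
    have h1 : HasDerivAt (fun t : ℝ => Gm (f x + t • z)) (D z) 0 := by
      have hG' : HasFDerivAt Gm D (f x + (0:ℝ) • z) := by simpa using hGd
      exact hG'.comp_hasDerivAt (0:ℝ) hl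
    have h2 : HasDerivAt (fun t : ℝ => Gm (f x + t • z)) 0 0 := by
      refine (hasDerivAt_const (0:ℝ) (Gm (f x))).congr_of_eventuallyEq ?_
      have hcont : Continuous fun t : ℝ => 1 + (t : ℂ) * c := by fun_prop
      have : ∀ᶠ t : ℝ in 𝓝 0, 1 + (t : ℂ) * c ≠ 0 :=
        hcont.continuousAt.eventually_ne (by simp)
      filter_upwards [this] with t ht
      have e : f x + t • z = (1 + (t : ℂ) * c) • f x := by
        rw [add_smul, one_smul, mul_smul, ← hc]
        congr 1
      rw [e, hGs _ _ ht]
    exact h1.unique h2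
  let D0 : E0 →ₗ[ℝ] Q := (D : V →ₗ[ℝ] Q).comp E0.subtype
  have hD0 : Function.Surjective D0 := by
    intro y
    obtain ⟨v, hv⟩ := hsurj y
    exact ⟨⟨_, hrange v⟩, hv⟩
  have hrn := LinearMap.finrank_range_add_finrank_ker D0
  rw [LinearMap.range_eq_top.2 hD0, finrank_top] at hrn
  have hle : Module.finrank ℝ (Z.comap E0.subtype) ≤ Module.finrank ℝ (LinearMap.ker D0) :=
    Submodule.finrank_mono fun z hz => hker _ hz
  rw [(Submodule.comapSubtypeEquivOfLe hZE).finrank_eq] at hle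
  omega

end HLC
end

noncomputable section
namespace HLC
open Filter Topology
set_option linter.unusedSectionVars false
open scoped ComplexConjugate

theorem AffAct.lin_unip {G E : Type*} [Group G] [NormedAddCommGroup E] [NormedSpace ℝ E]
    [FiniteDimensional ℝ E] (A : AffAct G E) (hno : A.NoInv) (hdisc : A.Disc) :
    ∃ c > (0:ℝ), ∃ N : ℕ, ∀ g, ‖A.L g - 1‖ < c → (A.L g - 1) ^ N = 0 := by
  let sc : ℝ → ((E × ℝ) →L[ℝ] (E × ℝ)) := fun r =>
    (r • ContinuousLinearMap.id ℝ E).prodMap (ContinuousLinearMap.id ℝ ℝ)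
  have hsc : ∀ r z, sc r z = (r • z.1, z.2) := fun r z => rfl
  have hDD : ∀ k : ℕ, sc ((2⁻¹:ℝ)^k) * sc ((2:ℝ)^k) = 1 := by
    intro k; ext z <;> simp [hsc]
  have hDD' : ∀ k : ℕ, sc ((2:ℝ)^k) * sc ((2⁻¹:ℝ)^k) = 1 := by
    intro k; ext z <;> simp [hsc]
  have hlim : ∀ g, Tendsto (fun k : ℕ => sc ((2⁻¹:ℝ)^k) * A.hat g * sc ((2:ℝ)^k)) atTop
      (𝓝 (AffAct.dhat (A.L g))) := by
    intro g
    let T : (E × ℝ) →L[ℝ] (E × ℝ) := ((ContinuousLinearMap.snd ℝ E ℝ).smulRight (A.u g)).prod 0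
    have h1 : ∀ k : ℕ, sc ((2⁻¹:ℝ)^k) * A.hat g * sc ((2:ℝ)^k) =
        AffAct.dhat (A.L g) + ((2⁻¹:ℝ)^k) • T := by
      intro k; ext z <;> simp [hsc, T, AffAct.dhat]
    simp_rw [h1]
    have h2 : Tendsto (fun k : ℕ => ((2⁻¹:ℝ)^k) • T) atTop (𝓝 ((0:ℝ) • T)) :=
      (tendsto_pow_atTop_nhds_zero_of_lt_one (by norm_num) (by norm_num)).smul_const T
    have h3 := (tendsto_const_nhds (x := AffAct.dhat (A.L g))).add h2
    simpa using h3
  obtain ⟨c0, hc0, hF0⟩ := A.Rprime hno hdisc A.L (fun k => sc ((2⁻¹:ℝ)^k))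
    (fun k => sc ((2:ℝ)^k)) hDD hDD' hlim
  exact ⟨c0, hc0, _, fun g hg => A.Rprime_pow A.L (fun k => sc ((2⁻¹:ℝ)^k))
    (fun k => sc ((2:ℝ)^k)) hDD hDD' hlim c0 _ hF0 g hg⟩

theorem AffAct.disc_of_finite {G E : Type*} [Group G] [NormedAddCommGroup E] [NormedSpace ℝ E]
    (A : AffAct G E) (h : (A.hat '' {g | ‖A.u g‖ ≤ 1}).Finite) : A.Disc := by
  have hfin2 : (A.hat '' {g : G | ‖A.hat g - 1‖ < 1 ∧ A.hat g ≠ 1}).Finite := by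
    refine h.subset (Set.image_mono ?_)
    rintro g ⟨hg, -⟩
    have h1 : (A.hat g - 1) (0, 1) = (A.u g, 0) := by simp
    have h2 := (A.hat g - 1).le_opNorm (0, 1)
    rw [h1] at h2
    have h3 : ‖((0 : E), (1 : ℝ))‖ = 1 := by simp [Prod.norm_def]
    have h4 : ‖A.u g‖ ≤ ‖(A.u g, (0:ℝ))‖ := by simp [Prod.norm_def]
    rw [h3] at h2
    change ‖A.u g‖ ≤ 1
    linarith
  obtain ⟨δ, hδ, hmin⟩ : ∃ δ > 0, ∀ g ∈ {g : G | ‖A.hat g - 1‖ < 1 ∧ A.hat g ≠ 1},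
      δ ≤ ‖A.hat g - 1‖ := by
    rcases Set.eq_empty_or_nonempty {g : G | ‖A.hat g - 1‖ < 1 ∧ A.hat g ≠ 1} with he | hne
    · exact ⟨1, one_pos, by rw [he]; simp⟩
    · obtain ⟨_, ⟨g, hg, rfl⟩, hm⟩ := Set.exists_min_image _ (fun T => ‖T - 1‖) hfin2
        (hne.image A.hat)
      exact ⟨‖A.hat g - 1‖, norm_pos_iff.2 (sub_ne_zero.2 hg.2), fun g' hg' => hm _ ⟨g', hg', rfl⟩⟩
  refine ⟨min δ 1, lt_min hδ one_pos, fun g hg => ?_⟩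
  by_contra hne
  have := hmin g ⟨hg.trans_le (min_le_right _ _), hne⟩
  exact absurd (hg.trans_le (min_le_left _ _)) (not_lt.2 this)

variable {G V : Type*} [Group G] [NormedAddCommGroup V] [NormedSpace ℂ V] [FiniteDimensional ℂ V]
  {B : Herm V} {A : AffAct G V} {E : Submodule ℂ V} {o : V}

theorem Irr.o_ne (I : Irr B A E o) : o ≠ 0 := Herm.Avop.ne_zero_of_neg I.qo

/-- Schur lemma -/
theorem Irr.schur (I : Irr B A E o) (K : Subgroup G) [K.FiniteIndex] (T : V →ₗ[ℂ] V)
    (hT : ∀ x ∈ E, T x ∈ E) (hc : ∀ g ∈ K, ∀ x ∈ E, T (A.L g x) = A.L g (T x)) :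
    ∃ μ : ℂ, ∀ x ∈ E, T x = μ • x := by
  have : Nontrivial E := ⟨⟨⟨o, I.oE⟩, 0, fun h => I.o_ne (congrArg Subtype.val h)⟩⟩
  obtain ⟨μ, hμ⟩ := Module.End.exists_eigenvalue (T.restrict hT)
  obtain ⟨x, hx⟩ := hμ.exists_hasEigenvector
  have hx1 : T x = μ • (x : V) := congrArg Subtype.val hx.apply_eq_smul
  have hx0 : (x : V) ≠ 0 := fun h => hx.2 (Subtype.ext h)
  refine ⟨μ, ?_⟩
  let Z : Submodule ℂ V :=
    { carrier := {x | x ∈ E ∧ T x = μ • x}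
      add_mem' := by
        rintro a b ⟨ha, ha'⟩ ⟨hb, hb'⟩
        exact ⟨E.add_mem ha hb, by rw [map_add, ha', hb', smul_add]⟩
      zero_mem' := ⟨E.zero_mem, by simp⟩
      smul_mem' := by
        rintro c a ⟨ha, ha'⟩
        exact ⟨E.smul_mem c ha, by rw [map_smul, ha', smul_comm]⟩ }
  rcases I.irr K inferInstance Z (fun x hx => hx.1) (by
    rintro g hg y ⟨hy, hy'⟩
    exact ⟨I.inv g y hy, by rw [hc g hg y hy, hy', I.S.smul]⟩) with h | h
  · exfalso
    have : (x : V) ∈ Z := ⟨x.2, hx1⟩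
    rw [h] at this
    exact hx0 ((Submodule.mem_bot ℂ).1 this)
  · intro y hy
    rw [← h] at hy
    exact hy.2

theorem Irr.caseC (I : Irr B A E o) (hE : ∀ x ∈ E, x ∈ A.W) : False := by
  have : FiniteDimensional ℝ V := Setup.finReal
  obtain ⟨C, Bq, S, h0, hc, hfr, hprop⟩ := A.exists_tquot I.S.crys.proper
  have hker : ∀ g g', A.L g = A.L g' → Bq.hat g = Bq.hat g' := by
    intro g g' h
    have ht : A.L (g⁻¹ * g') = 1 := by rw [map_mul, ← h, ← map_mul]; simp
    have hu : Bq.u (g⁻¹ * g') = 0 := by rw [S.u, h0]; exact A.u_mem_W ht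
    have hL : Bq.L (g⁻¹ * g') = 1 := by
      ext1 x
      obtain ⟨y, rfl⟩ := S.surj x
      rw [S.L, ht]; rfl
    have e : Bq.hat (g⁻¹ * g') = 1 := by
      rw [Bq.hat_eq_one_iff]
      intro x
      rw [AffAct.act_def, hu, hL]; simp
    have : g' = g * (g⁻¹ * g') := by group
    rw [this, map_mul, e, mul_one]
  have hdisc : Bq.Disc := by
    apply AffAct.disc_of_finite
    have h1 := hprop 1
    choose r hr using fun T : V →L[ℝ] V => (Classical.em (∃ g, A.L g = T))
      |>.elim (fun ⟨g, hg⟩ => (⟨g, fun _ => hg⟩ : ∃ g, (∃ g, A.L g = T) → A.L g = T))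
        (fun h => ⟨1, fun h' => absurd h' h⟩)
    refine (h1.image (fun T => Bq.hat (r T))).subset ?_
    rintro _ ⟨g, hg, rfl⟩
    refine ⟨A.L g, ⟨g, ⟨0, by simp, by rw [AffAct.act_zero]; exact hg⟩, rfl⟩, ?_⟩
    exact hker _ _ (hr (A.L g) ⟨g, rfl⟩)
  obtain ⟨c, hcpos, N, hN⟩ := Bq.lin_unip (S.noInv I.S.crys.noInv) hdisc
  -- bounded linear part
  obtain ⟨M, hM⟩ : ∃ M, ∀ g, ‖Bq.L g‖ ≤ M := by
    apply banach_steinhaus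
    intro y
    obtain ⟨x, rfl⟩ := S.surj y
    obtain ⟨s, hs, hxs⟩ := B.exists_orth_decomp E (fun x hx hxo => I.E_nondeg hx hxo) x
    obtain ⟨m, hm, hN⟩ := B.exists_N_lower I.qo
    refine ⟨‖S.π‖ * Real.sqrt (B.q (x - s) / m), fun g => ?_⟩
    have e : S.π x = S.π (x - s) := by
      rw [map_sub, (h0 s).2 (hE s hs), sub_zero]
    rw [e, S.L]
    refine (S.π.le_opNorm _).trans ?_
    gcongr
    apply Real.le_sqrt_of_sq_le
    rw [le_div_iff₀ hm]
    have h1 := hN (A.L g (x - s))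
    have h2 : B.h o (A.L g (x - s)) = 0 := I.S.orth_inv I.inv g hxs o I.oE
    unfold Herm.N at h1
    rw [h2, I.S.q_L] at h1
    rw [norm_zero, mul_comm] at h1
    simpa using h1
  have hfinL : (Set.range Bq.L).Finite := by
    rw [← Set.image_univ]
    refine finite_image Bq.L c hcpos ?_ M Set.univ (fun g _ => ⟨hM g, hM _⟩)
    intro g hg
    refine bounded_unipotent _ N (hN g hg) M fun j => ?_
    rw [← map_pow]; exact hM _
  let G1 : Subgroup G := Bq.L.ker
  have hG1 : ∀ g ∈ G1, Bq.L g = 1 := fun g hg => hg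
  have : G1.FiniteIndex := by
    apply fi_of_finite_range G1 Bq.L hfinL
    intro b b' h
    change Bq.L _ = 1
    rw [map_mul, ← h, ← map_mul]; simp
  refine I.infinite_of_bd G1 |B.q o| ?_
  intro a ha
  let Ca : Subgroup G :=
    { carrier := {g | A.L g * A.L a = A.L a * A.L g}
      mul_mem' := by
        intro g h hg hh
        have hg : A.L g * A.L a = A.L a * A.L g := hg
        have hh : A.L h * A.L a = A.L a * A.L h := hh
        change A.L (g * h) * A.L a = A.L a * A.L (g * h)
        rw [map_mul, mul_assoc, hh, ← mul_assoc, hg, mul_assoc]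
      one_mem' := by simp
      inv_mem' := by
        intro g hg
        have hg : A.L g * A.L a = A.L a * A.L g := hg
        change A.L g⁻¹ * A.L a = A.L a * A.L g⁻¹
        have h1 : A.L g⁻¹ * A.L g = 1 := by rw [← map_mul]; simp
        have h2 : A.L g * A.L g⁻¹ = 1 := by rw [← map_mul]; simp
        calc A.L g⁻¹ * A.L a = A.L g⁻¹ * (A.L a * A.L g) * A.L g⁻¹ := by
              rw [mul_assoc, mul_assoc, h2, mul_one]
          _ = A.L a * A.L g⁻¹ := by rw [← hg, ← mul_assoc, h1, one_mul] }
  have hCa : ∀ g ∈ Ca, A.L g * A.L a = A.L a * A.L g := fun g hg => hg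
  have : Ca.FiniteIndex := by
    apply fi_of_finite_range Ca (fun b => A.L (b * a * b⁻¹ * a⁻¹))
    · refine (hprop (M * ‖Bq.u a‖ + ‖Bq.u a‖)).subset ?_
      rintro _ ⟨b, rfl⟩
      have hMnn : 0 ≤ M := (norm_nonneg _).trans (hM 1)
      refine ⟨_, ⟨0, by simp; positivity, ?_⟩, rfl⟩
      have h1 : Bq.L a = 1 := hG1 a ha
      have hinv : Bq.act a⁻¹ 0 = - Bq.u a := by
        have := Bq.act_act_inv a 0
        rw [AffAct.act_def, h1] at this
        simp only [one_apply_eq_self] at this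
        exact eq_neg_of_add_eq_zero_left this
      have h2 : Bq.act (b * a * b⁻¹ * a⁻¹) 0 = Bq.L b (Bq.u a) - Bq.u a := by
        rw [AffAct.act_mul, AffAct.act_mul, AffAct.act_mul, AffAct.act_def _ a, h1, hinv,
          AffAct.act_def _ b]
        simp only [one_apply_eq_self, map_add]
        have := Bq.act_act_inv b (-Bq.u a)
        rw [AffAct.act_def] at this
        rw [add_right_comm, this]; abel
      rw [h2]
      refine (norm_sub_le _ _).trans (add_le_add ((Bq.L b).le_opNorm _ |>.trans ?_) le_rfl)
      gcongr
      exact hM b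
    · intro b b' h
      have h : A.L (b * a * b⁻¹ * a⁻¹) = A.L (b' * a * b'⁻¹ * a⁻¹) := h
      change A.L (b⁻¹ * b') * A.L a = A.L a * A.L (b⁻¹ * b')
      have e1 : b⁻¹ * (b' * a * b'⁻¹ * a⁻¹) * (a * b') = b⁻¹ * b' * a := by group
      have e2 : b⁻¹ * (b * a * b⁻¹ * a⁻¹) * (a * b') = a * (b⁻¹ * b') := by group
      rw [← map_mul, ← map_mul, ← e1, ← e2, map_mul, map_mul A.L b⁻¹, ← h, ← map_mul, ← map_mul]
  obtain ⟨μ, hμ⟩ := I.schur Ca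
    { toFun := A.L a, map_add' := map_add _, map_smul' := I.S.smul a } (I.inv a) (by
      intro g hg x _
      have := congrArg (fun T : V →L[ℝ] V => T x) (hCa g hg)
      exact this.symm)
  have h1 : A.L a o = μ • o := hμ o I.oE
  have h2 := I.S.q_L a o
  rw [h1, B.q_smul] at h2
  have h3 : ‖μ‖ ^ 2 = 1 := mul_right_cancel₀ I.qo.ne (by rw [h2, one_mul])
  have h4 : ‖μ‖ = 1 := by
    have := norm_nonneg μ
    nlinarith
  rw [h1, map_smul, norm_smul, h4, one_mul, B.h_self, Complex.norm_real, Real.norm_eq_abs]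

end HLC
end

noncomputable section
namespace HLC
open Filter Topology
set_option linter.unusedSectionVars false
open scoped ComplexConjugate

theorem sl2_commute {a b c d p q r s : ℝ} (hg : a * d - b * c = 1) (ht : |a + d| < 2)
    (hM : 0 ≤ (a*p+b*r - (p*a+q*c)) * (c*q+d*s - (r*b+s*d))
      - (a*q+b*s - (p*b+q*d)) * (c*p+d*r - (r*a+s*c))) :
    b * r = q * c ∧ (a - d) * q = b * (p - s) ∧ c * (p - s) = r * (a - d) := by
  have h1 : (a - d)^2 + 4 * (b * c) < 0 := by
    have := sq_lt_sq' (abs_lt.1 ht).1 (abs_lt.1 ht).2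
    nlinarith
  have hbc : b * c < 0 := by nlinarith [sq_nonneg (a - d)]
  obtain ⟨x, hx⟩ : ∃ x, x = b * r - q * c := ⟨_, rfl⟩
  obtain ⟨y, hy⟩ : ∃ y, y = a*q+b*s - (p*b+q*d) := ⟨_, rfl⟩
  obtain ⟨z, hz⟩ : ∃ z, z = c*p+d*r - (r*a+s*c) := ⟨_, rfl⟩
  have hM' : 0 ≤ -x^2 - y*z := by
    rw [hx, hy, hz]; linarith
  have htr : x * (a - d) + y * c + z * b = 0 := by rw [hx, hy, hz]; ring
  have hx0 : x = 0 := by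
    by_contra hne
    have hpos : 0 < x^2 := by positivity
    have e1 : (x * (a - d))^2 = (y * c - z * b)^2 + 4 * (b * c) * (y * z) := by
      have : x * (a - d) = -(y * c + z * b) := by linarith
      rw [this]; ring
    have e2 : 4 * (b * c) * (-x^2) ≤ 4 * (b * c) * (y * z) :=
      mul_le_mul_of_nonpos_left (by linarith) (by linarith)
    have e3 := mul_neg_of_pos_of_neg hpos h1
    nlinarith [sq_nonneg (y * c - z * b)]
  rw [hx0] at hM' htr
  have hyz : z = 0 := by
    have e1 : y * c = - (z * b) := by linarith
    have e2 : y * z * (b * c) = - (z * b) ^ 2 := by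
      calc y * z * (b * c) = (y * c) * (z * b) := by ring
        _ = _ := by rw [e1]; ring
    have e3 : 0 ≤ y * z * (b * c) := mul_nonneg_of_nonpos_of_nonpos (by linarith) hbc.le
    have e4 : (z * b)^2 = 0 := by nlinarith [sq_nonneg (z * b)]
    have e5 : z * b = 0 := by simpa using e4
    rcases mul_eq_zero.1 e5 with h | h
    · exact h
    · rw [h] at hbc; simp at hbc
  have hy0 : y = 0 := by
    rw [hyz] at htr
    have : y * c = 0 := by linarith
    rcases mul_eq_zero.1 this with h | h
    · exact h
    · rw [h] at hbc; simp at hbc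
  refine ⟨by linarith, by linarith, by linarith⟩

theorem sl2_bound {a b c d : ℝ} (hg : a * d - b * c = 1) (ht : |a + d| < 2) :
    ∃ C, ∀ p q r s : ℝ, p * s - q * r = 1 → |p + s| ≤ 2 →
      b * r = q * c → (a - d) * q = b * (p - s) → c * (p - s) = r * (a - d) →
      |p| ≤ C ∧ |q| ≤ C ∧ |r| ≤ C ∧ |s| ≤ C := by
  have h1 : (a - d)^2 + 4 * (b * c) < 0 := by
    have := sq_lt_sq' (abs_lt.1 ht).1 (abs_lt.1 ht).2
    nlinarith
  have hbc : b * c < 0 := by nlinarith [sq_nonneg (a - d)]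
  have hb : b ≠ 0 := by rintro rfl; simp at hbc
  obtain ⟨D, hD⟩ : ∃ D, D = -((a - d)^2 + 4 * (b * c)) := ⟨_, rfl⟩
  have hDpos : 0 < D := by rw [hD]; linarith
  obtain ⟨K, hK⟩ : ∃ K, K = Real.sqrt (4 / D) := ⟨_, rfl⟩
  have hK0 : 0 ≤ K := by rw [hK]; positivity
  refine ⟨1 + K * (|a| + |b| + |c| + |d|), ?_⟩
  intro p q r s hdet htr e1 e2 e3
  obtain ⟨β, hβ⟩ : ∃ β, q = β * b := ⟨q / b, by field_simp⟩
  have hr : r = β * c := by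
    apply mul_left_cancel₀ hb; rw [e1, hβ]; ring
  have hps : p - s = β * (a - d) := by
    apply mul_left_cancel₀ hb; rw [← e2, hβ]; ring
  have hβb : |β| ≤ K := by
    rw [hK]
    apply Real.le_sqrt_of_sq_le
    rw [sq_abs, le_div_iff₀ hDpos]
    have : (p + s)^2 + β^2 * D = 4 := by
      have : (p+s)^2 = (p - s)^2 + 4 * (p * s) := by ring
      rw [this, hps, hD]
      have : p * s = 1 + q * r := by linarith
      rw [this, hβ, hr]; ring
    nlinarith [sq_nonneg (p + s)]
  have hb1 : ∀ t : ℝ, |β * t| ≤ K * |t| := fun t => by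
    rw [abs_mul]; exact mul_le_mul_of_nonneg_right hβb (abs_nonneg _)
  have ka := hb1 a
  have kb := hb1 b
  have kc := hb1 c
  have kd := hb1 d
  rw [← hβ] at kb
  rw [← hr] at kc
  have na := mul_nonneg hK0 (abs_nonneg a)
  have nb := mul_nonneg hK0 (abs_nonneg b)
  have nc := mul_nonneg hK0 (abs_nonneg c)
  have nd := mul_nonneg hK0 (abs_nonneg d)
  have hps' : p - s = β * a - β * d := by rw [hps]; ring
  have := abs_le.1 ka
  have := abs_le.1 kd
  have := abs_le.1 htr
  refine ⟨abs_le.2 ⟨?_, ?_⟩, ?_, ?_, abs_le.2 ⟨?_, ?_⟩⟩ <;> linarith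

theorem sl2 {G : Type*} [Group G] (ρ : G →* Matrix (Fin 2) (Fin 2) ℝ) (hdet : ∀ g, (ρ g).det = 1)
    (htr : ∀ g, |(ρ g).trace| ≤ 2) :
    (∃ v : Fin 2 → ℝ, v ≠ 0 ∧ ∀ g, ∃ c : ℝ, ρ g *ᵥ v = c • v) ∨
      ∃ C, ∀ g i j, |ρ g i j| ≤ C := by
  by_cases hpar : ∃ g, |(ρ g).trace| = 2 ∧ ρ g ≠ 1 ∧ ρ g ≠ -1
  · left
    obtain ⟨g, hg2, hg1, hgm⟩ := hpar
    obtain ⟨ε, hε, hεt⟩ : ∃ ε : ℝ, ε * ε = 1 ∧ (ρ g).trace = 2 * ε := by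
      rcases abs_eq (by norm_num : (0:ℝ) ≤ 2) |>.1 hg2 with h | h
      · exact ⟨1, by norm_num, by rw [h]; norm_num⟩
      · exact ⟨-1, by norm_num, by rw [h]; norm_num⟩
    set n : Matrix (Fin 2) (Fin 2) ℝ := ρ (g * g) - 1 with hn
    have hd := hdet g
    rw [Matrix.det_fin_two] at hd
    rw [Matrix.trace_fin_two] at hεt
    have hnn : n = (2 * ε) • (ρ g - ε • 1) := by
      rw [hn, map_mul]
      ext i j
      fin_cases i <;> fin_cases j <;> simp [Matrix.mul_apply, Fin.sum_univ_two]
      · linear_combination -1 * hd + ρ g 0 0 * hεt + 2 * hε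
      · linear_combination ρ g 0 1 * hεt
      · linear_combination ρ g 1 0 * hεt
      · linear_combination -1 * hd + ρ g 1 1 * hεt + 2 * hε
    have hn2 : n * n = 0 := by
      rw [hnn]
      ext i j
      fin_cases i <;> fin_cases j <;> simp [Matrix.mul_apply, Fin.sum_univ_two]
      · linear_combination (4 * ε ^ 2) * (-1 * hd + ρ g 0 0 * hεt + hε)
      · linear_combination (4 * ε ^ 2) * ρ g 0 1 * hεt
      · linear_combination (4 * ε ^ 2) * ρ g 1 0 * hεt
      · linear_combination (4 * ε ^ 2) * (-1 * hd + ρ g 1 1 * hεt + hε)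
    have hn0 : n ≠ 0 := by
      intro h
      rw [hnn] at h
      have hε0 : ε ≠ 0 := by rintro rfl; simp at hε
      have h2 : ρ g - ε • 1 = 0 := (smul_eq_zero.1 h).resolve_left (by simpa using hε0)
      have h3 : ρ g = ε • 1 := sub_eq_zero.1 h2
      rcases mul_self_eq_one_iff.1 hε with h | h
      · exact hg1 (by rw [h3, h, one_smul])
      · exact hgm (by rw [h3, h]; simp)
    have hpow : ∀ k : ℕ, ρ ((g * g) ^ k) = 1 + (k : ℝ) • n := by
      intro k
      induction k with
      | zero => simp
      | succ k ih =>
        have e : ρ (g * g) = 1 + n := by rw [hn]; abel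
        rw [pow_succ, map_mul, ih, e, add_mul, mul_add, mul_add, Matrix.smul_mul, Matrix.smul_mul, hn2]
        push_cast
        rw [add_smul]; simp; abel
    have htn : ∀ h, (n * ρ h).trace = 0 := by
      intro h
      by_contra hne
      obtain ⟨k, hk⟩ := exists_nat_gt (4 / |(n * ρ h).trace|)
      rw [div_lt_iff₀ (abs_pos.2 hne)] at hk
      have h1 := htr ((g * g) ^ k * h)
      rw [map_mul, hpow, add_mul, one_mul, Matrix.smul_mul, Matrix.trace_add, Matrix.trace_smul] at h1
      have h2 := htr h
      have h3 : |(k : ℝ) • (n * ρ h).trace| ≤ 4 := by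
        have := abs_sub ((ρ h).trace + (k : ℝ) • (n * ρ h).trace) ((ρ h).trace)
        rw [add_sub_cancel_left] at this
        linarith
      rw [smul_eq_mul, abs_mul, Nat.abs_cast] at h3
      linarith
    have htn1 : n.trace = 0 := by have := htn 1; rwa [map_one, mul_one] at this
    rw [Matrix.trace_fin_two] at htn1
    have hn11 : n 1 1 = - n 0 0 := by linarith
    have hq : n 0 0 * n 0 0 + n 0 1 * n 1 0 = 0 := by
      have := congrFun (congrFun hn2 0) 0
      simpa [Matrix.mul_apply, Fin.sum_univ_two] using this
    have key : ∀ h, n 0 0 * ρ h 0 0 + n 0 1 * ρ h 1 0 + n 1 0 * ρ h 0 1 - n 0 0 * ρ h 1 1 = 0 := by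
      intro h
      have := htn h
      rw [Matrix.trace_fin_two] at this
      simp only [Matrix.mul_apply, Fin.sum_univ_two, hn11] at this
      linarith
    clear_value n
    by_cases hr : n 1 0 = 0
    · have hp : n 0 0 = 0 := by rw [hr] at hq; simpa using hq
      have hq0 : n 0 1 ≠ 0 := by
        intro h
        apply hn0
        ext i j
        fin_cases i <;> fin_cases j <;> simp [hr, hp, h, hn11]
      refine ⟨![1, 0], fun h => by simpa using congrFun h 0, fun h => ⟨ρ h 0 0, ?_⟩⟩
      have := key h
      rw [hr, hp] at this
      have h10 : ρ h 1 0 = 0 := by simpa [hq0] using this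
      ext i
      fin_cases i <;> simp [Matrix.mulVec, dotProduct, Fin.sum_univ_two, h10]
    · refine ⟨![n 0 0, n 1 0], fun h => hr (by simpa using congrFun h 1), 
        fun h => ⟨(ρ h 1 0 * n 0 0 + ρ h 1 1 * n 1 0) / n 1 0, ?_⟩⟩
      have := key h
      ext i
      fin_cases i
      · simp only [Matrix.mulVec, dotProduct, Fin.sum_univ_two]
        simp
        field_simp
        linear_combination n 1 0 * key h - ρ h 1 0 * hq
      · simp [Matrix.mulVec, dotProduct, Fin.sum_univ_two]
        field_simp
  push Not at hpar
  right
  by_cases hall : ∀ g, ρ g = 1 ∨ ρ g = -1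
  · refine ⟨1, fun g i j => ?_⟩
    rcases hall g with h | h <;> rw [h] <;> fin_cases i <;> fin_cases j <;> simp
  push Not at hall
  obtain ⟨g, hg1, hgm⟩ := hall
  have hlt : |(ρ g).trace| < 2 := by
    refine lt_of_le_of_ne (htr g) fun h => hgm (hpar g h hg1)
  have hd := hdet g
  rw [Matrix.det_fin_two] at hd
  rw [Matrix.trace_fin_two] at hlt
  obtain ⟨C, hC⟩ := sl2_bound hd hlt
  refine ⟨C, fun h => ?_⟩
  have hdh := hdet h
  rw [Matrix.det_fin_two] at hdh
  have hth := htr h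
  rw [Matrix.trace_fin_two] at hth
  have hM : 0 ≤ (ρ g * ρ h - ρ h * ρ g).det := by
    have e : ρ g * ρ h - ρ h * ρ g = (ρ (g * h * (h * g)⁻¹) - 1) * ρ (h * g) := by
      rw [sub_mul, one_mul, ← map_mul, ← map_mul, ← map_mul, inv_mul_cancel_right]
    rw [e, Matrix.det_mul, hdet, mul_one]
    have h1 := hdet (g * h * (h * g)⁻¹)
    have h2 := htr (g * h * (h * g)⁻¹)
    rw [Matrix.det_fin_two] at h1 ⊢
    rw [Matrix.trace_fin_two] at h2
    generalize ρ (g * h * (h * g)⁻¹) = κ at *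
    simp
    have := (abs_le.1 h2).2
    nlinarith
  rw [Matrix.det_fin_two] at hM
  simp only [Matrix.sub_apply, Matrix.mul_apply, Fin.sum_univ_two] at hM
  obtain ⟨c1, c2, c3⟩ := sl2_commute (p := ρ h 0 0) (q := ρ h 0 1) (r := ρ h 1 0) (s := ρ h 1 1)
    hd hlt hM
  obtain ⟨b1, b2, b3, b4⟩ := hC _ _ _ _ hdh hth c1 c2 c3
  intro i j
  fin_cases i <;> fin_cases j
  · exact b1
  · exact b2
  · exact b3
  · exact b4

end HLC
end

noncomputable section
namespace HLC
open Filter Topology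
set_option linter.unusedSectionVars false
open scoped ComplexConjugate

variable {G V : Type*} [Group G] [NormedAddCommGroup V] [NormedSpace ℂ V] [FiniteDimensional ℂ V]
  {B : Herm V} {A : AffAct G V} {E : Submodule ℂ V} {o : V}

theorem real_smul_c (c : ℝ) (x : V) : c • x = (c : ℂ) • x :=
  RCLike.real_smul_eq_coe_smul (K := ℂ) c x

theorem Irr.E_sep (I : Irr B A E o) (z z' : E)
    (h : ∀ y : E, (B.h (z : V) y).re = (B.h (z' : V) y).re) : z = z' := by
  have h1 : ∀ y ∈ E, B.h ((z : V) - z') y = 0 := by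
    intro y hy
    rw [map_sub, LinearMap.sub_apply]
    have h2 := h ⟨y, hy⟩
    have h3 := h ⟨Complex.I • y, E.smul_mem _ hy⟩
    apply Complex.ext
    · simpa [sub_eq_zero] using h2
    · simp at h3
      simp; linarith
  have h2 : (z : V) - z' = 0 := by
    apply I.E_nondeg (E.sub_mem z.2 z'.2)
    intro y hy
    exact B.h_eq_zero_symm (h1 y hy)
  exact Subtype.ext (sub_eq_zero.1 h2)

theorem Irr.E_rep (I : Irr B A E o) (φ : E →ₗ[ℝ] ℝ) :
    ∃ z : E, ∀ y : E, (B.h (z : V) y).re = φ y := by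
  have : FiniteDimensional ℝ V := Setup.finReal
  have : FiniteDimensional ℝ E := FiniteDimensional.trans ℝ ℂ E
  let Φ : E →ₗ[ℝ] Module.Dual ℝ E := LinearMap.mk₂ ℝ (fun x y => (B.h (x : V) y).re)
    (by intro a b c; simp) (by intro c a b; simp [real_smul_c, -Complex.coe_smul])
    (by intro a b c; simp) (by intro c a b; simp [real_smul_c, -Complex.coe_smul])
  have hΦ : Function.Injective Φ := by
    intro z z' hzz
    exact I.E_sep z z' fun y => congrArg (fun f => f y) hzz
  have hs : Function.Surjective Φ :=
    (LinearMap.injective_iff_surjective_of_finrank_eq_finrank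
      (Subspace.dual_finrank_eq (K := ℝ) (V := E)).symm).1 hΦ
  obtain ⟨z, hz⟩ := hs φ
  exact ⟨z, fun y => congrArg (fun f => f y) hz⟩

theorem Irr.real_or_imag (I : Irr B A E o) (Y : Submodule ℝ V) (hYE : ∀ y ∈ Y, y ∈ E)
    (hY : ∀ g, ∀ y ∈ Y, A.L g y ∈ Y) (h0 : ∀ y ∈ Y, Complex.I • y ∈ Y → y = 0)
    (hsp : ∀ x ∈ E, ∃ a ∈ Y, ∃ b ∈ Y, x = a + Complex.I • b) :
    (∀ a ∈ Y, ∀ b ∈ Y, (B.h a b).im = 0) ∨ (∀ a ∈ Y, ∀ b ∈ Y, (B.h a b).re = 0) := by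
  have hu : ∀ a ∈ Y, ∀ b ∈ Y, ∀ a' ∈ Y, ∀ b' ∈ Y, a + Complex.I • b = a' + Complex.I • b' →
      a = a' ∧ b = b' := by
    intro a ha b hb a' ha' b' hb' h
    have h1 : Complex.I • (b - b') = a' - a := by
      rw [smul_sub, sub_eq_sub_iff_add_eq_add, add_comm, h, add_comm]
    have h2 := h0 (b - b') (Y.sub_mem hb hb') (h1 ▸ Y.sub_mem ha' ha)
    rw [h2, smul_zero] at h1
    exact ⟨(sub_eq_zero.1 h1.symm).symm, sub_eq_zero.1 h2⟩
  obtain ⟨σ, hσ⟩ : ∃ σ : V → V, ∀ a ∈ Y, ∀ b ∈ Y, σ (a + Complex.I • b) = a - Complex.I • b := by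
    choose! α hα β hβ hαβ using hsp
    refine ⟨fun x => α x - Complex.I • β x, fun a ha b hb => ?_⟩
    have hE : a + Complex.I • b ∈ E := E.add_mem (hYE _ ha) (E.smul_mem _ (hYE _ hb))
    obtain ⟨h1, h2⟩ := hu _ (hα _ hE) _ (hβ _ hE) a ha b hb (hαβ _ hE).symm
    simp only [h1, h2]
  have hσE : ∀ x ∈ E, σ x ∈ E := by
    intro x hx
    obtain ⟨a, ha, b, hb, rfl⟩ := hsp x hx
    rw [hσ a ha b hb]
    exact E.sub_mem (hYE _ ha) (E.smul_mem _ (hYE _ hb))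
  have hσadd : ∀ x ∈ E, ∀ y ∈ E, σ (x + y) = σ x + σ y := by
    intro x hx y hy
    obtain ⟨a, ha, b, hb, rfl⟩ := hsp x hx
    obtain ⟨a', ha', b', hb', rfl⟩ := hsp y hy
    rw [hσ a ha b hb, hσ a' ha' b' hb', show a + Complex.I • b + (a' + Complex.I • b') =
      (a + a') + Complex.I • (b + b') by module, hσ _ (Y.add_mem ha ha') _ (Y.add_mem hb hb')]
    module
  have hσsmul : ∀ (c : ℂ), ∀ x ∈ E, σ (c • x) = conj c • σ x := by
    intro c x hx
    obtain ⟨a, ha, b, hb, rfl⟩ := hsp x hx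
    have e1 : c • (a + Complex.I • b) = (c.re • a - c.im • b) +
        Complex.I • (c.re • b + c.im • a) := by
      conv_lhs => rw [← Complex.re_add_im c]
      simp only [real_smul_c]
      match_scalars
      · ring
      · linear_combination (c.im : ℂ) * Complex.I_sq
    rw [e1, hσ _ (Y.sub_mem (Y.smul_mem _ ha) (Y.smul_mem _ hb)) _
      (Y.add_mem (Y.smul_mem _ hb) (Y.smul_mem _ ha)), hσ a ha b hb]
    have e2 : conj c = (c.re : ℂ) - c.im * Complex.I := by
      apply Complex.ext <;> simp
    rw [e2]
    simp only [real_smul_c]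
    match_scalars
    · ring
    · linear_combination (-c.im : ℂ) * Complex.I_sq
  have hσL : ∀ g, ∀ x ∈ E, σ (A.L g x) = A.L g (σ x) := by
    intro g x hx
    obtain ⟨a, ha, b, hb, rfl⟩ := hsp x hx
    rw [hσ a ha b hb, map_add, I.S.smul, hσ _ (hY g a ha) _ (hY g b hb), map_sub, I.S.smul]
  have hT : ∀ x : E, ∃ z : E, ∀ y : E, (B.h (z : V) y).re = (B.h (σ x) (σ y)).re := by
    intro x
    refine ⟨_, (I.E_rep
      { toFun := fun y : E => (B.h (σ x) (σ y)).re
        map_add' := ?_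
        map_smul' := ?_ }).choose_spec⟩
    · intro y y'
      simp [hσadd _ y.2 _ y'.2]
    · intro c y
      have : ((c • y : E) : V) = (c : ℂ) • (y : V) := real_smul_c c (y : V)
      rw [this, hσsmul _ _ y.2]
      simp
  choose T hT using hT
  let T1 : E →ₗ[ℂ] V :=
    { toFun := fun x => (T x : V)
      map_add' := by
        intro x y
        rw [← Submodule.coe_add]
        congr 1
        apply I.E_sep
        intro z
        rw [hT, Submodule.coe_add, Submodule.coe_add, hσadd _ x.2 _ y.2]
        simp [hT]
      map_smul' := by
        intro c x
        rw [RingHom.id_apply, ← Submodule.coe_smul]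
        congr 1
        apply I.E_sep
        intro z
        rw [hT, Submodule.coe_smul, Submodule.coe_smul, hσsmul _ _ x.2]
        have h1 := hT x (conj c • z)
        rw [Submodule.coe_smul, hσsmul _ _ z.2] at h1
        simpa using h1.symm }
  obtain ⟨T2, hT2⟩ := LinearMap.exists_extend T1
  have hT2' : ∀ x : E, T2 x = T x := fun x => congrArg (fun f => f x) hT2
  obtain ⟨μ, hμ⟩ := I.schur ⊤ T2 (by
      intro x hx
      rw [hT2' ⟨x, hx⟩]; exact (T _).2) (by
      intro g _ x hx
      have hgx := I.inv g x hx
      rw [hT2' ⟨x, hx⟩, hT2' ⟨_, hgx⟩]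
      have : T ⟨A.L g x, hgx⟩ = ⟨A.L g (T ⟨x, hx⟩), I.inv g _ (T ⟨x, hx⟩).2⟩ := by
        apply I.E_sep
        intro z
        rw [hT]
        simp only
        have h1 := hT ⟨x, hx⟩ ⟨A.L g⁻¹ z, I.inv _ _ z.2⟩
        simp only at h1
        rw [hσL _ _ z.2, ← I.S.inv g (σ x), A.L_L_inv, ← I.S.inv g (T ⟨x, hx⟩ : V), A.L_L_inv] at h1
        rw [hσL _ _ hx, h1]
      rw [this])
  have key : ∀ a ∈ Y, ∀ b ∈ Y, conj μ * B.h a b = conj (B.h a b) := by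
    intro a ha b hb
    have e0 : ∀ y : E, (B.h (μ • a) y).re = (B.h a (σ y)).re := by
      intro y
      have h1 := hT ⟨a, hYE a ha⟩ y
      rw [← hT2', hμ _ (hYE a ha)] at h1
      rw [h1]
      have := hσ a ha 0 Y.zero_mem
      simp at this
      rw [this]
    have e1 := e0 ⟨b, hYE b hb⟩
    have e2 := e0 ⟨Complex.I • b, E.smul_mem _ (hYE b hb)⟩
    have s1 := hσ b hb 0 Y.zero_mem
    have s2 := hσ 0 Y.zero_mem b hb
    simp only [smul_zero, add_zero, sub_zero, zero_add, zero_sub] at s1 s2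
    simp only [s1, s2] at e1 e2
    apply Complex.ext
    · simpa using e1
    · simp at e2
      simp; linarith
  by_cases hq : ∃ a ∈ Y, B.q a ≠ 0
  · left
    obtain ⟨a, ha, hqa⟩ := hq
    have h1 := key a ha a ha
    rw [B.h_self, Complex.conj_ofReal] at h1
    have hqc : (B.q a : ℂ) ≠ 0 := Complex.ofReal_ne_zero.2 hqa
    have h2 : conj μ = 1 := mul_right_cancel₀ hqc (by rw [h1, one_mul])
    intro x hx y hy
    have h3 := key x hx y hy
    rw [h2, one_mul] at h3
    exact Complex.conj_eq_iff_im.1 h3.symm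
  · right
    push Not at hq
    intro x hx y hy
    have := B.q_add x y
    rw [hq _ (Y.add_mem hx hy), hq _ hx, hq _ hy] at this
    linarith

end HLC
end

noncomputable section
namespace HLC
open Filter Topology
set_option linter.unusedSectionVars false
open scoped ComplexConjugate

variable {G V : Type*} [Group G] [NormedAddCommGroup V] [NormedSpace ℂ V] [FiniteDimensional ℂ V]
  {B : Herm V} {A : AffAct G V} {E : Submodule ℂ V} {o : V}

theorem Irr.dropE (I : Irr B A E o)
    {Q : Type*} [NormedAddCommGroup Q] [NormedSpace ℝ Q] [FiniteDimensional ℝ Q]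
    {C : AffAct G Q} (S : A.Semi C) (hS : ∀ t, A.L t = 1 → C.u t = 0)
    (h : Module.finrank ℝ (E.restrictScalars ℝ) < Module.finrank ℝ Q + 2) : False := by
  have : FiniteDimensional ℝ V := Setup.finReal
  obtain ⟨f, hf, hfq, hfe, hfE, -⟩ := I.S.exists_f I.qo
  have hfE' := hfE E I.oE I.inv
  refine I.drop S hS f hf hfq hfe (E.restrictScalars ℝ) hfE' fun x => ?_
  refine ⟨(Submodule.span ℂ {f x}).restrictScalars ℝ, ?_, ?_, ?_⟩
  · intro z hz
    exact (Submodule.span_singleton_le_iff_mem _ _).2 (hfE' x) hz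
  · intro z hz
    obtain ⟨c, hc⟩ := Submodule.mem_span_singleton.1 (show z ∈ Submodule.span ℂ {f x} from hz)
    exact ⟨c, hc.symm⟩
  · have h1 : Module.finrank ℂ (Submodule.span ℂ {f x}) = 1 :=
      finrank_span_singleton (Herm.Avop.ne_zero_of_neg (hfq x))
    have h2 : Module.finrank ℝ (Submodule.span ℂ {f x}) = 2 := by
      rw [← Module.finrank_mul_finrank ℝ ℂ, h1, Complex.finrank_real_complex]
    have h3 : Module.finrank ℝ ((Submodule.span ℂ {f x}).restrictScalars ℝ) = 2 := h2
    rw [h3]; exact h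

theorem Irr.dropY (I : Irr B A E o)
    {Q : Type*} [NormedAddCommGroup Q] [NormedSpace ℝ Q] [FiniteDimensional ℝ Q]
    {C : AffAct G Q} (S : A.Semi C) (hS : ∀ t, A.L t = 1 → C.u t = 0)
    (Y : Submodule ℝ V) (hYE : ∀ y ∈ Y, y ∈ E) (hY : ∀ g, ∀ y ∈ Y, A.L g y ∈ Y)
    (hr : ∀ a ∈ Y, ∀ b ∈ Y, (B.h a b).im = 0) (o' : V) (ho' : o' ∈ Y) (hqo : B.q o' < 0)
    (h : Module.finrank ℝ Y < Module.finrank ℝ Q + 1) : False := by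
  have : FiniteDimensional ℝ V := Setup.finReal
  have I' : Irr B A E o' := ⟨I.S, I.discr, I.nconc, I.inv, hYE _ ho', hqo, I.irr⟩
  obtain ⟨f, hf, hfq, hfe, -, hfY⟩ := I.S.exists_f hqo
  have hfY' := hfY Y ho' hY hr
  refine I'.drop S hS f hf hfq hfe Y hfY' fun x => ?_
  refine ⟨Submodule.span ℝ {f x}, ?_, ?_, ?_⟩
  · exact (Submodule.span_singleton_le_iff_mem _ _).2 (hfY' x)
  · intro z hz
    obtain ⟨c, hc⟩ := Submodule.mem_span_singleton.1 hz
    exact ⟨c, by rw [← hc, real_smul_c]⟩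
  · rw [finrank_span_singleton (Herm.Avop.ne_zero_of_neg (hfq x))]
    exact h

/-- a matrix of determinant one and finite order has trace at most two in absolute value -/
theorem trace_le_of_pow (M : Matrix (Fin 2) (Fin 2) ℝ) (hd : M.det = 1) (k : ℕ) (hk : k ≠ 0)
    (h : M ^ k = 1) : |M.trace| ≤ 2 := by
  by_contra hc
  push Not at hc
  have h4 : 4 < M.trace ^ 2 := by
    rw [← sq_abs]; nlinarith
  set s := Real.sqrt (M.trace ^ 2 - 4) with hs
  have hs2 : s ^ 2 = M.trace ^ 2 - 4 := Real.sq_sqrt (by linarith)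
  set l := (M.trace + s) / 2 with hl
  have hl2 : l ^ 2 - M.trace * l + 1 = 0 := by rw [hl]; nlinarith
  have hdet : (M - l • (1 : Matrix (Fin 2) (Fin 2) ℝ)).det = 0 := by
    rw [Matrix.det_fin_two] at hd ⊢
    rw [Matrix.trace_fin_two] at hl2
    simp
    linear_combination hl2 + hd
  obtain ⟨v, hv, hv2⟩ := Matrix.exists_mulVec_eq_zero_iff.2 hdet
  have hMv : M *ᵥ v = l • v := by
    rw [Matrix.sub_mulVec, Matrix.smul_mulVec, Matrix.one_mulVec, sub_eq_zero] at hv2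
    exact hv2
  have hp : ∀ j : ℕ, (M ^ j) *ᵥ v = l ^ j • v := by
    intro j
    induction j with
    | zero => simp
    | succ j ih =>
      rw [pow_succ', ← Matrix.mulVec_mulVec, ih, Matrix.mulVec_smul, hMv, smul_smul, pow_succ]
  have h1 := hp k
  rw [h, Matrix.one_mulVec] at h1
  have h2 : l ^ k = 1 := by
    by_contra hne
    have : (l ^ k - 1) • v = 0 := by rw [sub_smul, one_smul, ← h1, sub_self]
    exact (smul_ne_zero (sub_ne_zero.2 hne) hv) this
  have h3 : |l| = 1 := by
    have : |l| ^ k = 1 := by rw [← abs_pow, h2, abs_one]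
    exact (pow_eq_one_iff_of_nonneg (abs_nonneg _) hk).1 this
  have h5 : l ^ 2 = 1 := by rw [← sq_abs, h3]; norm_num
  have h6 : M.trace * l = 2 := by linarith
  have h7 : M.trace ^ 2 = 4 := by
    have : (M.trace * l) ^ 2 = 4 := by rw [h6]; norm_num
    rw [mul_pow, h5, mul_one] at this
    exact this
  linarith

end HLC
end

noncomputable section
namespace HLC
open Filter Topology
set_option linter.unusedSectionVars false
open scoped ComplexConjugate

variable {G V : Type*} [Group G] [NormedAddCommGroup V] [NormedSpace ℂ V] [FiniteDimensional ℂ V]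
  {B : Herm V} {A : AffAct G V} {E : Submodule ℂ V} {o : V}

theorem Irr.imag_basis (I : Irr B A E o) (Y : Submodule ℝ V) (hYE : ∀ y ∈ Y, y ∈ E)
    (h0 : ∀ y ∈ Y, Complex.I • y ∈ Y → y = 0)
    (hsp : ∀ x ∈ E, ∃ a ∈ Y, ∃ b ∈ Y, x = a + Complex.I • b)
    (him : ∀ a ∈ Y, ∀ b ∈ Y, (B.h a b).re = 0) :
    ∃ b : Module.Basis (Fin 2) ℝ Y, B.h (b 0 : V) (b 1 : V) ≠ 0 := by
  have hq0 : ∀ a ∈ Y, B.q a = 0 := fun a ha => him a ha a ha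
  obtain ⟨a, ha, ha0⟩ : ∃ a ∈ Y, a ≠ 0 := by
    by_contra hc
    push Not at hc
    obtain ⟨a, ha, b, hb, hab⟩ := hsp o I.oE
    rw [hc a ha, hc b hb] at hab
    exact I.o_ne (by simpa using hab)
  obtain ⟨b, hb, hab⟩ : ∃ b ∈ Y, B.h a b ≠ 0 := by
    by_contra hc
    push Not at hc
    apply ha0
    apply I.E_nondeg (hYE a ha)
    intro x hx
    apply B.h_eq_zero_symm
    obtain ⟨c, hcY, d, hd, rfl⟩ := hsp x hx
    simp [hc c hcY, hc d hd]
  have himab : ∀ x ∈ Y, ∀ y ∈ Y, B.h x y = ((B.h x y).im : ℂ) * Complex.I := by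
    intro x hx y hy
    apply Complex.ext <;> simp [him x hx y hy]
  have hab' : (B.h a b).im ≠ 0 := by
    intro h
    apply hab
    rw [himab a ha b hb, h]; simp
  have haa : B.h a a = 0 := by rw [B.h_self, hq0 a ha]; simp
  have hgen : ∀ y ∈ Y, ∃ s t : ℝ, y = s • a + t • b := by
    intro y hy
    set t := (B.h a y).im / (B.h a b).im with ht
    have hz : y - t • b ∈ Y := Y.sub_mem hy (Y.smul_mem _ hb)
    have h1 : B.h a (y - t • b) = 0 := by
      rw [map_sub, real_smul_c, map_smul, himab a ha y hy, himab a ha b hb, ht]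
      have : ((B.h a b).im : ℂ) ≠ 0 := Complex.ofReal_ne_zero.2 hab'
      push_cast
      simp only [smul_eq_mul]
      field_simp
      simp
    obtain ⟨c, hc⟩ := (B.core (hq0 a ha).le ha0 h1).2 (hq0 _ hz)
    have h2 : y - t • b - c.re • a = Complex.I • (c.im • a) := by
      rw [hc]
      have hcc : c • a = ((c.re : ℂ) + c.im * Complex.I) • a := by rw [Complex.re_add_im]
      rw [hcc]
      simp only [real_smul_c]
      module
    have h3 : c.im • a = 0 := by
      apply h0 _ (Y.smul_mem _ ha)
      rw [← h2]
      exact Y.sub_mem hz (Y.smul_mem _ ha)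
    rw [h3, smul_zero, sub_sub, sub_eq_zero] at h2
    exact ⟨c.re, t, by rw [h2, add_comm]⟩
  have hli : LinearIndependent ℝ ![(⟨a, ha⟩ : Y), ⟨b, hb⟩] := by
    rw [LinearIndependent.pair_iff]
    intro s t hst
    have h1 : s • a + t • b = 0 := congrArg Subtype.val hst
    have h2 : t = 0 := by
      have : B.h a (s • a + t • b) = 0 := by rw [h1, map_zero]
      rw [real_smul_c, real_smul_c, map_add, map_smul, map_smul, haa] at this
      simpa [hab] using this
    refine ⟨?_, h2⟩
    rw [h2, zero_smul, add_zero] at h1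
    exact (smul_eq_zero.1 h1).resolve_right ha0
  have hspan : ⊤ ≤ Submodule.span ℝ (Set.range ![(⟨a, ha⟩ : Y), ⟨b, hb⟩]) := by
    rintro ⟨y, hy⟩ -
    obtain ⟨s, t, hst⟩ := hgen y hy
    have : (⟨y, hy⟩ : Y) = s • ⟨a, ha⟩ + t • ⟨b, hb⟩ := Subtype.ext hst
    rw [this]
    exact add_mem (Submodule.smul_mem _ _ (Submodule.subset_span ⟨0, rfl⟩))
      (Submodule.smul_mem _ _ (Submodule.subset_span ⟨1, rfl⟩))
  refine ⟨Module.Basis.mk hli hspan, ?_⟩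
  simpa using hab

theorem Irr.imag (I : Irr B A E o) (Y : Submodule ℝ V) (hYE : ∀ y ∈ Y, y ∈ E)
    (hY : ∀ g, ∀ y ∈ Y, A.L g y ∈ Y) (h0 : ∀ y ∈ Y, Complex.I • y ∈ Y → y = 0)
    (hsp : ∀ x ∈ E, ∃ a ∈ Y, ∃ b ∈ Y, x = a + Complex.I • b)
    (him : ∀ a ∈ Y, ∀ b ∈ Y, (B.h a b).re = 0)
    {Q : Type*} [NormedAddCommGroup Q] [NormedSpace ℝ Q] [FiniteDimensional ℝ Q]
    {C : AffAct G Q} (S : A.Semi C) (hS : ∀ t, A.L t = 1 → C.u t = 0)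
    (hker : ∀ y ∈ Y, S.π (Complex.I • y) = 0 → y = 0)
    (hfin : ∀ R : ℝ, (A.L '' {g | ∃ x : Q, ‖x‖ ≤ R ∧ ‖C.act g x‖ ≤ R}).Finite) : False := by
  have : FiniteDimensional ℝ V := Setup.finReal
  obtain ⟨b, hb⟩ := I.imag_basis Y hYE h0 hsp him
  have hfrY : Module.finrank ℝ Y = 2 := by
    rw [Module.finrank_eq_card_basis b]; simp
  -- multiplication by `i`
  let J : V →ₗ[ℝ] V := (LinearMap.lsmul ℂ V Complex.I).restrictScalars ℝ
  have hJ : ∀ x, J x = Complex.I • x := fun x => rfl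
  have hfrE : Module.finrank ℝ (E.restrictScalars ℝ) ≤ 4 := by
    have h1 : E.restrictScalars ℝ ≤ Y ⊔ Y.map J := by
      intro x hx
      obtain ⟨a, ha, c, hc, rfl⟩ := hsp x hx
      exact Submodule.add_mem_sup ha ⟨c, hc, rfl⟩
    have h2 := Submodule.finrank_mono h1
    have h3 := Submodule.finrank_add_le_finrank_add_finrank Y (Y.map J)
    have h4 := Submodule.finrank_map_le J Y
    omega
  have hfrQ : Module.finrank ℝ Q ≤ 2 := by
    by_contra hc
    exact I.dropE S hS (by omega)
  let p : Y →ₗ[ℝ] Q := (S.π : V →ₗ[ℝ] Q).comp (J.comp Y.subtype)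
  have hp : ∀ y : Y, p y = S.π (Complex.I • (y : V)) := fun y => rfl
  have hpi : Function.Injective p := by
    rw [injective_iff_map_eq_zero]
    intro y hy
    exact Subtype.ext (hker y y.2 hy)
  have hps : Function.Surjective p := by
    have h1 := LinearMap.finrank_le_finrank_of_injective hpi
    exact (LinearMap.injective_iff_surjective_of_finrank_eq_finrank (by omega)).1 hpi
  let LY : G →* (Y →ₗ[ℝ] Y) :=
    { toFun := fun g => ((A.L g : V →L[ℝ] V) : V →ₗ[ℝ] V).restrict (hY g)
      map_one' := by ext x; simp
      map_mul' := by intro g g'; ext x; simp }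
  have hLY : ∀ g (y : Y), (LY g y : V) = A.L g y := fun g y => rfl
  let ρ : G →* Matrix (Fin 2) (Fin 2) ℝ := (LinearMap.toMatrixAlgEquiv b : _ →* _).comp LY
  have hρ : ∀ g, ρ g = LinearMap.toMatrixAlgEquiv b (LY g) := fun g => rfl
  have hρr : ∀ g y, ρ g *ᵥ (b.repr y) = b.repr (LY g y) := by
    intro g y
    rw [hρ]
    exact LinearMap.toMatrix_mulVec_repr b b (LY g) y
  have hLb : ∀ g j, A.L g (b j : V) = (ρ g 0 j) • (b 0 : V) + (ρ g 1 j) • (b 1 : V) := by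
    intro g j
    have h1 := b.sum_repr (LY g (b j))
    rw [Fin.sum_univ_two] at h1
    have h2 := congrArg Subtype.val h1
    rw [← hLY, ← h2]
    simp [hρ, LinearMap.toMatrixAlgEquiv_apply]
  have hbb : ∀ j, B.h (b j : V) (b j : V) = 0 := by
    intro j
    rw [B.h_self, show B.q (b j : V) = 0 from him _ (b j).2 _ (b j).2]; simp
  have hb10 : B.h (b 1 : V) (b 0 : V) = - B.h (b 0 : V) (b 1 : V) := by
    rw [← B.symm]
    apply Complex.ext <;> simp [him _ (b 0).2 _ (b 1).2]
  have hdet : ∀ g, (ρ g).det = 1 := by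
    intro g
    have h1 := I.S.inv g (b 0) (b 1)
    rw [hLb, hLb] at h1
    simp only [real_smul_c, map_add, LinearMap.add_apply, map_smulₛₗ, LinearMap.smul_apply,
      hbb, hb10, Complex.conj_ofReal, smul_eq_mul, RingHom.id_apply] at h1
    rw [Matrix.det_fin_two]
    have h2 : ((ρ g 0 0 * ρ g 1 1 - ρ g 0 1 * ρ g 1 0 : ℝ) : ℂ) = 1 := by
      apply mul_right_cancel₀ hb
      push_cast
      linear_combination h1
    exact_mod_cast h2
  have htr : ∀ g, |(ρ g).trace| ≤ 2 := by
    intro g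
    by_contra hc
    have ht2 : (ρ g).trace ≠ 2 := by
      intro h; rw [h] at hc; norm_num at hc
    -- `g` has a fixed point in the quotient
    have hfixL : ∀ y : Y, LY g y = y → y = 0 := by
      intro y hy
      by_contra hne
      have h1 := hρr g y
      rw [hy] at h1
      have h2 : (ρ g - 1).det = 0 := by
        apply Matrix.exists_mulVec_eq_zero_iff.1
        refine ⟨b.repr y, ?_, ?_⟩
        · intro h
          apply hne
          apply b.repr.injective
          rw [map_zero]
          exact DFunLike.coe_injective h
        · rw [Matrix.sub_mulVec, h1, Matrix.one_mulVec, sub_self]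
      have h3 := hdet g
      rw [Matrix.det_fin_two] at h2 h3
      rw [Matrix.trace_fin_two] at ht2
      simp at h2
      apply ht2
      linarith
    have hinj : Function.Injective (((C.L g : Q →L[ℝ] Q) : Q →ₗ[ℝ] Q) - LinearMap.id (R := ℝ) (M := Q)) := by
      rw [injective_iff_map_eq_zero]
      intro c hc'
      obtain ⟨y, rfl⟩ := hps c
      have h1 : C.L g (p y) = p y := sub_eq_zero.1 hc'
      have h2 : p (LY g y) = p y := by
        rw [← h1, hp, hp, S.L, I.S.smul, hLY]
      rw [hfixL y (hpi h2), map_zero]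
    obtain ⟨c, hc2⟩ := LinearMap.injective_iff_surjective.1 hinj (- C.u g)
    have hfix : C.act g c = c := by
      have h1 : C.L g c - c = - C.u g := hc2
      rw [C.act_def]
      have h2 : C.L g c + C.u g = (C.L g c - c) + C.u g + c := by abel
      rw [h2, h1]; abel
    have hfixk : ∀ k : ℕ, C.act (g ^ k) c = c := by
      intro k
      induction k with
      | zero => simp [C.act_one]
      | succ k ih => rw [pow_succ, C.act_mul, hfix, ih]
    have hmem : ∀ k : ℕ, A.L (g ^ k) ∈ A.L '' {g | ∃ x : Q, ‖x‖ ≤ ‖c‖ ∧ ‖C.act g x‖ ≤ ‖c‖} :=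
      fun k => ⟨g ^ k, ⟨c, le_rfl, by rw [hfixk]⟩, rfl⟩
    obtain ⟨i, j, hij, he⟩ := Set.Finite.exists_lt_map_eq_of_forall_mem hmem (hfin ‖c‖)
    have hk : A.L (g ^ (j - i)) = 1 := by
      have h1 : g ^ (j - i) = (g ^ i)⁻¹ * g ^ j := by
        rw [eq_inv_mul_iff_mul_eq, ← pow_add]; congr 1; omega
      rw [h1, map_mul, ← he, ← map_mul, inv_mul_cancel, map_one]
    apply hc
    refine trace_le_of_pow (ρ g) (hdet g) (j - i) (by omega) ?_
    rw [← map_pow, hρ]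
    have : LY (g ^ (j - i)) = 1 := by
      ext y
      rw [hLY, hk]; rfl
    rw [this, map_one]
  rcases sl2 ρ hdet htr with ⟨v, hv, hev⟩ | ⟨K, hK⟩
  · let y : Y := v 0 • b 0 + v 1 • b 1
    have hrep : (b.repr y : Fin 2 → ℝ) = v := by
      ext i
      fin_cases i <;> simp [y]
    have hy0 : (y : V) ≠ 0 := by
      intro h
      have : y = 0 := Subtype.ext h
      rw [this] at hrep
      apply hv
      rw [← hrep]; simp
    refine I.S.noNull I.nconc ⊤ (y : V) hy0 (him _ y.2 _ y.2) ?_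
    intro g _
    obtain ⟨c, hc⟩ := hev g
    refine ⟨(c : ℂ), ?_⟩
    rw [← real_smul_c, ← hLY]
    have : LY g y = c • y := by
      apply b.repr.injective
      apply DFunLike.coe_injective
      rw [← hρr, map_smul, Finsupp.coe_smul, hrep, hc]
    rw [this]; rfl
  · obtain ⟨x, hx, z, hz, hxz⟩ := hsp o I.oE
    have hc : ∃ c0 c1 : ℂ, o = c0 • (b 0 : V) + c1 • (b 1 : V) := by
      have h1 := congrArg Subtype.val (b.sum_repr ⟨x, hx⟩)
      have h2 := congrArg Subtype.val (b.sum_repr ⟨z, hz⟩)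
      rw [Fin.sum_univ_two] at h1 h2
      simp only [Submodule.coe_add, Submodule.coe_smul, real_smul_c] at h1 h2
      rw [hxz, ← h1, ← h2]
      generalize ((b.repr ⟨x, hx⟩ 0 : ℝ) : ℂ) = x0
      generalize ((b.repr ⟨x, hx⟩ 1 : ℝ) : ℂ) = x1
      generalize ((b.repr ⟨z, hz⟩ 0 : ℝ) : ℂ) = z0
      generalize ((b.repr ⟨z, hz⟩ 1 : ℝ) : ℂ) = z1
      exact ⟨x0 + Complex.I * z0, x1 + Complex.I * z1, by module⟩
    obtain ⟨c0, c1, ho⟩ := hc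
    refine I.infinite_of_bd ⊤ (‖c0‖ * (K * ‖B.h o (b 0 : V)‖ + K * ‖B.h o (b 1 : V)‖) +
      ‖c1‖ * (K * ‖B.h o (b 0 : V)‖ + K * ‖B.h o (b 1 : V)‖)) ?_
    intro g _
    have h1 : A.L g o = c0 • A.L g (b 0 : V) + c1 • A.L g (b 1 : V) := by
      conv_lhs => rw [ho]
      rw [map_add, I.S.smul, I.S.smul]
    have h2 : ∀ j, ‖B.h o (A.L g (b j : V))‖ ≤ K * ‖B.h o (b 0 : V)‖ + K * ‖B.h o (b 1 : V)‖ := by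
      intro j
      rw [hLb, real_smul_c, real_smul_c, map_add, map_smul, map_smul]
      refine (norm_add_le _ _).trans ?_
      rw [norm_smul, norm_smul, Complex.norm_real, Complex.norm_real]
      have e1 := hK g 0 j
      have e2 := hK g 1 j
      rw [← Real.norm_eq_abs] at e1 e2
      gcongr
    rw [h1, map_add, map_smul, map_smul]
    refine (norm_add_le _ _).trans ?_
    rw [norm_smul, norm_smul]
    have e1 := h2 0
    have e2 := h2 1
    gcongr

theorem Irr.false (I : Irr B A E o) : False := by
  have : FiniteDimensional ℝ V := Setup.finReal
  obtain ⟨C, Bq, S, hker, -, -, hfin⟩ := A.exists_tquot I.S.crys.proper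
  have hS : ∀ t, A.L t = 1 → Bq.u t = 0 := fun t ht => by
    rw [S.u, hker]; exact A.u_mem_W ht
  have hdec : ∀ (c : ℂ) (x : V), c • x = c.re • x + c.im • (Complex.I • x) := by
    intro c x
    conv_lhs => rw [← Complex.re_add_im c]
    simp only [real_smul_c]
    module
  have hII : ∀ x : V, Complex.I • (Complex.I • x) = -x := by
    intro x; rw [smul_smul, Complex.I_mul_I, neg_one_smul]
  let Y : Submodule ℝ V := A.W ⊓ E.restrictScalars ℝ
  have hYE : ∀ y ∈ Y, y ∈ E := fun y hy => hy.2
  have hY : ∀ g, ∀ y ∈ Y, A.L g y ∈ Y := fun g y hy => ⟨A.L_mem_W g hy.1, I.inv g y hy.2⟩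
  let Z1 : Submodule ℂ V :=
    { carrier := {x | x ∈ Y ∧ Complex.I • x ∈ Y}
      add_mem' := by
        rintro x y ⟨h1, h2⟩ ⟨h3, h4⟩
        exact ⟨Y.add_mem h1 h3, by rw [smul_add]; exact Y.add_mem h2 h4⟩
      zero_mem' := ⟨Y.zero_mem, by rw [smul_zero]; exact Y.zero_mem⟩
      smul_mem' := by
        rintro c x ⟨h1, h2⟩
        refine ⟨?_, ?_⟩
        · rw [hdec]
          exact Y.add_mem (Y.smul_mem _ h1) (Y.smul_mem _ h2)
        · rw [smul_comm, hdec, hII]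
          exact Y.add_mem (Y.smul_mem _ h2) (Y.smul_mem _ (Y.neg_mem h1)) }
  let Z2 : Submodule ℂ V :=
    { carrier := {x | ∃ a ∈ Y, ∃ b ∈ Y, x = a + Complex.I • b}
      add_mem' := by
        rintro x y ⟨a, ha, b, hb, rfl⟩ ⟨a', ha', b', hb', rfl⟩
        exact ⟨_, Y.add_mem ha ha', _, Y.add_mem hb hb', by module⟩
      zero_mem' := ⟨0, Y.zero_mem, 0, Y.zero_mem, by simp⟩
      smul_mem' := by
        rintro c x ⟨a, ha, b, hb, rfl⟩
        refine ⟨_, Y.sub_mem (Y.smul_mem c.re ha) (Y.smul_mem c.im hb), _,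
          Y.add_mem (Y.smul_mem c.re hb) (Y.smul_mem c.im ha), ?_⟩
        rw [hdec, smul_add Complex.I a, hII]
        simp only [real_smul_c]
        module }
  rcases I.irr ⊤ inferInstance Z1 (fun x hx => hYE _ hx.1) (fun g _ x hx =>
    ⟨hY g _ hx.1, by rw [← I.S.smul]; exact hY g _ hx.2⟩) with h1 | h1
  swap
  · apply I.caseC
    intro x hx
    rw [← h1] at hx
    exact hx.1.1
  have h0 : ∀ y ∈ Y, Complex.I • y ∈ Y → y = 0 := by
    intro y hy hy2
    have : y ∈ Z1 := ⟨hy, hy2⟩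
    rw [h1] at this
    simpa using this
  have hkerY : ∀ y ∈ Y, S.π (Complex.I • y) = 0 → y = 0 := by
    intro y hy hy2
    exact h0 y hy ⟨(hker _).1 hy2, E.smul_mem _ (hYE _ hy)⟩
  rcases I.irr ⊤ inferInstance Z2 (by
      rintro _ ⟨a, ha, b, hb, rfl⟩
      exact E.add_mem (hYE _ ha) (E.smul_mem _ (hYE _ hb))) (by
      rintro g _ _ ⟨a, ha, b, hb, rfl⟩
      exact ⟨_, hY g _ ha, _, hY g _ hb, by rw [map_add, I.S.smul]⟩) with h2 | h2
  · apply I.dropE S hS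
    have hY0 : ∀ y ∈ Y, y = 0 := by
      intro y hy
      have : y ∈ Z2 := ⟨y, hy, 0, Y.zero_mem, by simp⟩
      rw [h2] at this
      simpa using this
    let p : (E.restrictScalars ℝ) →ₗ[ℝ] C := (S.π : V →ₗ[ℝ] C).comp (E.restrictScalars ℝ).subtype
    have hpi : Function.Injective p := by
      rw [injective_iff_map_eq_zero]
      intro y hy
      exact Subtype.ext (hY0 y ⟨(hker _).1 hy, y.2⟩)
    have := LinearMap.finrank_le_finrank_of_injective hpi
    omega
  have hsp : ∀ x ∈ E, ∃ a ∈ Y, ∃ b ∈ Y, x = a + Complex.I • b := by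
    intro x hx
    rw [← h2] at hx
    exact hx
  rcases I.real_or_imag Y hYE hY h0 hsp with hr | hi
  · obtain ⟨o', ho', hqo'⟩ : ∃ o' ∈ Y, B.q o' < 0 := by
      obtain ⟨a, ha, b, hb, hab⟩ := hsp o I.oE
      have hq := I.qo
      rw [hab, B.q_add, B.q_smul] at hq
      simp [hr a ha b hb] at hq
      by_contra hc
      push Not at hc
      linarith [hc a ha, hc b hb]
    refine I.dropY S hS Y hYE hY hr o' ho' hqo' ?_
    let J : V →ₗ[ℝ] V := (LinearMap.lsmul ℂ V Complex.I).restrictScalars ℝ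
    let p : Y →ₗ[ℝ] C := (S.π : V →ₗ[ℝ] C).comp (J.comp Y.subtype)
    have hpi : Function.Injective p := by
      rw [injective_iff_map_eq_zero]
      intro y hy
      exact Subtype.ext (hkerY y y.2 hy)
    have := LinearMap.finrank_le_finrank_of_injective hpi
    omega
  · exact I.imag Y hYE hY h0 hsp hi S hS hkerY hfin

/-- the main theorem, abstractly -/
theorem Setup.concl (S : Setup B A) : Concl G := by
  rcases S.step4 with h | h
  · exact S.concl_of_parab h
  · by_contra hn
    obtain ⟨H, hH, E, o, I⟩ := S.exists_irr h hn
    exact I.false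

end HLC
end

noncomputable section
namespace HLC
open Filter Topology
set_option linter.unusedSectionVars false
open scoped ComplexConjugate

theorem final_abs {V : Type*} [NormedAddCommGroup V] [NormedSpace ℂ V] [FiniteDimensional ℂ V]
    (B : Herm V) (Γ : Subgroup (Equiv.Perm V)) (l : Γ → (V →ₗ[ℂ] V))
    (hl : ∀ (γ : Γ) x, (γ : Equiv.Perm V) x = l γ x + (γ : Equiv.Perm V) 0)
    (hdet : ∀ γ, ‖LinearMap.det (l γ)‖ = 1)
    (hinv : ∀ γ x y, B.h (l γ x) (l γ y) = B.h x y)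
    (hpd : ∀ K : Set V, IsCompact K →
      {γ : Equiv.Perm V | γ ∈ Γ ∧ ((⇑γ '' K) ∩ K).Nonempty}.Finite)
    (hcc : CompactSpace (Quotient (MulAction.orbitRel Γ V))) : Concl Γ := by
  have : FiniteDimensional ℝ V := Setup.finReal
  have hproper : ProperSpace V := FiniteDimensional.proper_real V
  have hl' : ∀ γ x, l γ x = (γ : Equiv.Perm V) x - (γ : Equiv.Perm V) 0 := by
    intro γ x; rw [hl γ x]; abel
  have hldiff : ∀ (γ : Γ) x y, (γ : Equiv.Perm V) x - (γ : Equiv.Perm V) y = l γ (x - y) := by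
    intro γ x y; rw [hl γ x, hl γ y, map_sub]; abel
  let A : AffAct Γ V :=
    { L :=
        { toFun := fun γ => LinearMap.toContinuousLinearMap ((l γ).restrictScalars ℝ)
          map_one' := by
            ext x
            change l 1 x = x
            rw [hl']; simp
          map_mul' := by
            intro γ δ
            ext x
            change l (γ * δ) x = l γ (l δ x)
            rw [hl' δ, ← hldiff, hl']; rfl }
      u := fun γ => (γ : Equiv.Perm V) 0
      u_mul := by
        intro γ δ
        change (γ : Equiv.Perm V) ((δ : Equiv.Perm V) 0) = _ + l γ ((δ : Equiv.Perm V) 0)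
        rw [hl γ, add_comm] }
  have hL : ∀ γ x, A.L γ x = l γ x := fun γ x => rfl
  have hact : ∀ (γ : Γ) x, A.act γ x = (γ : Equiv.Perm V) x := fun γ x => (hl γ x).symm
  have S : Setup B A := by
    refine ⟨⟨?_, ?_, ?_, ?_⟩, ?_, ?_⟩
    · intro R
      have h1 := hpd (Metric.closedBall 0 R) (isCompact_closedBall 0 R)
      refine Set.Finite.of_finite_image (f := Subtype.val) (h1.subset ?_)
        Subtype.val_injective.injOn
      rintro _ ⟨g, ⟨x, hx, hgx⟩, rfl⟩
      rw [hact] at hgx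
      exact ⟨g.2, _, ⟨x, by simpa using hx, rfl⟩, by simpa using hgx⟩
    · have hcs : ContinuousConstSMul Γ V := by
        constructor
        intro γ
        have : (fun x : V => γ • x) = fun x => A.L γ x + A.u γ := by
          ext x; exact (hact γ x).symm
        rw [this]
        exact (A.L γ).continuous.add continuous_const
      let π : V → Quotient (MulAction.orbitRel Γ V) := Quotient.mk (MulAction.orbitRel Γ V)
      have hπ : IsOpenQuotientMap π := MulAction.isOpenQuotientMap_quotientMk
      obtain ⟨n, hn⟩ := isCompact_univ.elim_directed_cover
        (fun n : ℕ => π '' Metric.ball 0 (n : ℝ))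
        (fun n => hπ.isOpenMap _ Metric.isOpen_ball) (by
          intro z _
          obtain ⟨x, rfl⟩ := hπ.surjective z
          obtain ⟨n, hn⟩ := exists_nat_gt ‖x‖
          exact Set.mem_iUnion.2 ⟨n, x, by simpa using hn, rfl⟩) (by
          apply Monotone.directed_le
          intro m n hmn
          exact Set.image_mono (Metric.ball_subset_ball (by exact_mod_cast hmn)))
      refine ⟨n, fun x => ?_⟩
      obtain ⟨y, hy, hyx⟩ := hn (Set.mem_univ (π x))
      have h1 : y ∈ MulAction.orbit Γ x := MulAction.orbitRel_apply.1 (Quotient.exact hyx)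
      obtain ⟨γ, hγ⟩ := h1
      refine ⟨γ, ?_⟩
      have h2 : A.act γ x = y := (hact γ x).trans hγ
      rw [h2]
      have := mem_ball_zero_iff.1 hy
      exact this.le
    · intro γ
      have h1 : (A.L γ).det = LinearMap.det ((l γ).restrictScalars ℝ) := rfl
      rw [h1, LinearMap.det_restrictScalars, Algebra.norm_complex_apply, Complex.normSq_eq_norm_sq,
        hdet]
      simp
    · intro γ h
      apply Subtype.ext
      ext x
      rw [← hact, h]; rfl
    · intro γ c x
      rw [hL, hL, map_smul]
    · intro γ x y
      rw [hL, hL, hinv]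
  exact S.concl

section
variable {n : ℕ}

theorem HMat_mulVec (hn : 1 ≤ n) (y : HV n) (i : Fin (n + 1)) :
    (HMat n *ᵥ y) i = y (Equiv.swap 0 (Fin.last n) i) := by
  have h0 : (0 : Fin (n + 1)) ≠ Fin.last n := by
    intro h
    have := congrArg Fin.val h
    simp at this
    omega
  have : ∀ j, HMat n i j = if Equiv.swap 0 (Fin.last n) i = j then 1 else 0 := by
    intro j
    unfold HMat
    by_cases hi : i = 0
    · subst hi
      simp [h0, eq_comm]
    · by_cases hi2 : i = Fin.last n
      · subst hi2
        simp [h0.symm, eq_comm]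
      · rw [Equiv.swap_apply_of_ne_of_ne hi hi2]
        simp [hi, hi2]
  rw [Matrix.mulVec, dotProduct]
  simp [this]

def form (n : ℕ) : HV n →ₗ⋆[ℂ] HV n →ₗ[ℂ] ℂ :=
  LinearMap.mk₂'ₛₗ (starRingEnd ℂ) (RingHom.id ℂ) (fun x y => star x ⬝ᵥ (HMat n *ᵥ y))
    (by intro x y z; simp [add_dotProduct])
    (by intro c x y; simp [smul_dotProduct])
    (by intro x y z; simp [mulVec_add, dotProduct_add])
    (by intro c x y; simp [mulVec_smul, dotProduct_smul])

theorem form_apply (x y : HV n) : form n x y = star x ⬝ᵥ (HMat n *ᵥ y) := rfl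

theorem form_sum (hn : 1 ≤ n) (x y : HV n) :
    form n x y = ∑ i, conj (x i) * y (Equiv.swap 0 (Fin.last n) i) := by
  rw [form_apply, dotProduct]
  simp only [HMat_mulVec hn]
  rfl

theorem sum_conj_pos (z : HV n) (hz : z ≠ 0) : 0 < (∑ i, conj (z i) * z i).re := by
  have h1 : ∀ i, (conj (z i) * z i).re = ‖z i‖ ^ 2 := by
    intro i
    rw [Complex.conj_mul']
    norm_cast
  rw [Complex.re_sum]
  simp only [h1]
  obtain ⟨i, hi⟩ := Function.ne_iff.1 hz
  exact Finset.sum_pos' (fun i _ => by positivity)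
    ⟨i, Finset.mem_univ _, by have := norm_pos_iff.2 hi; positivity⟩

def herm (hn : 1 ≤ n) : Herm (HV n) where
  h := form n
  symm := by
    intro x y
    rw [form_sum hn, form_sum hn, map_sum, ← Equiv.sum_comp (Equiv.swap 0 (Fin.last n))]
    apply Finset.sum_congr rfl
    intro i _
    simp [mul_comm]
  nondeg := by
    intro x hx
    ext i
    have h1 := hx (Pi.single (Equiv.swap 0 (Fin.last n) i) 1)
    rw [form_sum hn, Finset.sum_eq_single i] at h1
    · simpa using h1
    · intro j _ hj
      rw [Pi.single_eq_of_ne, mul_zero]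
      intro h
      exact hj (Equiv.injective _ h)
    · simp
  ν := (LinearMap.proj 0 : HV n →ₗ[ℂ] ℂ) - (LinearMap.proj (Fin.last n) : HV n →ₗ[ℂ] ℂ)
  pos := by
    intro z hz hz0
    have h1 : z 0 = z (Fin.last n) := by
      exact sub_eq_zero.1 ((LinearMap.sub_apply _ _ z).symm.trans hz)
    have h2 : ∀ i, z (Equiv.swap 0 (Fin.last n) i) = z i := by
      intro i
      rw [Equiv.swap_apply_def]
      split_ifs with h h'
      · rw [h, h1]
      · rw [h', h1]
      · rfl
    rw [form_sum hn]
    simp only [h2]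
    exact sum_conj_pos z hz0
  neg := by
    have h0 : (0 : Fin (n + 1)) ≠ Fin.last n := by
      intro h
      have := congrArg Fin.val h
      simp at this
      omega
    let o : HV n := Pi.single 0 1 - Pi.single (Fin.last n) 1
    have h2 : ∀ i, o (Equiv.swap 0 (Fin.last n) i) = - o i := by
      intro i
      rw [Equiv.swap_apply_def]
      split_ifs with h h'
      · simp [o, h, h0, h0.symm]
      · simp [o, h', h0, h0.symm]
      · simp [o, h, h']
    refine ⟨o, ?_⟩
    rw [form_sum hn]
    simp only [h2, mul_neg, Finset.sum_neg_distrib, Complex.neg_re]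
    have h3 : o ≠ 0 := by
      intro h
      have := congrFun h 0
      simp [o, h0] at this
    have := sum_conj_pos o h3
    linarith

theorem form_inv {M : Matrix (Fin (n + 1)) (Fin (n + 1)) ℂ} (hM : M ∈ USet n) (x y : HV n) :
    form n (M *ᵥ x) (M *ᵥ y) = form n x y := by
  have hM' : Mᴴ * HMat n * M = HMat n := hM
  rw [form_apply, form_apply, star_mulVec, ← dotProduct_mulVec, mulVec_mulVec, mulVec_mulVec,
    hM']

theorem det_norm (hn : 1 ≤ n) {M : Matrix (Fin (n + 1)) (Fin (n + 1)) ℂ} (hM : M ∈ USet n) :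
    ‖M.det‖ = 1 := by
  have hM' : Mᴴ * HMat n * M = HMat n := hM
  have hH : (HMat n).det ≠ 0 := by
    intro h
    obtain ⟨v, hv, hv2⟩ := Matrix.exists_mulVec_eq_zero_iff.2 h
    apply hv
    ext i
    have := congrFun hv2 (Equiv.swap 0 (Fin.last n) i)
    rw [HMat_mulVec hn] at this
    simpa using this
  have h1 := congrArg (fun X => ‖X.det‖) hM'
  simp only [Matrix.det_mul, Matrix.det_conjTranspose, norm_mul, norm_star] at h1
  have hH' : 0 < ‖(HMat n).det‖ := norm_pos_iff.2 hH
  have h2 : ‖M.det‖ ^ 2 = 1 := by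
    apply mul_right_cancel₀ hH'.ne'
    linarith
  exact (pow_eq_one_iff_of_nonneg (norm_nonneg _) two_ne_zero).1 h2

theorem final (hn : 1 ≤ n) (Γ : Subgroup (Equiv.Perm (HV n)))
    (hΓ : (Γ : Set (Equiv.Perm (HV n))) ⊆ HermAff n)
    (hpd : ProperlyDiscontinuous Γ) (hcc : Cocompact Γ) : Concl Γ := by
  have h1 : ∀ γ : Γ, ∃ M ∈ USet n, ∀ x, (γ : Equiv.Perm (HV n)) x =
      M *ᵥ x + (γ : Equiv.Perm (HV n)) 0 := by
    intro γ
    obtain ⟨M, hM, v, hv⟩ := hΓ γ.2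
    refine ⟨M, hM, fun x => ?_⟩
    rw [hv, hv 0, mulVec_zero, zero_add]
  choose M hM hv using h1
  refine final_abs (herm hn) Γ (fun γ => Matrix.mulVecLin (M γ)) ?_ ?_ ?_ hpd hcc
  · intro γ x
    exact hv γ x
  · intro γ
    rw [← Matrix.toLin'_apply', LinearMap.det_toLin']
    exact det_norm hn (hM γ)
  · intro γ x y
    exact form_inv (hM γ) x y

end

end HLC
end

/-- a crystallographic subgroup of ℋ(n,1) is either virtually
nilpotent or contains a finite-index subgroup that is abelian by cyclic. -/
theorem hermiteLorentz_crystallographic_dichotomy (n : ℕ) (hn : 1 ≤ n)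
    (Γ : Subgroup (Equiv.Perm (HV n)))
    (hΓ : (Γ : Set (Equiv.Perm (HV n))) ⊆ HermAff n)
    (hpd : ProperlyDiscontinuous Γ) (hcc : Cocompact Γ) :
    VirtuallyNilpotent Γ ∨
      ∃ Γ₀ : Subgroup Γ, Γ₀.FiniteIndex ∧ AbelianByCyclic Γ₀ := by
  exact HLC.final hn Γ hΓ hpd hcc
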